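/- arXiv:2106.13968 — 2 statements merged into one kernel-verified Lean document; each statement's English description precedes it below -/
import Mathlib

section
/- For every constant p ∈ (0,1), the probability P(G(n,p) has three pairwise disjoint nonempty sets X₁, X₂, X₃ of vertices with distinguished vertices x₁ ∈ X₁, x₂ ∈ X₂, x₃ ∈ X₃ such that every vertex outside X₁ ∪ X₂ ∪ X₃ has at least one neighbor in each Xᵢ, and for any distinct i, j ∈ {1,2,3} the only edge between Xᵢ and Xⱼ is the edge {xᵢ, xⱼ}) does not converge as n → ∞. -/
open MeasureTheory Filter Real

noncomputable instance simpleGraphMeasurableSpace {n : ℕ} :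
    MeasurableSpace (SimpleGraph (Fin n)) := ⊤

/-- The binomial random graph `G(n,p)`: the measure on simple graphs on `Fin n`
assigning to each graph `G` the probability `p^{e(G)} * (1-p)^{n(n-1)/2 - e(G)}`. -/
noncomputable def gnp (n : ℕ) (p : ℝ) : Measure (SimpleGraph (Fin n)) :=
  Measure.sum fun G : SimpleGraph (Fin n) =>
    ENNReal.ofReal (p ^ Nat.card G.edgeSet *
      (1 - p) ^ (n * (n - 1) / 2 - Nat.card G.edgeSet)) • Measure.dirac G

/-- The tuple `(X₁,x₁,X₂,x₂,X₃,x₃)` is special: the `Xᵢ` are pairwise disjoint, `xᵢ ∈ Xᵢ`,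
every vertex outside `X₁ ∪ X₂ ∪ X₃` has a neighbor in each `Xᵢ`, and for distinct `i,j`
the only edge between `Xᵢ` and `Xⱼ` is `{xᵢ, xⱼ}`. -/
def SpecialTuple {n : ℕ} (G : SimpleGraph (Fin n)) (X₁ X₂ X₃ : Finset (Fin n))
    (x₁ x₂ x₃ : Fin n) : Prop :=
  Disjoint X₁ X₂ ∧ Disjoint X₁ X₃ ∧ Disjoint X₂ X₃ ∧
  x₁ ∈ X₁ ∧ x₂ ∈ X₂ ∧ x₃ ∈ X₃ ∧
  (∀ v : Fin n, v ∉ X₁ → v ∉ X₂ → v ∉ X₃ →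
    (∃ u ∈ X₁, G.Adj v u) ∧ (∃ u ∈ X₂, G.Adj v u) ∧ (∃ u ∈ X₃, G.Adj v u)) ∧
  (∀ u ∈ X₁, ∀ v ∈ X₂, (G.Adj u v ↔ u = x₁ ∧ v = x₂)) ∧
  (∀ u ∈ X₁, ∀ v ∈ X₃, (G.Adj u v ↔ u = x₁ ∧ v = x₃)) ∧
  (∀ u ∈ X₂, ∀ v ∈ X₃, (G.Adj u v ↔ u = x₂ ∧ v = x₃))

/-- `X(k,ℓ,m)`: the number of special tuples `(X₁,x₁,X₂,x₂,X₃,x₃)` with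
`|X₁| = k`, `|X₂| = ℓ`, `|X₃| = m`. -/
noncomputable def countX {n : ℕ} (G : SimpleGraph (Fin n)) (k l m : ℕ) : ℕ :=
  Nat.card {t : Finset (Fin n) × Finset (Fin n) × Finset (Fin n) × Fin n × Fin n × Fin n //
    t.1.card = k ∧ t.2.1.card = l ∧ t.2.2.1.card = m ∧
    SpecialTuple G t.1 t.2.1 t.2.2.1 t.2.2.2.1 t.2.2.2.2.1 t.2.2.2.2.2}

/-- The expectation of `X(k,ℓ,m)` under `G(n,p)`. -/
noncomputable def expX (n : ℕ) (p : ℝ) (k l m : ℕ) : ℝ :=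
  ∫ G, (countX G k l m : ℝ) ∂ gnp n p

namespace RandomGraph

section Bernoulli

open Finset

variable {α : Type*}

/-- The expectation of `F A`, where `A` is a random subset of `E` which contains every element of
`E` independently with probability `p`. -/
noncomputable def subsetExp (p : ℝ) (E : Finset α) (F : Finset α → ℝ) : ℝ :=
  ∑ A ∈ E.powerset, p ^ #A * (1 - p) ^ (#E - #A) * F A

lemma subsetExp_congr {p : ℝ} {E : Finset α} {F F' : Finset α → ℝ}
    (h : ∀ A ⊆ E, F A = F' A) : subsetExp p E F = subsetExp p E F' :=
  sum_congr rfl fun A hA => by rw [h A (mem_powerset.1 hA)]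

lemma subsetExp_mono {p : ℝ} (hp : p ∈ Set.Ioo (0 : ℝ) 1) {E : Finset α} {F F' : Finset α → ℝ}
    (h : ∀ A ⊆ E, F A ≤ F' A) : subsetExp p E F ≤ subsetExp p E F' := by
  refine sum_le_sum fun A hA => mul_le_mul_of_nonneg_left (h A (mem_powerset.1 hA)) ?_
  have := hp.1; have := hp.2
  have : 0 ≤ 1 - p := by linarith
  positivity

lemma subsetExp_one (p : ℝ) (E : Finset α) : subsetExp p E (fun _ => 1) = 1 := by
  simp [subsetExp, Finset.sum_pow_mul_eq_add_pow]

lemma subsetExp_image {β : Type*} [DecidableEq β] (p : ℝ) (E : Finset α) {g : α → β}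
    (hg : Set.InjOn g E) (F : Finset β → ℝ) :
    subsetExp p (E.image g) F = subsetExp p E (fun A => F (A.image g)) := by
  rw [subsetExp, powerset_image, sum_image]
  · refine sum_congr rfl fun A hA => ?_
    rw [card_image_of_injOn hg, card_image_of_injOn (hg.mono (by simpa using hA))]
  · intro A hA B hB hAB
    simp only [coe_powerset, Set.mem_preimage, Set.mem_powerset_iff] at hA hB
    have := congrArg (fun s : Finset β => (s : Set β)) hAB
    simp only [coe_image] at this
    exact_mod_cast (hg.image_eq_image_iff hA hB).1 this

variable [DecidableEq α]

lemma subsetExp_union (p : ℝ) {E₁ E₂ : Finset α} (h : Disjoint E₁ E₂) (F₁ F₂ : Finset α → ℝ) :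
    subsetExp p (E₁ ∪ E₂) (fun A => F₁ (A ∩ E₁) * F₂ (A ∩ E₂)) =
      subsetExp p E₁ F₁ * subsetExp p E₂ F₂ := by
  rw [subsetExp, subsetExp, subsetExp, sum_mul_sum, ← sum_product']
  symm
  have key : ∀ x ∈ E₁.powerset ×ˢ E₂.powerset,
      (x.1 ∪ x.2) ∩ E₁ = x.1 ∧ (x.1 ∪ x.2) ∩ E₂ = x.2 := by
    intro x hx
    simp only [mem_product, mem_powerset] at hx
    have h1 : x.1 ∩ E₂ = ∅ := disjoint_iff_inter_eq_empty.1 (h.mono_left hx.1)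
    have h2 : x.2 ∩ E₁ = ∅ := disjoint_iff_inter_eq_empty.1 (h.symm.mono_left hx.2)
    rw [union_inter_distrib_right, union_inter_distrib_right, h1, h2,
      inter_eq_left.2 hx.1, inter_eq_left.2 hx.2]
    simp
  refine sum_nbij' (fun x => x.1 ∪ x.2) (fun A => (A ∩ E₁, A ∩ E₂)) ?_ ?_ ?_ ?_ ?_
  · intro x hx
    simp only [mem_product, mem_powerset] at hx ⊢
    exact union_subset_union hx.1 hx.2
  · intro A hA
    simp
  · intro x hx
    exact Prod.ext (key x hx).1 (key x hx).2
  · intro A hA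
    simp only [mem_powerset] at hA
    rw [← inter_union_distrib_left, inter_eq_left.2 hA]
  · intro x hx
    rw [(key x hx).1, (key x hx).2]
    simp only [mem_product, mem_powerset] at hx
    have hd : Disjoint x.1 x.2 := (h.mono_left hx.1).mono_right hx.2
    rw [card_union_of_disjoint hd, card_union_of_disjoint h]
    have c1 := card_le_card hx.1
    have c2 := card_le_card hx.2
    rw [show #E₁ + #E₂ - (#x.1 + #x.2) = (#E₁ - #x.1) + (#E₂ - #x.2) by omega, pow_add, pow_add]
    ring

lemma subsetExp_of_subset (p : ℝ) {E₁ E : Finset α} (h : E₁ ⊆ E) (F : Finset α → ℝ) :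
    subsetExp p E (fun A => F (A ∩ E₁)) = subsetExp p E₁ F := by
  have := subsetExp_union p (disjoint_sdiff (s := E₁) (t := E)) F (fun _ => 1)
  rw [union_sdiff_of_subset h, subsetExp_one] at this
  simpa using this

lemma subsetExp_biUnion (p : ℝ) {ι : Type*} [DecidableEq ι] (I : Finset ι) (E : ι → Finset α)
    (h : (I : Set ι).PairwiseDisjoint E) (F : ι → Finset α → ℝ) :
    subsetExp p (I.biUnion E) (fun A => ∏ i ∈ I, F i (A ∩ E i)) =
      ∏ i ∈ I, subsetExp p (E i) (F i) := by
  induction I using Finset.induction_on with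
  | empty => simp [subsetExp]
  | insert a s ha ih =>
    rw [prod_insert ha, ← ih (h.subset (by simp)), biUnion_insert]
    have hd : Disjoint (E a) (s.biUnion E) := by
      rw [disjoint_biUnion_right]
      intro i hi
      exact h (by simp) (by simp [hi]) (by rintro rfl; exact ha hi)
    rw [← subsetExp_union p hd]
    refine subsetExp_congr fun A hA => ?_
    rw [prod_insert ha]
    congr 1
    refine prod_congr rfl fun i hi => ?_
    rw [inter_assoc, inter_eq_right.2 (subset_biUnion_of_mem E hi)]

lemma subsetExp_eq (p : ℝ) {E M : Finset α} (h : M ⊆ E) :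
    subsetExp p E (fun A => if A = M then 1 else 0) = p ^ #M * (1 - p) ^ (#E - #M) := by
  rw [subsetExp]
  simp [h]

lemma subsetExp_disjoint (p : ℝ) {E B : Finset α} (h : B ⊆ E) :
    subsetExp p E (fun A => if A ∩ B = ∅ then 1 else 0) = (1 - p) ^ #B := by
  rw [subsetExp_of_subset p h (fun A => if A = ∅ then 1 else 0), subsetExp_eq p (empty_subset _)]
  simp

end Bernoulli

section Graph

open Finset
open scoped Classical

variable {V : Type*} [Fintype V]

/-- The finset of edges of `G`. -/
noncomputable def edges (G : SimpleGraph V) : Finset (Sym2 V) := {e | e ∈ G.edgeSet}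

@[simp] lemma mem_edges {G : SimpleGraph V} {e : Sym2 V} : e ∈ edges G ↔ e ∈ G.edgeSet := by
  simp [edges]

lemma natCard_edgeSet (G : SimpleGraph V) : Nat.card G.edgeSet = #(edges G) := by
  rw [Nat.card_eq_fintype_card, ← Set.toFinset_card]
  congr 1
  ext; simp

lemma edges_le_top (G : SimpleGraph V) : edges G ⊆ edges (⊤ : SimpleGraph V) := by
  intro e
  simp only [mem_edges]
  exact fun h => SimpleGraph.edgeSet_mono le_top h

lemma card_edges_top : #(edges (⊤ : SimpleGraph V)) = (Fintype.card V).choose 2 := by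
  rw [← SimpleGraph.card_edgeFinset_top_eq_card_choose_two]
  congr 1
  ext; simp

/-- The expectation of `F G` for the binomial random graph `G` on `V`. -/
noncomputable def graphExp (p : ℝ) (F : SimpleGraph V → ℝ) : ℝ :=
  ∑ G : SimpleGraph V,
    p ^ #(edges G) * (1 - p) ^ ((Fintype.card V).choose 2 - #(edges G)) * F G

/-- The probability of `Q G` for the binomial random graph `G` on `V`. -/
noncomputable def graphProb (p : ℝ) (Q : SimpleGraph V → Prop) : ℝ :=
  graphExp p fun G => if Q G then 1 else 0

lemma graphExp_eq_subsetExp (p : ℝ) (F : Finset (Sym2 V) → ℝ) :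
    graphExp p (fun G => F (edges G)) = subsetExp p (edges (⊤ : SimpleGraph V)) F := by
  rw [graphExp, subsetExp, card_edges_top]
  refine sum_nbij' edges (fun A => SimpleGraph.fromEdgeSet (A : Set (Sym2 V))) ?_ ?_ ?_ ?_ ?_
  · intro G _
    exact mem_powerset.2 (edges_le_top G)
  · intro A _
    simp
  · intro G _
    have : (edges G : Set (Sym2 V)) = G.edgeSet := by ext; simp
    simp only [this, SimpleGraph.fromEdgeSet_edgeSet]
  · intro A hA
    ext e
    have h := mem_powerset.1 hA
    simp only [mem_edges, SimpleGraph.edgeSet_fromEdgeSet, Set.mem_sdiff, mem_coe]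
    constructor
    · exact fun h => h.1
    · intro he
      refine ⟨he, ?_⟩
      have := h he
      simpa using this
  · intro G _
    rfl

variable {p : ℝ}

lemma graphExp_mono (hp : p ∈ Set.Ioo (0 : ℝ) 1) {F F' : SimpleGraph V → ℝ}
    (h : ∀ G, F G ≤ F' G) : graphExp p F ≤ graphExp p F' := by
  refine sum_le_sum fun A _ => mul_le_mul_of_nonneg_left (h A) ?_
  have := hp.1; have := hp.2
  have : 0 ≤ 1 - p := by linarith
  positivity

lemma graphExp_sum {ι : Type*} (s : Finset ι) (F : ι → SimpleGraph V → ℝ) :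
    graphExp p (fun G => ∑ i ∈ s, F i G) = ∑ i ∈ s, graphExp p (F i) := by
  simp only [graphExp, mul_sum]
  exact sum_comm

lemma graphProb_mono (hp : p ∈ Set.Ioo (0 : ℝ) 1) {Q Q' : SimpleGraph V → Prop}
    (h : ∀ G, Q G → Q' G) : graphProb p Q ≤ graphProb p Q' := by
  refine graphExp_mono hp fun G => ?_
  by_cases hQ : Q G
  · simp [hQ, h G hQ]
  · simp only [hQ, if_false]
    positivity

lemma graphProb_nonneg (hp : p ∈ Set.Ioo (0 : ℝ) 1) (Q : SimpleGraph V → Prop) :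
    0 ≤ graphProb p Q := by
  have := graphExp_mono (F := fun _ => 0) hp
    (fun G : SimpleGraph V => show (0 : ℝ) ≤ if Q G then 1 else 0 by positivity)
  simpa [graphProb, graphExp] using this

lemma graphProb_exists_le (hp : p ∈ Set.Ioo (0 : ℝ) 1) {ι : Type*} (s : Finset ι)
    (Q : ι → SimpleGraph V → Prop) :
    graphProb p (fun G => ∃ i ∈ s, Q i G) ≤ ∑ i ∈ s, graphProb p (Q i) := by
  simp only [graphProb]
  rw [← graphExp_sum]
  refine graphExp_mono hp fun G => ?_
  split_ifs with h
  · obtain ⟨i, hi, hQ⟩ := h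
    have := single_le_sum (f := fun i => if Q i G then (1 : ℝ) else 0)
      (fun i _ => by positivity) hi
    simpa [hQ] using this
  · exact sum_nonneg fun i _ => by positivity

lemma graphProb_exists_eq {ι : Type*} (s : Finset ι)
    (Q : ι → SimpleGraph V → Prop) (hQ : ∀ i ∈ s, ∀ j ∈ s, ∀ G, Q i G → Q j G → i = j) :
    graphProb p (fun G => ∃ i ∈ s, Q i G) = ∑ i ∈ s, graphProb p (Q i) := by
  simp only [graphProb]
  rw [← graphExp_sum]
  congr 1
  ext G
  split_ifs with h
  · obtain ⟨i, hi, h⟩ := h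
    rw [sum_eq_single_of_mem i hi]
    · simp [h]
    · intro j hj hij
      rw [if_neg]
      exact fun h' => hij (hQ j hj i hi G h' h)
  · symm
    refine sum_eq_zero fun i hi => ?_
    rw [if_neg]
    exact fun h' => h ⟨i, hi, h'⟩

/-- The probability that a random subset of `W` meets all the sets `B i`. -/
noncomputable def hitProb {ι : Type*} (p : ℝ) (W : Finset V) (B : ι → Finset V) : ℝ :=
  subsetExp p W fun A => if ∀ i, (A ∩ B i).Nonempty then 1 else 0

/-- The edges inside `W` form a prescribed pattern on `S`, and all vertices outside `W` have a
neighbour in every set `B i`. -/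
lemma graphProb_pattern_hit {ι : Type*} {S M : Finset (Sym2 V)} {W : Finset V}
    {B : ι → Finset V} (hS : ∀ e ∈ S, ¬ e.IsDiag ∧ ∀ v ∈ e, v ∈ W) (hM : M ⊆ S)
    (hB : ∀ i, B i ⊆ W) :
    graphProb p (fun G : SimpleGraph V =>
      edges G ∩ S = M ∧ ∀ v ∉ W, ∀ i, ∃ u ∈ B i, G.Adj v u) =
    p ^ #M * (1 - p) ^ (#S - #M) * hitProb p W B ^ (Fintype.card V - #W) := by
  set st : V → Finset (Sym2 V) := fun v => W.image (fun u => s(v, u)) with hst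
  have hinj : ∀ v, Set.InjOn (fun u => s(v, u)) (W : Set V) := by
    intro v a _ b _ hab
    exact Sym2.congr_right.1 hab
  have hdisj : ((Wᶜ : Finset V) : Set V).PairwiseDisjoint st := by
    intro v hv w hw hvw
    rw [Function.onFun, disjoint_left]
    intro e he he'
    simp only [hst, mem_image] at he he'
    obtain ⟨a, ha, rfl⟩ := he
    obtain ⟨c, hc, h⟩ := he'
    rw [Sym2.eq_iff] at h
    simp only [coe_compl, Set.mem_compl_iff, mem_coe] at hv hw
    rcases h with ⟨h1, h2⟩ | ⟨h1, h2⟩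
    · exact hvw h1.symm
    · exact hw (h1 ▸ ha)
  have hSd : Disjoint S (Wᶜ.biUnion st) := by
    rw [disjoint_left]
    intro e he he'
    simp only [mem_biUnion, hst, mem_image, mem_compl] at he'
    obtain ⟨v, hv, a, ha, rfl⟩ := he'
    exact hv ((hS _ he).2 v (by simp))
  set D : V → Finset (Sym2 V) → ℝ := fun v A =>
    if ∀ i, ∃ u ∈ B i, s(v, u) ∈ A then 1 else 0 with hD
  set FS : Finset (Sym2 V) → ℝ := fun A => if A = M then 1 else 0 with hFS
  have hsub : S ∪ Wᶜ.biUnion st ⊆ edges (⊤ : SimpleGraph V) := by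
    intro e he
    rw [mem_edges, SimpleGraph.edgeSet_top]
    rcases mem_union.1 he with he | he
    · simpa using (hS e he).1
    · simp only [mem_biUnion, hst, mem_image, mem_compl] at he
      obtain ⟨v, hv, a, ha, rfl⟩ := he
      have : v ≠ a := by rintro rfl; exact hv ha
      simpa using this
  have key : graphProb p (fun G : SimpleGraph V =>
      edges G ∩ S = M ∧ ∀ v ∉ W, ∀ i, ∃ u ∈ B i, G.Adj v u) =
      graphExp p (fun G => (fun A => FS (A ∩ S) *
        (fun A => ∏ v ∈ Wᶜ, D v (A ∩ st v)) (A ∩ Wᶜ.biUnion st)) (edges G)) := by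
    rw [graphProb]
    congr 1
    ext G
    have hDv : ∀ v ∈ Wᶜ, D v (edges G ∩ Wᶜ.biUnion st ∩ st v) =
        if ∀ i, ∃ u ∈ B i, G.Adj v u then 1 else 0 := by
      intro v hv
      simp only [hD]
      rw [inter_assoc, inter_eq_right.2 (subset_biUnion_of_mem st hv)]
      congr 1
      refine propext (forall_congr' fun i => exists_congr fun u => and_congr_right fun hu => ?_)
      have : s(v, u) ∈ st v := mem_image_of_mem _ (hB i hu)
      simp [this]
    simp only
    rw [prod_congr rfl hDv]
    simp only [hFS]
    by_cases h1 : edges G ∩ S = M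
    · by_cases h2 : ∀ v ∉ W, ∀ i, ∃ u ∈ B i, G.Adj v u
      · rw [if_pos ⟨h1, h2⟩, if_pos h1, prod_eq_one]
        · simp
        · intro v hv
          rw [if_pos (h2 v (by simpa using hv))]
      · rw [if_neg (fun h => h2 h.2), eq_comm]
        push Not at h2
        obtain ⟨v, hv, i, h⟩ := h2
        rw [prod_eq_zero (i := v) (by simpa using hv), mul_zero]
        rw [if_neg]
        push Not
        exact ⟨i, h⟩
    · rw [if_neg (fun h => h1 h.1), if_neg h1, zero_mul]
  rw [key, graphExp_eq_subsetExp p (fun A => FS (A ∩ S) *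
        (fun A => ∏ v ∈ Wᶜ, D v (A ∩ st v)) (A ∩ Wᶜ.biUnion st))]
  have e1 := subsetExp_of_subset p hsub (fun A => FS (A ∩ S) *
        (fun A => ∏ v ∈ Wᶜ, D v (A ∩ st v)) (A ∩ Wᶜ.biUnion st))
  simp only [inter_assoc, inter_eq_right.2 subset_union_left,
    inter_eq_right.2 subset_union_right] at e1
  have e2 := subsetExp_union p hSd FS (fun A => ∏ v ∈ Wᶜ, D v (A ∩ st v))
  simp only [inter_assoc] at e2
  simp only [inter_assoc]
  rw [e1, e2, subsetExp_biUnion p _ _ hdisj, hFS, subsetExp_eq p hM]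
  congr 1
  have : ∀ v ∈ Wᶜ, subsetExp p (st v) (D v) = hitProb p W B := by
    intro v hv
    rw [hst, subsetExp_image p W (hinj v), hitProb]
    refine subsetExp_congr fun A hA => ?_
    simp only [hD]
    congr 1
    refine propext (forall_congr' fun i => ?_)
    simp only [mem_image, Sym2.congr_right, exists_eq_right, Finset.Nonempty, mem_inter]
    exact exists_congr fun u => and_comm
  rw [prod_congr rfl this, prod_const, card_compl]

end Graph

section Hit

open Finset
open scoped Classical

variable {V : Type*} {p : ℝ}

lemma subsetExp_nonempty (p : ℝ) (E : Finset V) :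
    subsetExp p E (fun A => if A.Nonempty then 1 else 0) = 1 - (1 - p) ^ #E := by
  have h1 := subsetExp_one p E
  have h2 := subsetExp_disjoint p (subset_refl E)
  refine Eq.trans ?_ (congrArg₂ (· - ·) h1 h2)
  rw [subsetExp, subsetExp, subsetExp, ← sum_sub_distrib]
  refine sum_congr rfl fun A hA => ?_
  rw [inter_eq_left.2 (mem_powerset.1 hA), ← mul_sub]
  congr 1
  rcases A.eq_empty_or_nonempty with h | h
  · simp [h]
  · simp [h, h.ne_empty]

lemma hitProb_nonneg {ι : Type*} (hp : p ∈ Set.Ioo (0 : ℝ) 1) (W : Finset V) (B : ι → Finset V) :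
    0 ≤ hitProb p W B := by
  have := hp.1; have := hp.2
  have : 0 ≤ 1 - p := by linarith
  exact sum_nonneg fun A _ => by positivity

lemma hitProb_of_disjoint {ι : Type*} [Fintype ι] {W : Finset V} {B : ι → Finset V}
    (hB : ∀ i, B i ⊆ W) (hd : Pairwise fun i j => Disjoint (B i) (B j)) :
    hitProb p W B = ∏ i, (1 - (1 - p) ^ #(B i)) := by
  have h1 := subsetExp_biUnion p univ B (fun i _ j _ hij => hd hij)
    (fun _ A => if A.Nonempty then 1 else 0)
  simp only [subsetExp_nonempty] at h1
  rw [← h1, hitProb, ← subsetExp_of_subset p (biUnion_subset.2 fun i _ => hB i)]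
  refine subsetExp_congr fun A _ => ?_
  have : ∀ i, A ∩ univ.biUnion B ∩ B i = A ∩ B i := fun i => by
    rw [inter_assoc, inter_eq_right.2 (subset_biUnion_of_mem B (mem_univ i))]
  simp only [this]
  split_ifs with h
  · rw [prod_eq_one]
    intro i _
    rw [if_pos (h i)]
  · push Not at h
    obtain ⟨i, hi⟩ := h
    rw [prod_eq_zero (mem_univ i)]
    simp [hi]

lemma subsetExp_sum {β : Type*} (E : Finset V) (s : Finset β) (F : β → Finset V → ℝ) :
    subsetExp p E (fun A => ∑ i ∈ s, F i A) = ∑ i ∈ s, subsetExp p E (F i) := by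
  simp only [subsetExp, mul_sum]
  exact sum_comm

lemma subsetExp_const_mul (E : Finset V) (c : ℝ) (F : Finset V → ℝ) :
    subsetExp p E (fun A => c * F A) = c * subsetExp p E F := by
  simp only [subsetExp, mul_sum]
  exact sum_congr rfl fun A _ => by ring

lemma subsetExp_add (E : Finset V) (F F' : Finset V → ℝ) :
    subsetExp p E (fun A => F A + F' A) = subsetExp p E F + subsetExp p E F' := by
  simp only [subsetExp, mul_add, sum_add_distrib]

/-- A Bonferroni bound for the probability that a random subset of `W` meets all the `B i`. -/
lemma hitProb_le {ι : Type*} [Fintype ι] (hp : p ∈ Set.Ioo (0 : ℝ) 1) {W : Finset V}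
    {B : ι → Finset V} (hB : ∀ i, B i ⊆ W) :
    hitProb p W B ≤ 1 - ∑ i, (1 - p) ^ #(B i) +
      2⁻¹ * ∑ z : ι × ι with z.1 ≠ z.2, (1 - p) ^ #(B z.1 ∪ B z.2) := by
  have key : hitProb p W B ≤ subsetExp p W (fun A =>
      (1 + (-1) * ∑ i, (if A ∩ B i = ∅ then (1 : ℝ) else 0)) +
      2⁻¹ * ∑ z : ι × ι with z.1 ≠ z.2, if A ∩ (B z.1 ∪ B z.2) = ∅ then 1 else 0) := by
    refine subsetExp_mono hp fun A _ => ?_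
    set b : ι → ℝ := fun i => if A ∩ B i = ∅ then (1 : ℝ) else 0 with hb
    have hbb : ∀ i, b i * b i = b i := fun i => by simp [hb]
    have h1 : ∑ z : ι × ι with z.1 ≠ z.2, (if A ∩ (B z.1 ∪ B z.2) = ∅ then (1 : ℝ) else 0) =
        (∑ i, b i) * (∑ i, b i) - ∑ i, b i := by
      rw [sum_mul_sum, ← sum_product', univ_product_univ, eq_sub_iff_add_eq,
        ← sum_filter_add_sum_filter_not univ (fun z : ι × ι => z.1 ≠ z.2)]
      congr 1
      · refine sum_congr rfl fun z _ => ?_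
        simp only [hb, inter_union_distrib_left, union_eq_empty]
        by_cases h1 : A ∩ B z.1 = ∅ <;> by_cases h2 : A ∩ B z.2 = ∅ <;> simp [h1, h2]
      · refine sum_nbij' (fun i => (i, i)) (fun z => z.1) ?_ ?_ ?_ ?_ ?_ <;> simp [hbb]
    rw [h1]
    have h2 : ∑ i, b i = (#{i | A ∩ B i = ∅} : ℕ) := by simp [hb]
    rw [h2]
    split_ifs with h
    · have : #{i | A ∩ B i = ∅} = 0 := by
        rw [card_eq_zero, filter_eq_empty_iff]
        exact fun i _ => (h i).ne_empty
      simp [this]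
    · push Not at h
      have : 1 ≤ #{i | A ∩ B i = ∅} := card_pos.2 (by
        obtain ⟨i, hi⟩ := h
        exact ⟨i, by simpa using hi⟩)
      obtain ⟨m, hm⟩ := Nat.exists_eq_add_of_le this
      rw [hm]
      push_cast
      rcases Nat.eq_zero_or_pos m with rfl | hm'
      · norm_num
      · have : (1 : ℝ) ≤ m := by exact_mod_cast hm'
        nlinarith
  refine key.trans (le_of_eq ?_)
  rw [subsetExp_add, subsetExp_add, subsetExp_const_mul, subsetExp_const_mul, subsetExp_sum,
    subsetExp_sum, subsetExp_one]
  have h1 : ∀ i, subsetExp p W (fun A => if A ∩ B i = ∅ then 1 else 0) = (1 - p) ^ #(B i) :=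
    fun i => subsetExp_disjoint p (hB i)
  have h2 : ∀ z : ι × ι, subsetExp p W (fun A => if A ∩ (B z.1 ∪ B z.2) = ∅ then 1 else 0) =
    (1 - p) ^ #(B z.1 ∪ B z.2) := fun z => subsetExp_disjoint p (union_subset (hB _) (hB _))
  simp only [h1, h2]
  ring

end Hit

section Labelling

open Finset
open scoped Classical

variable {V : Type*} {p : ℝ}

/-- The edges between the distinguished vertices. -/
noncomputable def triangle (x : Fin 3 → V) : Finset (Sym2 V) :=
  {s(x 0, x 1), s(x 0, x 2), s(x 1, x 2)}

lemma card_triangle_le (x : Fin 3 → V) : #(triangle x) ≤ 3 := card_le_three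

lemma card_triangle {f : V → Option (Fin 3)} {x : Fin 3 → V} (hx : ∀ i, f (x i) = some i) :
    #(triangle x) = 3 := by
  have hxi : ∀ a b, a ≠ b → x a ≠ x b := fun a b hab h => by
    have := hx a
    rw [h, hx b] at this
    exact hab (Option.some_injective _ this).symm
  rw [triangle, card_eq_three]
  refine ⟨_, _, _, ?_, ?_, ?_, rfl⟩ <;>
  simp only [ne_eq, Sym2.eq_iff, not_or, not_and] <;>
  constructor <;> intro h <;> first | exact hxi _ _ (by decide) | exact absurd h (hxi _ _ (by decide))

variable [Fintype V]

/-- The vertices with label `i`. -/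
noncomputable def cls (f : V → Option (Fin 3)) (i : Fin 3) : Finset V := {v | f v = some i}

/-- The labelled vertices. -/
noncomputable def supp (f : V → Option (Fin 3)) : Finset V := {v | f v ≠ none}

/-- The complete tripartite graph on the labelled vertices. -/
def crossGraph (f : V → Option (Fin 3)) : SimpleGraph V where
  Adj u v := f u ≠ none ∧ f v ≠ none ∧ f u ≠ f v
  symm := ⟨fun _ _ h => ⟨h.2.1, h.1, h.2.2.symm⟩⟩
  loopless := ⟨fun _ h => h.2.2 rfl⟩

/-- The labelled sets together with the vertices `x i` are special. -/
def IsSpecial (G : SimpleGraph V) (f : V → Option (Fin 3)) (x : Fin 3 → V) : Prop :=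
  (∀ i, f (x i) = some i) ∧
  (∀ v, f v = none → ∀ i, ∃ u, f u = some i ∧ G.Adj v u) ∧
  ∀ i j, i ≠ j → ∀ u v, f u = some i → f v = some j → (G.Adj u v ↔ u = x i ∧ v = x j)

@[simp] lemma mem_cls {f : V → Option (Fin 3)} {i : Fin 3} {v : V} :
    v ∈ cls f i ↔ f v = some i := by simp [cls]

@[simp] lemma mem_supp {f : V → Option (Fin 3)} {v : V} : v ∈ supp f ↔ f v ≠ none := by
  simp [supp]

lemma cls_subset_supp (f : V → Option (Fin 3)) (i : Fin 3) : cls f i ⊆ supp f := by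
  intro v
  simp only [mem_cls, mem_supp]
  intro h
  simp [h]

lemma disjoint_cls (f : V → Option (Fin 3)) : Pairwise fun i j => Disjoint (cls f i) (cls f j) := by
  intro i j hij
  rw [disjoint_left]
  intro v
  simp only [mem_cls]
  intro h h'
  rw [h] at h'
  exact hij (Option.some_injective _ h')

lemma sum_comp_eq {τ : Type*} [Fintype τ] [DecidableEq τ] (g : V → τ) (φ : τ → ℕ) :
    ∑ v, φ (g v) = ∑ o, #{v | g v = o} * φ o := by
  rw [← sum_fiberwise univ g]
  refine sum_congr rfl fun o _ => ?_
  rw [sum_congr rfl (g := fun _ => φ o), sum_const, smul_eq_mul]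
  intro v hv
  rw [(mem_filter.1 hv).2]

lemma card_comp_eq {τ : Type*} [Fintype τ] [DecidableEq τ] (g : V → τ) (P : τ → Prop)
    [DecidablePred P] :
    #{v | P (g v)} = ∑ o, #{v | g v = o} * if P o then 1 else 0 := by
  rw [card_filter]
  exact sum_comp_eq g (fun o => if P o then 1 else 0)

lemma card_supp (f : V → Option (Fin 3)) : #(supp f) = ∑ i, #(cls f i) := by
  have h := card_comp_eq f (fun o => o ≠ none)
  simp only [Fintype.sum_option] at h
  simp only [supp, cls]
  convert h using 1
  simp

lemma two_mul_card_edges (H : SimpleGraph V) : 2 * #(edges H) = ∑ u, #{v | H.Adj u v} := by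
  have h := H.sum_degrees_eq_twice_card_edges
  have h1 : H.edgeFinset = edges H := by ext; simp
  rw [← h1, ← h]
  refine sum_congr rfl fun u _ => ?_
  rw [← SimpleGraph.card_neighborFinset_eq_degree]
  congr 1
  ext; simp

lemma card_edges_crossGraph (f : V → Option (Fin 3)) :
    #(edges (crossGraph f)) = #(cls f 0) * #(cls f 1) + #(cls f 0) * #(cls f 2) +
      #(cls f 1) * #(cls f 2) := by
  have h := two_mul_card_edges (crossGraph f)
  have h1 : ∀ u, #{v | (crossGraph f).Adj u v} =
      (fun o : Option (Fin 3) => ∑ o', #{v | f v = o'} *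
        if (o ≠ none ∧ o' ≠ none ∧ o ≠ o') then 1 else 0) (f u) := fun u => by
    beta_reduce
    rw [← card_comp_eq f (fun o' => f u ≠ none ∧ o' ≠ none ∧ f u ≠ o')]
    simp only [crossGraph]
    congr
  rw [sum_congr rfl fun u _ => h1 u, sum_comp_eq f (fun o : Option (Fin 3) =>
    ∑ o', #{v | f v = o'} * if (o ≠ none ∧ o' ≠ none ∧ o ≠ o') then 1 else 0)] at h
  simp [Fintype.sum_option, Fin.sum_univ_three] at h
  simp only [cls]
  nlinarith

lemma IsSpecial.edges_inter {G : SimpleGraph V} {f : V → Option (Fin 3)} {x : Fin 3 → V}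
    (h : IsSpecial G f x) : edges G ∩ edges (crossGraph f) = triangle x := by
  obtain ⟨h1, h2, h3⟩ := h
  ext e
  induction e using Sym2.ind with
  | _ u v =>
  simp only [mem_inter, mem_edges, SimpleGraph.mem_edgeSet, crossGraph]
  constructor
  · rintro ⟨hG, hu, hv, huv⟩
    obtain ⟨i, hi⟩ := Option.ne_none_iff_exists'.1 hu
    obtain ⟨j, hj⟩ := Option.ne_none_iff_exists'.1 hv
    have hij : i ≠ j := by
      rintro rfl
      exact huv (hi.trans hj.symm)
    obtain ⟨rfl, rfl⟩ := (h3 i j hij u v hi hj).1 hG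
    fin_cases i <;> fin_cases j <;> simp [triangle] at hij ⊢
  · have key : ∀ i j, i ≠ j → G.Adj (x i) (x j) ∧ f (x i) ≠ none ∧ f (x j) ≠ none ∧
        f (x i) ≠ f (x j) := by
      intro i j hij
      refine ⟨(h3 i j hij _ _ (h1 i) (h1 j)).2 ⟨rfl, rfl⟩, ?_⟩
      simp [h1, hij]
    have key' : ∀ i j, i ≠ j → s(u, v) = s(x i, x j) → G.Adj u v ∧ f u ≠ none ∧ f v ≠ none ∧
        f u ≠ f v := by
      intro i j hij h
      rcases Sym2.eq_iff.1 h with ⟨rfl, rfl⟩ | ⟨rfl, rfl⟩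
      · exact key _ _ hij
      · exact key _ _ hij.symm
    intro h
    simp only [triangle, mem_insert, mem_singleton] at h
    rcases h with h | h | h
    · exact key' 0 1 (by decide) h
    · exact key' 0 2 (by decide) h
    · exact key' 1 2 (by decide) h

lemma isSpecial_iff {G : SimpleGraph V} {f : V → Option (Fin 3)} {x : Fin 3 → V}
    (hx : ∀ i, f (x i) = some i) :
    IsSpecial G f x ↔ edges G ∩ edges (crossGraph f) = triangle x ∧
      ∀ v ∉ supp f, ∀ i, ∃ u ∈ cls f i, G.Adj v u := by
  constructor
  · intro h
    refine ⟨h.edges_inter, ?_⟩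
    simpa using h.2.1
  · rintro ⟨h1, h2⟩
    refine ⟨hx, by simpa using h2, ?_⟩
    intro i j hij u v hu hv
    have h3 : (crossGraph f).Adj u v := by simp [crossGraph, hu, hv, hij]
    have h4 : G.Adj u v ↔ s(u, v) ∈ triangle x := by
      rw [← h1]
      simp [h3]
    rw [h4]
    have hxi : ∀ a b, x a = x b → a = b := fun a b h => by
      have := hx a
      rw [h, hx b] at this
      exact (Option.some_injective _ this).symm
    constructor
    · have key : ∀ a b, s(u, v) = s(x a, x b) → u = x i ∧ v = x j := by
        intro a b h
        rcases Sym2.eq_iff.1 h with ⟨rfl, rfl⟩ | ⟨rfl, rfl⟩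
        all_goals
          rw [hx] at hu hv
          rw [Option.some_injective _ hu, Option.some_injective _ hv]
          exact ⟨rfl, rfl⟩
      simp only [triangle, mem_insert, mem_singleton]
      rintro (h | h | h)
      exacts [key _ _ h, key _ _ h, key _ _ h]
    · rintro ⟨rfl, rfl⟩
      fin_cases i <;> fin_cases j <;> simp [triangle] at hij ⊢

lemma not_isDiag_of_mem_edges {H : SimpleGraph V} {e : Sym2 V} (h : e ∈ edges H) : ¬ e.IsDiag :=
  H.not_isDiag_of_mem_edgeSet (by simpa using h)

lemma mem_supp_of_mem_edges {f : V → Option (Fin 3)} {e : Sym2 V}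
    (h : e ∈ edges (crossGraph f)) : ∀ v ∈ e, v ∈ supp f := by
  induction e using Sym2.ind with
  | _ u v =>
  simp only [mem_edges, SimpleGraph.mem_edgeSet, crossGraph] at h
  intro w hw
  rcases Sym2.mem_iff.1 hw with rfl | rfl
  · simpa using h.1
  · simpa using h.2.1

lemma triangle_subset {f : V → Option (Fin 3)} {x : Fin 3 → V} (hx : ∀ i, f (x i) = some i) :
    triangle x ⊆ edges (crossGraph f) := by
  intro e he
  simp only [triangle, mem_insert, mem_singleton] at he
  rcases he with rfl | rfl | rfl <;> simp [crossGraph, hx]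

lemma graphProb_isSpecial {f : V → Option (Fin 3)} {x : Fin 3 → V} (hx : ∀ i, f (x i) = some i) :
    graphProb p (fun G => IsSpecial G f x) = p ^ 3 * (1 - p) ^ (#(edges (crossGraph f)) - 3) *
      (∏ i, (1 - (1 - p) ^ #(cls f i))) ^ (Fintype.card V - #(supp f)) := by
  simp only [isSpecial_iff hx]
  rw [graphProb_pattern_hit (fun e he => ⟨not_isDiag_of_mem_edges he, mem_supp_of_mem_edges he⟩)
    (triangle_subset hx) (cls_subset_supp f), card_triangle hx,
    hitProb_of_disjoint (cls_subset_supp f) (disjoint_cls f)]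

lemma graphProb_exists_isSpecial (f : V → Option (Fin 3)) :
    graphProb p (fun G => ∃ x, IsSpecial G f x) = (∏ i, (#(cls f i) : ℝ)) *
      (p ^ 3 * (1 - p) ^ (#(edges (crossGraph f)) - 3) *
      (∏ i, (1 - (1 - p) ^ #(cls f i))) ^ (Fintype.card V - #(supp f))) := by
  have h1 : (fun G => ∃ x, IsSpecial G f x) =
      fun G => ∃ x ∈ Fintype.piFinset (cls f), IsSpecial G f x := by
    ext G
    refine exists_congr fun x => ?_
    rw [Fintype.mem_piFinset]
    exact ⟨fun h => ⟨fun i => by simpa using h.1 i, h⟩, fun h => h.2⟩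
  rw [h1, graphProb_exists_eq]
  · rw [sum_congr rfl (g := fun _ => p ^ 3 * (1 - p) ^ (#(edges (crossGraph f)) - 3) *
      (∏ i, (1 - (1 - p) ^ #(cls f i))) ^ (Fintype.card V - #(supp f))), sum_const,
      Fintype.card_piFinset, nsmul_eq_mul, Nat.cast_prod]
    intro x hx
    rw [Fintype.mem_piFinset] at hx
    exact graphProb_isSpecial (fun i => by simpa using hx i)
  · intro x _ y _ G hx hy
    ext i
    obtain ⟨j, hj⟩ : ∃ j, i ≠ j := (exists_ne i).imp fun j h => h.symm
    have := (hx.2.2 i j hj (y i) (y j) (hy.1 i) (hy.1 j)).1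
      ((hy.2.2 i j hj (y i) (y j) (hy.1 i) (hy.1 j)).2 ⟨rfl, rfl⟩)
    exact this.1.symm

/-- Two labellings are special simultaneously with probability at most the probability that all
but at most six edges of the union of the cross graphs are missing, times the probability that the
outside vertices have neighbours in the given classes. -/
lemma graphProb_isSpecial_and_le (hp : p ∈ Set.Ioo (0 : ℝ) 1) {ι : Type*}
    (f f' : V → Option (Fin 3)) (x x' : Fin 3 → V) (B : ι → Finset V)
    (hB : ∀ i, ∃ j, B i = cls f j ∨ B i = cls f' j) :
    graphProb p (fun G => IsSpecial G f x ∧ IsSpecial G f' x') ≤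
      (1 - p) ^ #(edges (crossGraph f ⊔ crossGraph f')) / (1 - p) ^ 6 *
        hitProb p (supp f ∪ supp f') B ^ (Fintype.card V - #(supp f ∪ supp f')) := by
  have hp1 := hp.1
  have hp2 := hp.2
  have hq : 0 < 1 - p := by linarith
  set W := supp f ∪ supp f' with hW
  set S := edges (crossGraph f ⊔ crossGraph f') \ (triangle x ∪ triangle x') with hS
  have hed : edges (crossGraph f ⊔ crossGraph f') =
      edges (crossGraph f) ∪ edges (crossGraph f') := by
    ext e; simp
  have hSW : ∀ e ∈ S, ¬ e.IsDiag ∧ ∀ v ∈ e, v ∈ W := by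
    intro e he
    rw [hS, Finset.mem_sdiff] at he
    refine ⟨not_isDiag_of_mem_edges he.1, ?_⟩
    intro v hv
    rw [hed, mem_union] at he
    rw [hW, mem_union]
    exact he.1.imp (fun h => mem_supp_of_mem_edges h v hv) (fun h => mem_supp_of_mem_edges h v hv)
  have hBW : ∀ i, B i ⊆ W := by
    intro i
    obtain ⟨j, h | h⟩ := hB i <;> rw [h]
    · exact (cls_subset_supp f j).trans subset_union_left
    · exact (cls_subset_supp f' j).trans subset_union_right
  have main : graphProb p (fun G => IsSpecial G f x ∧ IsSpecial G f' x') ≤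
      graphProb p (fun G : SimpleGraph V =>
        edges G ∩ S = ∅ ∧ ∀ v ∉ W, ∀ i, ∃ u ∈ B i, G.Adj v u) := by
    refine graphProb_mono hp fun G hG => ⟨?_, ?_⟩
    · rw [eq_empty_iff_forall_notMem]
      intro e he
      rw [hS, mem_inter, Finset.mem_sdiff, hed, mem_union, mem_union] at he
      obtain ⟨heG, he, hne⟩ := he
      refine hne (he.imp (fun h => ?_) (fun h => ?_))
      · rw [← hG.1.edges_inter]
        exact mem_inter.2 ⟨heG, h⟩
      · rw [← hG.2.edges_inter]
        exact mem_inter.2 ⟨heG, h⟩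
    · intro v hv i
      simp only [hW, mem_union, mem_supp, not_or, not_not] at hv
      obtain ⟨j, h | h⟩ := hB i <;> rw [h]
      · simpa using hG.1.2.1 v hv.1 j
      · simpa using hG.2.2.1 v hv.2 j
  refine main.trans ?_
  rw [graphProb_pattern_hit hSW (empty_subset _) hBW]
  refine mul_le_mul_of_nonneg_right ?_ (pow_nonneg (hitProb_nonneg hp _ _) _)
  rw [card_empty, pow_zero, one_mul, Nat.sub_zero, le_div_iff₀ (by positivity), ← pow_add]
  refine pow_le_pow_of_le_one hq.le (by linarith) ?_
  have h1 := le_card_sdiff (triangle x ∪ triangle x') (edges (crossGraph f ⊔ crossGraph f'))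
  have h2 := card_union_le (triangle x) (triangle x')
  have h3 := card_triangle_le x
  have h4 := card_triangle_le x'
  rw [← hS] at h1
  omega

end Labelling

section Measure

open Finset
open scoped Classical

lemma gnp_toReal_eq {n : ℕ} {p : ℝ} (hp : p ∈ Set.Ioo (0 : ℝ) 1) (Q : SimpleGraph (Fin n) → Prop) :
    (gnp n p {G | Q G}).toReal = graphProb p Q := by
  have hp1 := hp.1
  have hq : 0 < 1 - p := by linarith [hp.2]
  rw [gnp, Measure.sum_apply _ (MeasurableSpace.measurableSet_top), tsum_fintype,
    ENNReal.toReal_sum, graphProb, graphExp]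
  · refine sum_congr (by ext; simp) fun G _ => ?_
    rw [Measure.smul_apply, Measure.dirac_apply' _ (MeasurableSpace.measurableSet_top),
      natCard_edgeSet, Fintype.card_fin, Nat.choose_two_right, smul_eq_mul, ENNReal.toReal_mul,
      ENNReal.toReal_ofReal (by positivity)]
    congr 1
    by_cases h : Q G <;> simp [h]
  · intro G _
    rw [Measure.smul_apply, Measure.dirac_apply' _ (MeasurableSpace.measurableSet_top)]
    by_cases h : Q G <;> simp [h]

/-- The labelling whose classes are `X 0`, `X 1` and `X 2`. -/
noncomputable def labelling {V : Type*} (X₁ X₂ X₃ : Finset V) (v : V) : Option (Fin 3) :=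
  if v ∈ X₁ then some 0 else if v ∈ X₂ then some 1 else if v ∈ X₃ then some 2 else none

lemma exists_specialTuple_iff {n : ℕ} (G : SimpleGraph (Fin n)) :
    (∃ (X₁ X₂ X₃ : Finset (Fin n)) (x₁ x₂ x₃ : Fin n), SpecialTuple G X₁ X₂ X₃ x₁ x₂ x₃) ↔
      ∃ f x, IsSpecial G f x := by
  constructor
  · rintro ⟨X₁, X₂, X₃, x₁, x₂, x₃, h12, h13, h23, h1, h2, h3, hd, e12, e13, e23⟩
    have m0 : ∀ v, labelling X₁ X₂ X₃ v = some 0 ↔ v ∈ X₁ := by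
      intro v; unfold labelling; split_ifs <;> simp_all
    have m1 : ∀ v, labelling X₁ X₂ X₃ v = some 1 ↔ v ∈ X₂ := by
      intro v; unfold labelling
      have : v ∈ X₁ → v ∉ X₂ := fun h => disjoint_left.1 h12 h
      split_ifs <;> simp_all
    have m2 : ∀ v, labelling X₁ X₂ X₃ v = some 2 ↔ v ∈ X₃ := by
      intro v; unfold labelling
      have : v ∈ X₁ → v ∉ X₃ := fun h => disjoint_left.1 h13 h
      have : v ∈ X₂ → v ∉ X₃ := fun h => disjoint_left.1 h23 h
      split_ifs <;> simp_all
    have m3 : ∀ v, labelling X₁ X₂ X₃ v = none ↔ v ∉ X₁ ∧ v ∉ X₂ ∧ v ∉ X₃ := by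
      intro v; unfold labelling
      split_ifs <;> simp_all
    refine ⟨labelling X₁ X₂ X₃, ![x₁, x₂, x₃], ?_, ?_, ?_⟩
    · intro i
      fin_cases i <;> simp [*]
    · intro v hv i
      obtain ⟨a, b, c⟩ := (m3 v).1 hv
      obtain ⟨a, b, c⟩ := hd v a b c
      fin_cases i <;> simp [*]
    · intro i j hij u v hu hv
      fin_cases i <;> fin_cases j <;> simp [m0, m1, m2] at hij hu hv ⊢
      · exact e12 u hu v hv
      · exact e13 u hu v hv
      · rw [SimpleGraph.adj_comm, e12 v hv u hu, and_comm]
      · exact e23 u hu v hv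
      · rw [SimpleGraph.adj_comm, e13 v hv u hu, and_comm]
      · rw [SimpleGraph.adj_comm, e23 v hv u hu, and_comm]
  · rintro ⟨f, x, h1, h2, h3⟩
    refine ⟨cls f 0, cls f 1, cls f 2, x 0, x 1, x 2, disjoint_cls f (by decide),
      disjoint_cls f (by decide), disjoint_cls f (by decide), by simp [h1], by simp [h1],
      by simp [h1], ?_, ?_, ?_, ?_⟩
    · intro v
      simp only [mem_cls]
      intro a b c
      have hv : f v = none := by
        rcases hv : f v with _ | i
        · rfl
        · fin_cases i <;> simp_all
      exact ⟨h2 v hv 0, h2 v hv 1, h2 v hv 2⟩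
    all_goals
      intro u hu v hv
      rw [mem_cls] at hu hv
      exact h3 _ _ (by decide) u v hu hv

lemma gnp_specialTuple {n : ℕ} {p : ℝ} (hp : p ∈ Set.Ioo (0 : ℝ) 1) :
    ((gnp n p) {G : SimpleGraph (Fin n) | ∃ (X₁ X₂ X₃ : Finset (Fin n)) (x₁ x₂ x₃ : Fin n),
      SpecialTuple G X₁ X₂ X₃ x₁ x₂ x₃}).toReal =
    graphProb p (fun G : SimpleGraph (Fin n) => ∃ f x, IsSpecial G f x) := by
  simp only [exists_specialTuple_iff]
  exact gnp_toReal_eq hp _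

end Measure

section FirstMoment

open Finset
open scoped Classical

variable {V : Type*} [Fintype V] {p : ℝ}

lemma sum_prod_label {τ : Type*} [Fintype τ] (g : V → τ → ℝ) :
    ∑ f : V → τ, ∏ v, g v (f v) = ∏ v, ∑ o, g v o := by
  rw [prod_univ_sum, Fintype.piFinset_univ]

lemma prod_label (g : Option (Fin 3) → ℝ) (f : V → Option (Fin 3)) :
    ∏ v, g (f v) = g none ^ (Fintype.card V - #(supp f)) * ∏ i, g (some i) ^ #(cls f i) := by
  have h : ∏ v, g (f v) = ∏ o, g o ^ #{v | f v = o} := by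
    rw [← prod_fiberwise_of_maps_to (s := univ) (t := univ) (g := f) (fun _ _ => mem_univ _)]
    refine prod_congr rfl fun o _ => ?_
    rw [prod_congr rfl (g := fun _ => g o), prod_const]
    intro v hv
    rw [(mem_filter.1 hv).2]
  rw [h, Fintype.prod_option]
  congr 2
  have : supp f = univ \ ({v | f v = none} : Finset V) := by ext v; simp
  rw [this, card_univ_sdiff]
  have := card_le_univ ({v | f v = none} : Finset V)
  omega

/-- The number of labellings with class sizes `κ` is bounded by a label generating function. -/
lemma card_sizes_mul_le (g : Option (Fin 3) → ℝ) (hg : ∀ o, 0 ≤ g o) (κ : Fin 3 → ℕ) :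
    (#{f : V → Option (Fin 3) | ∀ i, #(cls f i) = κ i} : ℝ) *
      (g none ^ (Fintype.card V - ∑ i, κ i) * ∏ i, g (some i) ^ κ i) ≤
      (∑ o, g o) ^ Fintype.card V := by
  have h : ∑ f : V → Option (Fin 3), ∏ v, g (f v) = (∑ o, g o) ^ Fintype.card V := by
    rw [sum_prod_label (fun _ => g)]
    simp
  rw [← h, ← nsmul_eq_mul, ← sum_const]
  refine le_trans (le_of_eq (sum_congr rfl fun f hf => ?_))
    (sum_le_sum_of_subset_of_nonneg (subset_univ _) fun f _ _ => prod_nonneg fun v _ => hg _)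
  have hf := (mem_filter.1 hf).2
  rw [prod_label, card_supp]
  simp only [hf]

/-- An upper bound for the expected number of special tuples with a given labelling with class
sizes `κ`. -/
noncomputable def sizeWeight (q : ℝ) (n : ℕ) (κ : Fin 3 → ℕ) : ℝ :=
  (∏ i, (κ i : ℝ)) / q ^ 3 * q ^ (κ 0 * κ 1 + κ 0 * κ 2 + κ 1 * κ 2) *
    (∏ i, (1 - q ^ κ i)) ^ (n - ∑ i, κ i)

lemma sizeWeight_eq_zero (q : ℝ) (n : ℕ) {κ : Fin 3 → ℕ} {i : Fin 3} (h : κ i = 0) :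
    sizeWeight q n κ = 0 := by
  have : ∏ i, (κ i : ℝ) = 0 := prod_eq_zero (mem_univ i) (by simp [h])
  simp [sizeWeight, this]

lemma graphProb_exists_isSpecial_le (hp : p ∈ Set.Ioo (0 : ℝ) 1) (f : V → Option (Fin 3)) :
    graphProb p (fun G => ∃ x, IsSpecial G f x) ≤
      sizeWeight (1 - p) (Fintype.card V) fun i => #(cls f i) := by
  have hp1 := hp.1
  have hp2 := hp.2
  have hq : 0 < 1 - p := by linarith
  by_cases h : ∃ i, #(cls f i) = 0
  · obtain ⟨i, hi⟩ := h
    rw [graphProb_exists_isSpecial, sizeWeight_eq_zero _ _ hi, prod_eq_zero (mem_univ i),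
      zero_mul]
    simp [hi]
  · push Not at h
    rw [graphProb_exists_isSpecial, sizeWeight, card_supp, card_edges_crossGraph]
    rw [div_mul_eq_mul_div, div_mul_eq_mul_div, le_div_iff₀ (by positivity)]
    have h1 := fun i => Nat.one_le_iff_ne_zero.2 (h i)
    have h2 : 3 ≤ #(cls f 0) * #(cls f 1) + #(cls f 0) * #(cls f 2) +
        #(cls f 1) * #(cls f 2) := by
      have := Nat.mul_le_mul (h1 0) (h1 1)
      have := Nat.mul_le_mul (h1 0) (h1 2)
      have := Nat.mul_le_mul (h1 1) (h1 2)
      omega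
    generalize #(cls f 0) * #(cls f 1) + #(cls f 0) * #(cls f 2) + #(cls f 1) * #(cls f 2) = e at h2
    obtain ⟨d, rfl⟩ := Nat.exists_eq_add_of_le h2
    have : ∀ i, 0 ≤ 1 - (1 - p) ^ #(cls f i) :=
      fun i => sub_nonneg.2 (pow_le_one₀ hq.le (by linarith))
    have := prod_nonneg (s := univ) fun i _ => this i
    rw [Nat.add_sub_cancel_left, pow_add]
    have hp3 : p ^ 3 ≤ 1 := pow_le_one₀ hp1.le hp2.le
    have key := mul_le_mul_of_nonneg_right hp3 (show 0 ≤ (∏ i, (#(cls f i) : ℝ)) *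
      ((1 - p) ^ 3 * (1 - p) ^ d) * (∏ i, (1 - (1 - p) ^ #(cls f i))) ^
        (Fintype.card V - ∑ i, #(cls f i)) by positivity)
    linarith

lemma graphProb_exists_sizes_le (hp : p ∈ Set.Ioo (0 : ℝ) 1) (S : Finset (Fin 3 → ℕ))
    (Q : (Fin 3 → ℕ) → Prop) (hS : ∀ κ, Q κ → (∀ i, κ i ≤ Fintype.card V) →
      (∀ i, 1 ≤ κ i) → κ ∈ S) :
    graphProb p (fun G : SimpleGraph V => ∃ f x, IsSpecial G f x ∧ Q fun i => #(cls f i)) ≤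
      ∑ κ ∈ S, #{f : V → Option (Fin 3) | ∀ i, #(cls f i) = κ i} *
        sizeWeight (1 - p) (Fintype.card V) κ := by
  have h1 : ∀ G : SimpleGraph V, (∃ f x, IsSpecial G f x ∧ Q fun i => #(cls f i)) →
      ∃ f ∈ ({f | (fun i => #(cls f i)) ∈ S} : Finset (V → Option (Fin 3))),
        ∃ x, IsSpecial G f x := by
    rintro G ⟨f, x, h, hQ⟩
    refine ⟨f, mem_filter.2 ⟨mem_univ _, hS _ hQ (fun i => card_le_univ _) fun i => ?_⟩, x, h⟩
    exact card_pos.2 ⟨x i, by simpa using h.1 i⟩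
  refine (graphProb_mono hp h1).trans ((graphProb_exists_le hp _ _).trans ?_)
  refine (sum_le_sum fun f _ => graphProb_exists_isSpecial_le hp f).trans (le_of_eq ?_)
  rw [← sum_fiberwise_of_maps_to (t := S) (g := fun f : V → Option (Fin 3) => fun i => #(cls f i))
    (fun f hf => (mem_filter.1 hf).2)]
  refine sum_congr rfl fun κ hκ => ?_
  rw [← nsmul_eq_mul, ← sum_const, filter_filter]
  refine sum_congr ?_ ?_
  · ext f
    simp only [mem_filter, mem_univ, true_and, funext_iff]
    refine ⟨fun h => h.2, fun h => ⟨?_, h⟩⟩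
    rw [← funext_iff] at h
    rwa [h]
  · intro f hf
    simp only [mem_filter, mem_univ, true_and] at hf
    simp only [hf]

/-- Permuting the labels of a special labelling. -/
lemma IsSpecial.perm {V : Type*} {G : SimpleGraph V} {f : V → Option (Fin 3)} {x : Fin 3 → V}
    (h : IsSpecial G f x) (σ : Equiv.Perm (Fin 3)) :
    IsSpecial G (fun v => (f v).map σ) (fun i => x (σ.symm i)) := by
  have key : ∀ v i, (f v).map σ = some i ↔ f v = some (σ.symm i) := by
    intro v i
    rw [Option.map_eq_some_iff]
    constructor
    · rintro ⟨a, ha, rfl⟩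
      simpa using ha
    · exact fun h => ⟨_, h, by simp⟩
  refine ⟨fun i => by simp [h.1], fun v hv i => ?_, fun i j hij u v hu hv => ?_⟩
  · obtain ⟨u, hu⟩ := h.2.1 v (by simpa using hv) (σ.symm i)
    exact ⟨u, by simpa only [key] using hu⟩
  · rw [key] at hu hv
    exact h.2.2 _ _ (by simpa using hij) u v hu hv

end FirstMoment

section SizeBounds

open Finset
open scoped Classical

variable {V : Type*} [Fintype V]

/-- Bound for the expected number of special tuples with two small classes. -/
lemma card_sizes_mul_sizeWeight_le_of_small {l : ℝ} (hl : 0 < l) {M : ℝ}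
    (hM : (Fintype.card V : ℝ) = exp M) {κ : Fin 3 → ℕ} (h1 : ∀ i, 1 ≤ κ i)
    (hV : ∀ i, κ i ≤ Fintype.card V) {t : ℝ} (ht : (κ 1 : ℝ) + κ 2 ≤ 2 * t) :
    #{f : V → Option (Fin 3) | ∀ i, #(cls f i) = κ i} *
      sizeWeight (exp (-l)) (Fintype.card V) κ ≤
      exp (3 * M + 3 * l + 2 * t * M + 2 -
        (1 - exp (-l)) * (Fintype.card V * exp (-(l * t)))) := by
  set n := Fintype.card V with hn
  set q := exp (-l) with hq
  have hq0 : 0 < q := exp_pos _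
  have hq1 : q < 1 := Real.exp_lt_one_iff.2 (by linarith)
  have hqp : ∀ j : ℕ, q ^ j = exp (-(l * j)) := fun j => by
    rw [hq, ← exp_nat_mul]; ring_nf
  have hn1 : 1 ≤ n := (h1 0).trans (hV 0)
  have hnpos : (0 : ℝ) < n := by exact_mod_cast hn1
  have hM0 : 0 ≤ M := by
    rw [← exp_le_exp, ← hM, exp_zero]; exact_mod_cast hn1
  have hb : ∀ i, 0 ≤ 1 - q ^ κ i := fun i => sub_nonneg.2 (pow_le_one₀ hq0.le hq1.le)
  have hb' : ∀ i, 1 - q ^ κ i ≤ 1 := fun i => by have := pow_pos hq0 (κ i); linarith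
  let g : Option (Fin 3) → ℝ := fun o =>
    o.elim ((1 - q ^ κ 1) * (1 - q ^ κ 2)) ![q ^ (κ 1 + κ 2), (n : ℝ)⁻¹, (n : ℝ)⁻¹]
  have hg : ∀ o, 0 ≤ g o := by
    rintro (_ | i)
    · exact mul_nonneg (hb 1) (hb 2)
    · fin_cases i <;> (simp [g]; try positivity)
  have key := card_sizes_mul_le (V := V) g hg κ
  set N : ℝ := ((#{f : V → Option (Fin 3) | ∀ i, #(cls f i) = κ i} : ℕ) : ℝ) with hN
  have hgs : ∑ o, g o ≤ exp (2 / n - (1 - q) * (q ^ κ 1 + q ^ κ 2)) := by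
    have e : ∑ o, g o = 2 / n + (1 - q ^ κ 1 * (1 - q ^ κ 2) - q ^ κ 2 * (1 - q ^ κ 1)) := by
      rw [Fintype.sum_option, Fin.sum_univ_three]
      simp only [g, Option.elim]
      simp
      ring
    rw [e]
    have a1 : 1 - q ≤ 1 - q ^ κ 1 := sub_le_sub_left
      (pow_le_of_le_one hq0.le hq1.le (by have := h1 1; omega)) _
    have a2 : 1 - q ≤ 1 - q ^ κ 2 := sub_le_sub_left
      (pow_le_of_le_one hq0.le hq1.le (by have := h1 2; omega)) _
    have := mul_le_mul_of_nonneg_left a1 (pow_pos hq0 (κ 2)).le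
    have := mul_le_mul_of_nonneg_left a2 (pow_pos hq0 (κ 1)).le
    have := add_one_le_exp (2 / n - (1 - q) * (q ^ κ 1 + q ^ κ 2))
    linarith
  have hsw : sizeWeight q n κ ≤ exp (3 * M + 3 * l + (κ 1 + κ 2) * M) *
      (g none ^ (n - ∑ i, κ i) * ∏ i, g (some i) ^ κ i) := by
    rw [sizeWeight, Fin.prod_univ_three, Fin.prod_univ_three, Fin.prod_univ_three]
    have e1 : (κ 0 : ℝ) * κ 1 * κ 2 ≤ exp (3 * M) := by
      have : exp (3 * M) = n * n * n := by rw [hM, ← exp_add, ← exp_add]; ring_nf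
      rw [this]
      have := hV 0; have := hV 1; have := hV 2
      gcongr
    have e2 : g none ^ (n - ∑ i, κ i) * (g (some 0) ^ κ 0 * g (some 1) ^ κ 1 * g (some 2) ^ κ 2) =
        exp (-((κ 1 + κ 2) * M)) * q ^ (κ 0 * κ 1 + κ 0 * κ 2) *
          ((1 - q ^ κ 1) * (1 - q ^ κ 2)) ^ (n - ∑ i, κ i) := by
      simp only [g, Option.elim]
      simp only [Matrix.cons_val_zero, Matrix.cons_val_one, Matrix.cons_val]
      have : exp (-((κ 1 + κ 2) * M)) = ((n : ℝ)⁻¹) ^ κ 1 * ((n : ℝ)⁻¹) ^ κ 2 := by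
        rw [hM, ← exp_neg, ← exp_nat_mul, ← exp_nat_mul, ← exp_add]
        ring_nf
      rw [this, ← pow_mul, show (κ 1 + κ 2) * κ 0 = κ 0 * κ 1 + κ 0 * κ 2 by ring]
      ring
    rw [e2]
    have e3 : exp (3 * M + 3 * l + (κ 1 + κ 2) * M) * exp (-((κ 1 + κ 2) * M)) =
        exp (3 * M) / q ^ 3 := by
      rw [hqp, ← exp_add, ← exp_sub]
      congr 1
      push_cast
      ring
    rw [← mul_assoc, ← mul_assoc, e3]
    have e4 : q ^ (κ 0 * κ 1 + κ 0 * κ 2 + κ 1 * κ 2) ≤ q ^ (κ 0 * κ 1 + κ 0 * κ 2) :=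
      pow_le_pow_of_le_one hq0.le hq1.le (by omega)
    have e5 : (1 - q ^ κ 0) * (1 - q ^ κ 1) * (1 - q ^ κ 2) ≤ (1 - q ^ κ 1) * (1 - q ^ κ 2) := by
      have := mul_nonneg (hb 1) (hb 2)
      nlinarith [hb' 0]
    have e6 : 0 ≤ (1 - q ^ κ 0) * (1 - q ^ κ 1) * (1 - q ^ κ 2) :=
      mul_nonneg (mul_nonneg (hb 0) (hb 1)) (hb 2)
    gcongr
  calc N * sizeWeight q n κ
      ≤ N * (exp (3 * M + 3 * l + (κ 1 + κ 2) * M) *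
      (g none ^ (n - ∑ i, κ i) * ∏ i, g (some i) ^ κ i)) := by gcongr
    _ ≤ exp (3 * M + 3 * l + (κ 1 + κ 2) * M) * (∑ o, g o) ^ n := by
        rw [mul_left_comm]
        gcongr
    _ ≤ exp (3 * M + 3 * l + (κ 1 + κ 2) * M) *
        exp (2 / n - (1 - q) * (q ^ κ 1 + q ^ κ 2)) ^ n := by
        have := sum_nonneg fun o (_ : o ∈ univ) => hg o
        gcongr
    _ = exp (3 * M + 3 * l + (κ 1 + κ 2) * M + 2 - (1 - q) * (n * (q ^ κ 1 + q ^ κ 2))) := by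
        rw [← exp_nat_mul, ← exp_add]
        congr 1
        field_simp
        ring
    _ ≤ _ := by
        rw [exp_le_exp]
        have a : exp (-(l * t)) ≤ q ^ κ 1 + q ^ κ 2 := by
          rw [hqp, hqp]
          rcases le_total (κ 1 : ℝ) (κ 2) with h | h
          · have : exp (-(l * t)) ≤ exp (-(l * κ 1)) := by
              rw [exp_le_exp]; nlinarith
            have := exp_pos (-(l * κ 2))
            linarith
          · have : exp (-(l * t)) ≤ exp (-(l * κ 2)) := by
              rw [exp_le_exp]; nlinarith
            have := exp_pos (-(l * κ 1))
            linarith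
        have : (κ 1 + κ 2) * M ≤ 2 * t * M := by gcongr
        have : (1 - q) * (n * exp (-(l * t))) ≤ (1 - q) * (n * (q ^ κ 1 + q ^ κ 2)) := by
          have : 0 ≤ 1 - q := by linarith
          gcongr
        linarith

/-- Bound for the expected number of special tuples with one large class and two classes that are
not too small. -/
lemma card_sizes_mul_sizeWeight_le_of_large {l : ℝ} (hl : 0 < l) {M : ℝ}
    (hM : (Fintype.card V : ℝ) = exp M) {κ : Fin 3 → ℕ} (hV : ∀ i, κ i ≤ Fintype.card V) {K : ℝ} (hK : 0 < K) (h0 : 20 * K ≤ κ 0)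
    (h12 : 3 / 2 * K ≤ (κ 1 : ℝ) + κ 2) :
    #{f : V → Option (Fin 3) | ∀ i, #(cls f i) = κ i} *
      sizeWeight (exp (-l)) (Fintype.card V) κ ≤
      exp (3 * M + 3 * l - l * K ^ 2 + 3 * (Fintype.card V * exp (-(l * (6 / 5 * K))))) := by
  set n := Fintype.card V with hn
  set q := exp (-l) with hq
  have hq0 : 0 < q := exp_pos _
  have hq1 : q < 1 := Real.exp_lt_one_iff.2 (by linarith)
  have hqp : ∀ j : ℕ, q ^ j = exp (-(l * j)) := fun j => by
    rw [hq, ← exp_nat_mul]; ring_nf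
  have hb : ∀ i, 0 ≤ 1 - q ^ κ i := fun i => sub_nonneg.2 (pow_le_one₀ hq0.le hq1.le)
  have hb' : ∀ i, 1 - q ^ κ i ≤ 1 := fun i => by have := pow_pos hq0 (κ i); linarith
  let g : Option (Fin 3) → ℝ := fun o => o.elim 1 fun _ => exp (-(l * (6 / 5 * K)))
  have hg : ∀ o, 0 ≤ g o := by
    rintro (_ | i) <;> simp only [g, Option.elim] <;> positivity
  have key := card_sizes_mul_le (V := V) g hg κ
  set N : ℝ := ((#{f : V → Option (Fin 3) | ∀ i, #(cls f i) = κ i} : ℕ) : ℝ) with hN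
  have hgs : ∑ o, g o ≤ exp (3 * exp (-(l * (6 / 5 * K)))) := by
    rw [Fintype.sum_option]
    simp only [g, Option.elim]
    have := add_one_le_exp (3 * exp (-(l * (6 / 5 * K))))
    simp
    linarith
  have hsw : sizeWeight q n κ ≤ exp (3 * M + 3 * l - l * K ^ 2) *
      (g none ^ (n - ∑ i, κ i) * ∏ i, g (some i) ^ κ i) := by
    rw [sizeWeight, Fin.prod_univ_three, Fin.prod_univ_three]
    have e1 : (κ 0 : ℝ) * κ 1 * κ 2 ≤ exp (3 * M) := by
      have : exp (3 * M) = n * n * n := by rw [hM, ← exp_add, ← exp_add]; ring_nf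
      rw [this]
      have := hV 0; have := hV 1; have := hV 2
      gcongr
    have e2 : g none ^ (n - ∑ i, κ i) * (∏ i, g (some i) ^ κ i) =
        exp (-(l * (6 / 5 * K * (κ 0 + κ 1 + κ 2)))) := by
      simp only [g, Option.elim, Fin.prod_univ_three]
      simp only [one_pow, one_mul, ← exp_nat_mul, ← exp_add]
      congr 1; ring
    rw [e2]
    have e3 : q ^ (κ 0 * κ 1 + κ 0 * κ 2 + κ 1 * κ 2) ≤
        exp (-(l * (6 / 5 * K * (κ 0 + κ 1 + κ 2)))) * exp (-(l * K ^ 2)) := by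
      rw [hqp, ← exp_add, exp_le_exp]
      push_cast
      have a1 : 6 / 5 * K * (κ 0 + κ 1 + κ 2) + K ^ 2 ≤ κ 0 * (κ 1 + κ 2) := by
        have b1 := mul_le_mul_of_nonneg_left h12 (show (0 : ℝ) ≤ κ 0 by positivity)
        have b2 := mul_le_mul_of_nonneg_right h0 (show (0 : ℝ) ≤ κ 1 + κ 2 by positivity)
        have b3 := mul_le_mul_of_nonneg_left h0 hK.le
        have b4 : 0 ≤ K * (κ 1 + κ 2 : ℝ) := by positivity
        nlinarith
      have a2 : (0 : ℝ) ≤ κ 1 * κ 2 := by positivity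
      have a3 := mul_le_mul_of_nonneg_left (a1.trans (le_add_of_nonneg_right a2)) hl.le
      linarith
    have e4 : ((1 - q ^ κ 0) * (1 - q ^ κ 1) * (1 - q ^ κ 2)) ^ (n - ∑ i, κ i) ≤ 1 := by
      refine pow_le_one₀ (mul_nonneg (mul_nonneg (hb 0) (hb 1)) (hb 2)) ?_
      exact mul_le_one₀ (mul_le_one₀ (hb' 0) (hb 1) (hb' 1)) (hb 2) (hb' 2)
    have e5 : exp (3 * M + 3 * l - l * K ^ 2) = exp (3 * M) / q ^ 3 * exp (-(l * K ^ 2)) := by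
      rw [hqp, ← exp_sub, ← exp_add]
      congr 1; push_cast; ring
    rw [e5]
    calc _ ≤ exp (3 * M) / q ^ 3 * (exp (-(l * (6 / 5 * K * (κ 0 + κ 1 + κ 2)))) *
          exp (-(l * K ^ 2))) * 1 := by
          gcongr
          exact pow_nonneg (mul_nonneg (mul_nonneg (hb 0) (hb 1)) (hb 2)) _
      _ = _ := by ring
  calc N * sizeWeight q n κ
      ≤ N * (exp (3 * M + 3 * l - l * K ^ 2) *
      (g none ^ (n - ∑ i, κ i) * ∏ i, g (some i) ^ κ i)) := by gcongr
    _ ≤ exp (3 * M + 3 * l - l * K ^ 2) * (∑ o, g o) ^ n := by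
        rw [mul_left_comm]
        gcongr
    _ ≤ exp (3 * M + 3 * l - l * K ^ 2) * exp (3 * exp (-(l * (6 / 5 * K)))) ^ n := by
        have := sum_nonneg fun o (_ : o ∈ univ) => hg o
        gcongr
    _ = _ := by
        rw [← exp_nat_mul, ← exp_add]
        congr 1
        ring

/-- Bound for the expected number of special tuples with given class sizes. -/
lemma card_sizes_mul_sizeWeight_le {l : ℝ} (hl : 0 < l) {M : ℝ}
    (hM : (Fintype.card V : ℝ) = exp M) {κ : Fin 3 → ℕ} (h1 : ∀ i, 1 ≤ κ i) :
    #{f : V → Option (Fin 3) | ∀ i, #(cls f i) = κ i} *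
      sizeWeight (exp (-l)) (Fintype.card V) κ ≤
      (∏ i, (κ i : ℝ)) * exp (3 * l + ∑ i, κ i * (1 + M - log (κ i)) -
        l * (κ 0 * κ 1 + κ 0 * κ 2 + κ 1 * κ 2) -
        (Fintype.card V - ∑ i, (κ i : ℝ)) * ∑ i, exp (-(l * κ i))) := by
  set n := Fintype.card V with hn
  set q := exp (-l) with hq
  have hq0 : 0 < q := exp_pos _
  have hq1 : q < 1 := Real.exp_lt_one_iff.2 (by linarith)
  have hqp : ∀ j : ℕ, q ^ j = exp (-(l * j)) := fun j => by
    rw [hq, ← exp_nat_mul]; ring_nf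
  have hnpos : (0 : ℝ) < n := by rw [hM]; exact exp_pos _
  have hκ : ∀ i, (0 : ℝ) < κ i := fun i => by exact_mod_cast h1 i
  have hb : ∀ i, 0 ≤ 1 - q ^ κ i := fun i => sub_nonneg.2 (pow_le_one₀ hq0.le hq1.le)
  let g : Option (Fin 3) → ℝ := fun o => o.elim 1 fun i => κ i / n
  have hg : ∀ o, 0 ≤ g o := by
    rintro (_ | i) <;> simp only [g, Option.elim] <;> positivity
  have key := card_sizes_mul_le (V := V) g hg κ
  set N : ℝ := ((#{f : V → Option (Fin 3) | ∀ i, #(cls f i) = κ i} : ℕ) : ℝ) with hN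
  have hgs : (∑ o, g o) ^ n ≤ exp (∑ i, (κ i : ℝ)) := by
    rw [Fintype.sum_option]
    simp only [g, Option.elim]
    have := add_one_le_exp (∑ i, (κ i : ℝ) / n)
    calc _ ≤ (exp (∑ i, (κ i : ℝ) / n)) ^ n := by
          have : 0 ≤ ∑ i, (κ i : ℝ) / n := sum_nonneg fun i _ => by positivity
          gcongr
          linarith
      _ = _ := by
          rw [← exp_nat_mul, ← sum_div]
          congr 1
          field_simp
  have hgp : g none ^ (n - ∑ i, κ i) * ∏ i, g (some i) ^ κ i =
      exp (-∑ i, κ i * (M - log (κ i))) := by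
    simp only [g, Option.elim, one_pow, one_mul]
    rw [← sum_neg_distrib, exp_sum]
    refine prod_congr rfl fun i _ => ?_
    rw [hM]
    nth_rewrite 1 [← exp_log (hκ i)]
    rw [← exp_sub, ← exp_nat_mul]
    congr 1; ring
  rw [hgp] at key
  have hNle : N ≤ exp (∑ i, κ i * (1 + M - log (κ i))) := by
    have := key.trans hgs
    rw [exp_neg, ← div_eq_mul_inv, div_le_iff₀ (exp_pos _), ← exp_add] at this
    refine this.trans (le_of_eq ?_)
    congr 1
    rw [← sum_add_distrib]
    exact sum_congr rfl fun i _ => by ring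
  have hpw : (∏ i, (1 - q ^ κ i)) ^ (n - ∑ i, κ i) ≤
      exp (-((n - ∑ i, (κ i : ℝ)) * ∑ i, exp (-(l * κ i)))) := by
    calc _ ≤ (∏ i, exp (-exp (-(l * κ i)))) ^ (n - ∑ i, κ i) := by
          have := prod_nonneg fun i (_ : i ∈ univ) => hb i
          gcongr with i _
          · exact fun i _ => hb i
          · rw [hqp]
            exact one_sub_le_exp_neg _
      _ = exp (-(((n - ∑ i, κ i : ℕ) : ℝ) * ∑ i, exp (-(l * κ i)))) := by
          rw [← exp_sum, ← exp_nat_mul, sum_neg_distrib]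
          congr 1; ring
      _ ≤ _ := by
          have h : (n : ℝ) - ∑ i, (κ i : ℝ) ≤ ((n - ∑ i, κ i : ℕ) : ℝ) := by
            have : n ≤ (n - ∑ i, κ i) + ∑ i, κ i := by omega
            have : (n : ℝ) ≤ ((n - ∑ i, κ i : ℕ) : ℝ) + ((∑ i, κ i : ℕ) : ℝ) := by exact_mod_cast this
            push_cast at this
            linarith
          rw [exp_le_exp, neg_le_neg_iff]
          have := sum_nonneg fun i (_ : i ∈ univ) => (exp_pos (-(l * κ i))).le
          gcongr
  rw [sizeWeight]
  have e1 : 0 ≤ ∏ i, (κ i : ℝ) := prod_nonneg fun i _ => (hκ i).le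
  have e2 : (∏ i, (κ i : ℝ)) / q ^ 3 * q ^ (κ 0 * κ 1 + κ 0 * κ 2 + κ 1 * κ 2) =
      (∏ i, (κ i : ℝ)) * exp (3 * l - l * (κ 0 * κ 1 + κ 0 * κ 2 + κ 1 * κ 2)) := by
    rw [hqp, hqp, div_eq_mul_inv, ← exp_neg, mul_assoc, ← exp_add]
    congr 2
    push_cast; ring
  rw [e2]
  have e3 := pow_nonneg (prod_nonneg fun i (_ : i ∈ univ) => hb i) (n - ∑ i, κ i)
  calc _ ≤ exp (∑ i, κ i * (1 + M - log (κ i))) *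
        ((∏ i, (κ i : ℝ)) * exp (3 * l - l * (κ 0 * κ 1 + κ 0 * κ 2 + κ 1 * κ 2)) *
        exp (-((n - ∑ i, (κ i : ℝ)) * ∑ i, exp (-(l * κ i))))) := by
        gcongr
    _ = _ := by
        rw [mul_assoc, ← exp_add, mul_left_comm, ← exp_add]
        congr 2
        ring

end SizeBounds

section Exponent

/-- The function `z ↦ z - 1 + e⁻ᶻ`, which is nonnegative and vanishes only at `0`. -/
noncomputable def psi (z : ℝ) : ℝ := z - 1 + exp (-z)

lemma psi_nonneg (z : ℝ) : 0 ≤ psi z := by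
  have := add_one_le_exp (-z)
  unfold psi; linarith

lemma psi_pos {z : ℝ} (hz : z ≠ 0) : 0 < psi z := by
  have := add_one_lt_exp (neg_ne_zero.2 hz)
  unfold psi; linarith

lemma sq_le_psi_neg {v : ℝ} (hv : 0 ≤ v) : v ^ 2 / 2 ≤ psi (-v) := by
  have := quadratic_le_exp_of_nonneg hv
  unfold psi; rw [neg_neg]; linarith

lemma linear_le_psi {z w : ℝ} (hw : 0 < w) (h : w ≤ z) : psi w / w * z ≤ psi z := by
  rw [div_mul_eq_mul_div, div_le_iff₀ hw]
  have h1 : exp (-w) * (1 + w - z) ≤ exp (-z) := by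
    have := add_one_le_exp (w - z)
    have e : exp (-z) = exp (-w) * exp (w - z) := by rw [← exp_add]; congr 1; ring
    rw [e]
    have := exp_pos (-w)
    gcongr
    linarith
  have h2 : exp (-w) * (1 + w) ≤ 1 := by
    have := add_one_le_exp w
    have e : exp (-w) * exp w = 1 := by rw [← exp_add]; simp
    rw [← e]
    have := exp_pos (-w)
    gcongr
    linarith
  unfold psi
  nlinarith [mul_nonneg (sub_nonneg.2 h) (sub_nonneg.2 h2), mul_le_mul_of_nonneg_right h1 hw.le]

/-- A uniform lower bound for `psi (l * a)` with `|a| ≥ 1/2`. -/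
lemma min_le_psi {l a : ℝ} (hl : 0 < l) (ha : 1 / 2 ≤ |a|) :
    min (psi (l / 2)) (l ^ 2 / 8) ≤ psi (l * a) := by
  rcases le_abs.1 ha with h | h
  · have h1 : l / 2 ≤ l * a := by nlinarith
    have h2 := linear_le_psi (by positivity) h1
    have h3 : psi (l / 2) ≤ psi (l / 2) / (l / 2) * (l * a) := by
      have h4 := psi_nonneg (l / 2)
      rw [div_mul_eq_mul_div, le_div_iff₀ (by positivity)]
      exact mul_le_mul_of_nonneg_left h1 h4
    exact (min_le_left _ _).trans (h3.trans h2)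
  · have h2 := sq_le_psi_neg (v := l * (-a)) (by nlinarith)
    rw [show -(l * (-a)) = l * a by ring] at h2
    refine (min_le_right _ _).trans (le_trans ?_ h2)
    have : l / 2 ≤ l * (-a) := by nlinarith
    nlinarith

/-- Conditions on `K` that hold for all large `K`. -/
structure LargeFor (l K : ℝ) : Prop where
  one_le : 1 ≤ K
  exp_small : 60 * K * exp (-(l * (K / 2))) ≤ 1
  psi_large : 480 ≤ (l * (K / 2)) ^ 2 / 2
  slope_large : 160 ≤ K * (psi (l / 2) / 2)

lemma eventually_largeFor {l : ℝ} (hl : 0 < l) : ∀ᶠ K in atTop, LargeFor l K := by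
  have h1 : Tendsto (fun K : ℝ => 60 * K * exp (-(l * (K / 2)))) atTop (nhds 0) := by
    have h := (tendsto_pow_mul_exp_neg_atTop_nhds_zero 1).comp
      (tendsto_id.const_mul_atTop (show 0 < l / 2 by positivity))
    have h2 := h.const_mul (120 / l)
    rw [mul_zero] at h2
    refine h2.congr fun K => ?_
    simp only [Function.comp, id, pow_one]
    rw [show l * (K / 2) = l / 2 * K by ring]
    field_simp
    ring
  have h2 : Tendsto (fun K : ℝ => (l * (K / 2)) ^ 2 / 2) atTop atTop := by
    refine Tendsto.atTop_div_const (by norm_num) ((tendsto_pow_atTop two_ne_zero).comp ?_)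
    exact (tendsto_id.atTop_div_const (by norm_num)).const_mul_atTop hl
  have h3 : Tendsto (fun K : ℝ => K * (psi (l / 2) / 2)) atTop atTop :=
    tendsto_id.atTop_mul_const (by have := psi_pos (show l / 2 ≠ 0 by positivity); positivity)
  filter_upwards [eventually_ge_atTop 1, h1.eventually_le_const one_pos,
    h2.eventually_ge_atTop 480, h3.eventually_ge_atTop 160] with K a b c d
  exact ⟨a, b, c, d⟩

lemma neg_mul_le_psi {l K a b : ℝ} (hl : 0 < l) (hK : LargeFor l K) (ha : 1 / 2 ≤ |a|)
    (hb : 1 / 2 ≤ |b|) (haK : a ≤ 19 * K) (hbK : b ≤ 19 * K) :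
    -(l * (a * b)) ≤ K / 4 * (psi (l * a) + psi (l * b)) := by
  have key : ∀ a v : ℝ, 1 / 2 ≤ a → 1 / 2 ≤ v → a ≤ 19 * K →
      l * (a * v) ≤ K / 4 * (psi (l * a) + psi (l * (-v))) := by
    intro a v ha hv haK
    have hs := hK.slope_large
    have hK1 := hK.one_le
    have h1 : l / 2 ≤ l * a := by nlinarith
    have h2 := linear_le_psi (by positivity) h1
    have h3 := psi_nonneg (l * (-v))
    have h4 := sq_le_psi_neg (v := l * v) (by positivity)
    rw [show -(l * v) = l * (-v) by ring] at h4
    have h5 := psi_nonneg (l * a)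
    have h6 : psi (l / 2) / (l / 2) * (l * a) = 2 * psi (l / 2) * a := by field_simp
    rw [h6] at h2
    by_cases hc : l * v ≤ K / 2 * psi (l / 2)
    · have := mul_le_mul_of_nonneg_right hc (show 0 ≤ a by linarith)
      nlinarith
    · push Not at hc
      have h7 : 160 ≤ l * v := by linarith
      have h8 : 80 * (l * v) ≤ psi (l * (-v)) := by nlinarith
      have h9 := mul_le_mul_of_nonneg_left haK (show 0 ≤ l * v by positivity)
      nlinarith
  have hK1 := hK.one_le
  have hpa := psi_nonneg (l * a)
  have hpb := psi_nonneg (l * b)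
  have hpos : 0 ≤ K / 4 * (psi (l * a) + psi (l * b)) := by positivity
  rcases le_abs.1 ha with h | h <;> rcases le_abs.1 hb with h' | h'
  · have : 0 ≤ l * (a * b) := mul_nonneg hl.le (mul_nonneg (by linarith) (by linarith))
    linarith
  · have := key a (-b) h h' haK
    rw [neg_neg] at this
    linarith
  · have := key b (-a) h' h hbK
    rw [neg_neg] at this
    linarith
  · have : 0 ≤ l * (-a * -b) := mul_nonneg hl.le (mul_nonneg (by linarith) (by linarith))
    linarith

lemma exp_mul_le_psi {l K k : ℝ} (hl : 0 < l) (hK : LargeFor l K) (hk : 0 ≤ k) :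
    60 * K * exp (-(l * k)) ≤ 1 + K / 8 * psi (l * (k - K)) := by
  have hK1 := hK.one_le
  have h0 := psi_nonneg (l * (k - K))
  by_cases h : k ≤ K / 2
  · have h1 := sq_le_psi_neg (v := l * (K - k)) (mul_nonneg hl.le (by linarith))
    rw [show -(l * (K - k)) = l * (k - K) by ring] at h1
    have h2 : (l * (K / 2)) ^ 2 ≤ (l * (K - k)) ^ 2 := by gcongr; linarith
    have h3 := hK.psi_large
    have h4 : exp (-(l * k)) ≤ 1 := exp_le_one_iff.2 (by nlinarith)
    nlinarith
  · push Not at h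
    have h1 : exp (-(l * k)) ≤ exp (-(l * (K / 2))) := by
      rw [exp_le_exp]; nlinarith
    have := hK.exp_small
    nlinarith [mul_nonneg (show 0 ≤ K by linarith) h0]

/-- The exponent of the expected number of special tuples, when all class sizes stay away from
`K`. -/
lemma exponent_le {l K M : ℝ} (hl : 0 < l) (hK : LargeFor l K) {k : Fin 3 → ℝ}
    (hk : ∀ i, 0 < k i) (hk' : ∀ i, k i ≤ 20 * K) (hd : ∀ i, 1 / 2 ≤ |k i - K|)
    (hn : K * exp (l * K) ≤ exp M) (hn' : exp M ≤ K * exp (l * K) + 1) :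
    ∑ i, k i * (1 + M - log (k i)) - l * (k 0 * k 1 + k 0 * k 2 + k 1 * k 2) -
      (exp M - ∑ i, k i) * ∑ i, exp (-(l * k i)) ≤
      63 - K * min (psi (l / 2)) (l ^ 2 / 8) := by
  have hK1 := hK.one_le
  have hM : M ≤ log K + l * K + 1 / K := by
    have h1 : exp M ≤ K * exp (l * K) * exp (1 / K) := by
      have h2 := add_one_le_exp (1 / K)
      have h3 : 1 ≤ exp (l * K) := one_le_exp (by positivity)
      have h4 : K * exp (l * K) * (1 / K + 1) ≤ K * exp (l * K) * exp (1 / K) := by gcongr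
      have h5 : K * exp (l * K) * (1 / K + 1) = exp (l * K) + K * exp (l * K) := by field_simp
      linarith
    rw [← exp_le_exp]
    refine h1.trans (le_of_eq ?_)
    rw [exp_add, exp_add, exp_log (by linarith)]
  have e1 : ∀ i, k i * (1 + M - log (k i)) ≤ K + l * K * k i + 20 := by
    intro i
    have a1 : log (K / k i) ≤ K / k i - 1 := log_le_sub_one_of_pos (div_pos (by linarith) (hk i))
    rw [log_div (by linarith) (hk i).ne'] at a1
    have a2 := mul_le_mul_of_nonneg_left (a := k i)
      (show 1 + M - log (k i) ≤ K / k i + l * K + 1 / K by linarith) (hk i).le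
    refine a2.trans ?_
    have a3 : k i * (1 / K) ≤ 20 := by
      rw [mul_one_div, div_le_iff₀ (by linarith)]; exact hk' i
    have a4 : k i * (K / k i) = K := by have := (hk i).ne'; field_simp
    nlinarith
  have e2 : (K * exp (l * K) - 60 * K) * ∑ i, exp (-(l * k i)) ≤
      (exp M - ∑ i, k i) * ∑ i, exp (-(l * k i)) := by
    have : 0 ≤ ∑ i, exp (-(l * k i)) := Finset.sum_nonneg fun i _ => (exp_pos _).le
    have := hk' 0; have := hk' 1; have := hk' 2
    rw [Fin.sum_univ_three k]
    gcongr ?_ * _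
    linarith
  have e3 : ∀ i, K * exp (l * K) * exp (-(l * k i)) = K * (psi (l * (k i - K)) + 1) -
      K * (l * (k i - K)) := by
    intro i
    rw [mul_assoc, ← exp_add, psi]
    ring_nf
  have e4 := fun i => exp_mul_le_psi hl hK (hk i).le
  have e5 := fun i j => neg_mul_le_psi hl hK (hd i) (hd j) (by linarith [hk' i]) (by linarith [hk' j])
  have e6 := fun i => min_le_psi hl (hd i)
  have e7 : ∀ i, K * min (psi (l / 2)) (l ^ 2 / 8) ≤ K * psi (l * (k i - K)) := fun i =>
    mul_le_mul_of_nonneg_left (e6 i) (by linarith)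
  simp only [Fin.sum_univ_three] at e2 ⊢
  have f0 := e1 0; have f1 := e1 1; have f2 := e1 2
  have g0 := e3 0; have g1 := e3 1; have g2 := e3 2
  have h0 := e4 0; have h1 := e4 1; have h2 := e4 2
  have i01 := e5 0 1; have i02 := e5 0 2; have i12 := e5 1 2
  have j0 := e7 0; have j1 := e7 1; have j2 := e7 2
  have m0 : 0 ≤ K * min (psi (l / 2)) (l ^ 2 / 8) :=
    mul_nonneg (by linarith) (le_min (psi_nonneg _) (by positivity))
  nlinarith

end Exponent

section UpperBound

open Finset
open scoped Classical

variable {V : Type*} [Fintype V] {p : ℝ}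

lemma graphProb_or_le (hp : p ∈ Set.Ioo (0 : ℝ) 1) (Q Q' : SimpleGraph V → Prop) :
    graphProb p (fun G => Q G ∨ Q' G) ≤ graphProb p Q + graphProb p Q' := by
  have h := graphProb_exists_le hp (univ : Finset Bool) (fun b => if b then Q else Q')
  simpa [or_comm] using h

lemma cls_map (f : V → Option (Fin 3)) (σ : Equiv.Perm (Fin 3)) (i : Fin 3) :
    cls (fun v => (f v).map σ) i = cls f (σ.symm i) := by
  ext v
  simp only [mem_cls, Option.map_eq_some_iff]
  constructor
  · rintro ⟨a, ha, rfl⟩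
    simpa using ha
  · exact fun h => ⟨_, h, by simp⟩

lemma graphProb_exists_isSpecial_le_add (hp : p ∈ Set.Ioo (0 : ℝ) 1) (t : ℝ) :
    graphProb p (fun G : SimpleGraph V => ∃ f x, IsSpecial G f x) ≤
      graphProb p (fun G : SimpleGraph V => ∃ f x, IsSpecial G f x ∧ t ≤ (#(cls f 0) : ℝ)) +
      graphProb p (fun G : SimpleGraph V => ∃ f x, IsSpecial G f x ∧
        ∀ i, (#(cls f i) : ℝ) ≤ t) := by
  refine le_trans (graphProb_mono hp ?_) (graphProb_or_le hp _ _)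
  rintro G ⟨f, x, h⟩
  by_cases hs : ∀ i, (#(cls f i) : ℝ) ≤ t
  · exact Or.inr ⟨f, x, h, hs⟩
  · push Not at hs
    obtain ⟨i, hi⟩ := hs
    refine Or.inl ⟨_, _, h.perm (Equiv.swap 0 i), ?_⟩
    rw [cls_map]
    simpa using hi.le

/-- A bound for the probability of a special tuple that tends to `0`. -/
noncomputable def upperBound (l K : ℝ) : ℝ :=
  exp (6 * ((l + 2) * K) + 3 * l + 3 / 2 * K * ((l + 2) * K) + 2 -
    (1 - exp (-l)) * exp (l * (K / 4))) +
  exp (6 * ((l + 2) * K) + 3 * l - l * K ^ 2 + 6 * K) +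
  (20 * K) ^ 6 * exp (3 * l + 63 - K * min (psi (l / 2)) (l ^ 2 / 8))

lemma tendsto_upperBound {l : ℝ} (hl : 0 < l) :
    Tendsto (upperBound l) atTop (nhds 0) := by
  have hq : 0 < 1 - exp (-l) := by
    have : exp (-l) < 1 := exp_lt_one_iff.2 (by linarith)
    linarith
  have h1 : Tendsto (fun K => exp (6 * ((l + 2) * K) + 3 * l + 3 / 2 * K * ((l + 2) * K) + 2 -
      (1 - exp (-l)) * exp (l * (K / 4)))) atTop (nhds 0) := by
    refine tendsto_exp_atBot.comp ?_
    set D := (1 - exp (-l)) * (l / 4) ^ 3 / 6 with hD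
    have hD0 : 0 < D := by positivity
    have h : Tendsto (fun K : ℝ => K * (6 * (l + 2) + K * (3 / 2 * (l + 2) - D * K)) +
        (3 * l + 2)) atTop atBot := by
      refine tendsto_atBot_add_const_right _ _ (tendsto_id.atTop_mul_atBot₀ ?_)
      refine tendsto_atBot_add_const_left _ _ (tendsto_id.atTop_mul_atBot₀ ?_)
      simp only [sub_eq_add_neg]
      refine tendsto_atBot_add_const_left _ _ ?_
      exact tendsto_neg_atTop_atBot.comp (tendsto_id.const_mul_atTop hD0)
    refine tendsto_atBot_mono' _ ?_ h
    filter_upwards [eventually_ge_atTop 0] with K hK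
    have := pow_div_factorial_le_exp (l * (K / 4)) (by positivity) 3
    have e : ((3).factorial : ℝ) = 6 := by norm_num [Nat.factorial]
    rw [e] at this
    have := mul_le_mul_of_nonneg_left this hq.le
    have e2 : (1 - exp (-l)) * ((l * (K / 4)) ^ 3 / 6) = D * K ^ 3 := by rw [hD]; ring
    nlinarith
  have h2 : Tendsto (fun K => exp (6 * ((l + 2) * K) + 3 * l - l * K ^ 2 + 6 * K)) atTop
      (nhds 0) := by
    refine tendsto_exp_atBot.comp ?_
    have h : Tendsto (fun K : ℝ => K * (6 * (l + 2) + 6 - l * K) + 3 * l) atTop atBot := by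
      refine tendsto_atBot_add_const_right _ _ (tendsto_id.atTop_mul_atBot₀ ?_)
      simp only [sub_eq_add_neg]
      refine tendsto_atBot_add_const_left _ _ ?_
      exact tendsto_neg_atTop_atBot.comp (tendsto_id.const_mul_atTop hl)
    refine h.congr fun K => by ring
  have h3 : Tendsto (fun K => (20 * K) ^ 6 *
      exp (3 * l + 63 - K * min (psi (l / 2)) (l ^ 2 / 8))) atTop (nhds 0) := by
    set c := min (psi (l / 2)) (l ^ 2 / 8) with hc
    have hc0 : 0 < c := lt_min (psi_pos (by positivity)) (by positivity)
    have h := ((tendsto_pow_mul_exp_neg_atTop_nhds_zero 6).comp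
      (tendsto_id.const_mul_atTop hc0)).const_mul (20 ^ 6 / c ^ 6 * exp (3 * l + 63))
    rw [mul_zero] at h
    refine h.congr fun K => ?_
    simp only [Function.comp, id]
    rw [sub_eq_add_neg, exp_add _ (-(K * c)), mul_comm K c]
    field_simp
  have h := (h1.add h2).add h3
  rw [add_zero, add_zero] at h
  exact h

lemma graphProb_large_le {l : ℝ} (hl : 0 < l) {K M : ℝ} (hK : 1 ≤ K)
    (hM : (Fintype.card V : ℝ) = exp M)
    (hn : K * exp (l * K) ≤ exp M) (hn' : exp M ≤ K * exp (l * K) + 1) :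
    graphProb (1 - exp (-l)) (fun G : SimpleGraph V =>
      ∃ f x, IsSpecial G f x ∧ 20 * K ≤ (#(cls f 0) : ℝ)) ≤
    exp (6 * ((l + 2) * K) + 3 * l + 3 / 2 * K * ((l + 2) * K) + 2 -
      (1 - exp (-l)) * exp (l * (K / 4))) +
    exp (6 * ((l + 2) * K) + 3 * l - l * K ^ 2 + 6 * K) := by
  have hq : exp (-l) < 1 := exp_lt_one_iff.2 (by linarith)
  have hq0 := exp_pos (-l)
  have hp : 1 - exp (-l) ∈ Set.Ioo (0 : ℝ) 1 := ⟨by linarith, by linarith⟩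
  have hlK : 0 < l * K := by positivity
  have hMK : M ≤ (l + 2) * K := by
    rw [← exp_le_exp]
    refine hn'.trans ?_
    have h1 : 1 ≤ exp (l * K) := one_le_exp hlK.le
    have h2 : (K + 1) * exp (l * K) ≤ exp K * exp (l * K) := by
      have := add_one_le_exp K; gcongr
    have h3 : exp K * exp (l * K) ≤ exp ((l + 2) * K) := by
      rw [← exp_add, exp_le_exp]; nlinarith
    linarith
  have hK0 : 0 ≤ K := by linarith
  set n := Fintype.card V with hn
  set A := exp (3 * M + 3 * l + 2 * (3 / 4 * K) * M + 2 -
        (1 - exp (-l)) * (n * exp (-(l * (3 / 4 * K))))) with hA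
  set B := exp (3 * M + 3 * l - l * K ^ 2 + 3 * (n * exp (-(l * (6 / 5 * K))))) with hB
  have h1 := graphProb_exists_sizes_le (V := V) hp
    {κ ∈ Fintype.piFinset fun _ : Fin 3 => Icc 1 n | 20 * K ≤ κ 0}
    (fun κ => 20 * K ≤ κ 0) (by
      intro κ hκ h2 h3
      simp only [mem_filter, Fintype.mem_piFinset, mem_Icc]
      exact ⟨fun i => ⟨h3 i, h2 i⟩, hκ⟩)
  simp only [sub_sub_cancel] at h1
  refine h1.trans ?_
  have h2 := sum_le_card_nsmul {κ ∈ Fintype.piFinset fun _ : Fin 3 => Icc 1 n | 20 * K ≤ κ 0}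
    (fun κ => #{f : V → Option (Fin 3) | ∀ i, #(cls f i) = κ i} * sizeWeight (exp (-l)) n κ)
    (A + B) (by
      intro κ hκ
      simp only [mem_filter, Fintype.mem_piFinset, mem_Icc] at hκ
      have hA0 : 0 < A := exp_pos _
      have hB0 : 0 < B := exp_pos _
      rcases le_total ((κ 1 : ℝ) + κ 2) (3 / 2 * K) with h | h
      · have := card_sizes_mul_sizeWeight_le_of_small hl hM (fun i => (hκ.1 i).1)
          (fun i => (hκ.1 i).2) (t := 3 / 4 * K) (by linarith)
        linarith
      · have := card_sizes_mul_sizeWeight_le_of_large hl hM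
          (fun i => (hκ.1 i).2) (K := K) (by linarith) hκ.2 h
        linarith)
  refine h2.trans ?_
  have hcard : (#{κ ∈ Fintype.piFinset fun _ : Fin 3 => Icc 1 n | 20 * K ≤ κ 0} : ℝ) ≤
      exp (3 * M) := by
    have a : #{κ ∈ Fintype.piFinset fun _ : Fin 3 => Icc 1 n | 20 * K ≤ κ 0} ≤ n ^ 3 := by
      refine (card_filter_le _ _).trans ?_
      simp
    have b : exp (3 * M) = (n : ℝ) ^ 3 := by
      rw [hM, ← exp_nat_mul]; norm_num
    rw [b]
    exact_mod_cast a
  rw [nsmul_eq_mul]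
  refine (mul_le_mul_of_nonneg_right hcard (by positivity)).trans ?_
  rw [mul_add, hA, hB, ← exp_add, ← exp_add]
  refine add_le_add ?_ ?_
  · rw [exp_le_exp]
    have a : exp (l * (K / 4)) ≤ n * exp (-(l * (3 / 4 * K))) := by
      calc exp (l * (K / 4)) ≤ K * exp (l * K) * exp (-(l * (3 / 4 * K))) := by
            rw [mul_assoc, ← exp_add, show l * K + -(l * (3 / 4 * K)) = l * (K / 4) by ring]
            exact le_mul_of_one_le_left (exp_pos _).le hK
        _ ≤ _ := by rw [hM]; gcongr
    have := mul_le_mul_of_nonneg_left a hp.1.le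
    have := mul_le_mul_of_nonneg_left hMK hK0
    linarith
  · rw [exp_le_exp]
    have a : n * exp (-(l * (6 / 5 * K))) ≤ 2 * K := by
      calc n * exp (-(l * (6 / 5 * K))) ≤ ((K + 1) * exp (l * K)) * exp (-(l * (6 / 5 * K))) := by
            have : 1 ≤ exp (l * K) := one_le_exp hlK.le
            gcongr
            linarith
        _ = (K + 1) * exp (-(l * K / 5)) := by
            rw [mul_assoc, ← exp_add]; congr 2; ring
        _ ≤ (K + 1) * 1 := by
            gcongr
            exact exp_le_one_iff.2 (by linarith)
        _ ≤ _ := by linarith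
    linarith

lemma graphProb_small_le {l : ℝ} (hl : 0 < l) {K M : ℝ} (hK : LargeFor l K)
    (hd : ∀ k : ℕ, 1 / 2 ≤ |(k : ℝ) - K|) (hM : (Fintype.card V : ℝ) = exp M)
    (hn : K * exp (l * K) ≤ exp M) (hn' : exp M ≤ K * exp (l * K) + 1) :
    graphProb (1 - exp (-l)) (fun G : SimpleGraph V =>
      ∃ f x, IsSpecial G f x ∧ ∀ i, (#(cls f i) : ℝ) ≤ 20 * K) ≤
    (20 * K) ^ 6 * exp (3 * l + 63 - K * min (psi (l / 2)) (l ^ 2 / 8)) := by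
  have hq : exp (-l) < 1 := exp_lt_one_iff.2 (by linarith)
  have hq0 := exp_pos (-l)
  have hp : 1 - exp (-l) ∈ Set.Ioo (0 : ℝ) 1 := ⟨by linarith, by linarith⟩
  have hK1 := hK.one_le
  have h1 := graphProb_exists_sizes_le (V := V) hp
    (Fintype.piFinset fun _ : Fin 3 => Icc 1 ⌊20 * K⌋₊)
    (fun κ => ∀ i, (κ i : ℝ) ≤ 20 * K) (by
      intro κ hκ h2 h3
      simp only [Fintype.mem_piFinset, mem_Icc]
      exact fun i => ⟨h3 i, Nat.le_floor (hκ i)⟩)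
  simp only [sub_sub_cancel] at h1
  refine h1.trans ?_
  set E := exp (3 * l + 63 - K * min (psi (l / 2)) (l ^ 2 / 8)) with hE
  have h2 := sum_le_card_nsmul (Fintype.piFinset fun _ : Fin 3 => Icc 1 ⌊20 * K⌋₊)
    (fun κ => #{f : V → Option (Fin 3) | ∀ i, #(cls f i) = κ i} *
      sizeWeight (exp (-l)) (Fintype.card V) κ)
    ((20 * K) ^ 3 * E) (by
      intro κ hκ
      simp only [Fintype.mem_piFinset, mem_Icc] at hκ
      have hκ1 : ∀ i, (0 : ℝ) < κ i := fun i => by exact_mod_cast (hκ i).1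
      have hκ2 : ∀ i, (κ i : ℝ) ≤ 20 * K := fun i =>
        (Nat.le_floor_iff (by positivity)).1 (hκ i).2
      refine (card_sizes_mul_sizeWeight_le hl hM (fun i => (hκ i).1)).trans ?_
      have a : ∏ i, (κ i : ℝ) ≤ (20 * K) ^ 3 := by
        have := prod_le_prod (s := (univ : Finset (Fin 3))) (fun i _ => (hκ1 i).le)
          (fun i _ => hκ2 i)
        simpa using this
      have b := exponent_le hl hK hκ1 hκ2 (fun i => hd (κ i)) hn hn'
      rw [hM, hE]
      refine mul_le_mul a ?_ (exp_pos _).le (by positivity)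
      rw [exp_le_exp]
      linarith)
  refine h2.trans ?_
  have hcard : (#(Fintype.piFinset fun _ : Fin 3 => Icc 1 ⌊20 * K⌋₊) : ℝ) ≤ (20 * K) ^ 3 := by
    simp only [Fintype.card_piFinset, Nat.card_Icc, Nat.add_sub_cancel, prod_const, card_univ,
      Fintype.card_fin, Nat.cast_pow]
    have := Nat.floor_le (show 0 ≤ 20 * K by positivity)
    gcongr
  rw [nsmul_eq_mul]
  have : 0 ≤ (20 * K) ^ 3 * E := by positivity
  calc _ ≤ (20 * K) ^ 3 * ((20 * K) ^ 3 * E) := by gcongr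
    _ = _ := by ring

lemma graphProb_le_upperBound {l : ℝ} (hl : 0 < l) {K : ℝ} (hK : LargeFor l K)
    (hd : ∀ k : ℕ, 1 / 2 ≤ |(k : ℝ) - K|)
    (hn : K * exp (l * K) ≤ Fintype.card V) (hn' : Fintype.card V ≤ K * exp (l * K) + 1) :
    graphProb (1 - exp (-l)) (fun G : SimpleGraph V => ∃ f x, IsSpecial G f x) ≤
      upperBound l K := by
  have hq : exp (-l) < 1 := exp_lt_one_iff.2 (by linarith)
  have hq0 := exp_pos (-l)
  have hp : 1 - exp (-l) ∈ Set.Ioo (0 : ℝ) 1 := ⟨by linarith, by linarith⟩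
  have hpos : (0 : ℝ) < Fintype.card V :=
    lt_of_lt_of_le (mul_pos (by linarith [hK.one_le]) (exp_pos _)) hn
  have hM : (Fintype.card V : ℝ) = exp (log (Fintype.card V)) := (exp_log hpos).symm
  rw [hM] at hn hn'
  refine (graphProb_exists_isSpecial_le_add hp (20 * K)).trans ?_
  exact add_le_add (graphProb_large_le hl hK.one_le hM hn hn')
    (graphProb_small_le hl hK hd hM hn hn')

end UpperBound

section SecondMoment

open Finset
open scoped Classical

variable {V : Type*} [Fintype V] {p : ℝ}

/-- The second moment method. -/
lemma sq_sum_graphProb_le (hp : p ∈ Set.Ioo (0 : ℝ) 1) {ι : Type*} (T : Finset ι)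
    (Q : ι → SimpleGraph V → Prop) :
    (∑ i ∈ T, graphProb p (Q i)) ^ 2 ≤ graphProb p (fun G => ∃ i ∈ T, Q i G) *
      ∑ i ∈ T, ∑ j ∈ T, graphProb p (fun G => Q i G ∧ Q j G) := by
  have hp1 := hp.1
  have hq : 0 < 1 - p := by linarith [hp.2]
  have h2 : ∀ i j, graphProb p (fun G : SimpleGraph V => Q i G ∧ Q j G) =
      graphExp p fun G => (if Q i G then 1 else 0) * if Q j G then 1 else 0 := by
    intro i j
    rw [graphProb]
    congr 1
    ext G
    by_cases h : Q i G <;> by_cases h' : Q j G <;> simp [h, h']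
  simp only [h2]
  simp only [graphProb, ← graphExp_sum]
  simp only [← mul_sum, ← sum_mul]
  simp only [graphExp]
  refine sum_sq_le_sum_mul_sum_of_sq_le_mul _ (fun G _ => by positivity) (fun G _ => ?_)
    (fun G _ => ?_)
  · have : 0 ≤ ∑ i ∈ T, if Q i G then (1 : ℝ) else 0 := sum_nonneg fun i _ => by positivity
    positivity
  · refine le_of_eq ?_
    by_cases h : ∃ i ∈ T, Q i G
    · simp only [h, if_true]
      ring
    · have : ∑ i ∈ T, (if Q i G then (1 : ℝ) else 0) = 0 :=
        sum_eq_zero fun i hi => if_neg fun hQ => h ⟨i, hi, hQ⟩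
      simp [this]

/-- The labellings all of whose classes have size `k`. -/
noncomputable def balanced (V : Type*) [Fintype V] (k : ℕ) : Finset (V → Option (Fin 3)) :=
  {f | ∀ i, #(cls f i) = k}

@[simp] lemma mem_balanced {k : ℕ} {f : V → Option (Fin 3)} :
    f ∈ balanced V k ↔ ∀ i, #(cls f i) = k := by simp [balanced]

lemma card_supp_of_balanced {k : ℕ} {f : V → Option (Fin 3)} (hf : f ∈ balanced V k) :
    #(supp f) = 3 * k := by
  rw [mem_balanced] at hf
  simp [card_supp, hf]

/-- The probability that a given balanced labelling is special. -/
noncomputable def baseProb (p : ℝ) (n k : ℕ) : ℝ :=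
  (k : ℝ) ^ 3 * (p ^ 3 * (1 - p) ^ (3 * k ^ 2 - 3) * ((1 - (1 - p) ^ k) ^ 3) ^ (n - 3 * k))

lemma card_edges_of_balanced {k : ℕ} {f : V → Option (Fin 3)} (hf : f ∈ balanced V k) :
    #(edges (crossGraph f)) = 3 * k ^ 2 := by
  rw [card_edges_crossGraph]
  rw [mem_balanced] at hf
  simp only [hf]
  ring

lemma graphProb_balanced {k : ℕ} {f : V → Option (Fin 3)} (hf : f ∈ balanced V k) :
    graphProb p (fun G => ∃ x, IsSpecial G f x) = baseProb p (Fintype.card V) k := by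
  rw [graphProb_exists_isSpecial, card_edges_of_balanced hf, card_supp_of_balanced hf, baseProb]
  rw [mem_balanced] at hf
  simp [hf]

lemma graphProb_pair_le (hp : p ∈ Set.Ioo (0 : ℝ) 1) {ι : Type*} {k : ℕ}
    {f f' : V → Option (Fin 3)} (hf : f ∈ balanced V k) (hf' : f' ∈ balanced V k)
    (B : ι → Finset V) (hB : ∀ i, ∃ j, B i = cls f j ∨ B i = cls f' j) :
    graphProb p (fun G => (∃ x, IsSpecial G f x) ∧ ∃ x, IsSpecial G f' x) ≤
      (k : ℝ) ^ 6 * ((1 - p) ^ #(edges (crossGraph f ⊔ crossGraph f')) / (1 - p) ^ 6 *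
        hitProb p (supp f ∪ supp f') B ^ (Fintype.card V - #(supp f ∪ supp f'))) := by
  have h1 : ∀ G : SimpleGraph V, ((∃ x, IsSpecial G f x) ∧ ∃ x, IsSpecial G f' x) →
      ∃ z ∈ Fintype.piFinset (cls f) ×ˢ Fintype.piFinset (cls f'),
        IsSpecial G f z.1 ∧ IsSpecial G f' z.2 := by
    rintro G ⟨⟨x, hx⟩, x', hx'⟩
    refine ⟨(x, x'), ?_, hx, hx'⟩
    simp only [mem_product, Fintype.mem_piFinset, mem_cls]
    exact ⟨hx.1, hx'.1⟩
  refine (graphProb_mono hp h1).trans ((graphProb_exists_le hp _ _).trans ?_)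
  refine (sum_le_card_nsmul _ _ _ fun z _ =>
    graphProb_isSpecial_and_le hp f f' z.1 z.2 B hB).trans (le_of_eq ?_)
  rw [mem_balanced] at hf hf'
  rw [nsmul_eq_mul, card_product, Fintype.card_piFinset, Fintype.card_piFinset]
  simp only [hf, hf']
  congr 1
  simp
  ring

lemma card_edges_sup {k : ℕ} {f f' : V → Option (Fin 3)} (hf : f ∈ balanced V k)
    (hf' : f' ∈ balanced V k) :
    #(edges (crossGraph f ⊔ crossGraph f')) + #(edges (crossGraph f ⊓ crossGraph f')) =
      6 * k ^ 2 := by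
  have h1 : edges (crossGraph f ⊔ crossGraph f') =
      edges (crossGraph f) ∪ edges (crossGraph f') := by ext e; simp
  have h2 : edges (crossGraph f ⊓ crossGraph f') =
      edges (crossGraph f) ∩ edges (crossGraph f') := by ext e; simp
  rw [h1, h2, card_union_add_card_inter, card_edges_of_balanced hf, card_edges_of_balanced hf']
  ring

lemma card_supp_union {k : ℕ} {f f' : V → Option (Fin 3)} (hf : f ∈ balanced V k)
    (hf' : f' ∈ balanced V k) : #(supp f ∪ supp f') + #(supp f ∩ supp f') = 6 * k := by
  rw [card_union_add_card_inter, card_supp_of_balanced hf, card_supp_of_balanced hf']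
  ring

lemma card_inter_supp (f f' : V → Option (Fin 3)) :
    #(supp f ∩ supp f') = ∑ i, #(cls f i ∩ supp f') := by
  have : supp f ∩ supp f' = univ.biUnion fun i => cls f i ∩ supp f' := by
    ext v
    simp only [mem_inter, mem_supp, mem_biUnion, mem_univ, true_and, mem_cls]
    rw [Option.ne_none_iff_exists']
    tauto
  rw [this, card_biUnion]
  exact fun i _ j _ hij => (disjoint_cls f hij).mono inter_subset_left inter_subset_left

lemma three_mul_card_edges_inf_le (f f' : V → Option (Fin 3)) :
    3 * #(edges (crossGraph f ⊓ crossGraph f')) ≤ #(supp f ∩ supp f') ^ 2 := by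
  set g : V → Option (Fin 3) := fun v => if f' v = none then none else f v with hg
  have h1 : edges (crossGraph f ⊓ crossGraph f') ⊆ edges (crossGraph g) := by
    intro e
    induction e using Sym2.ind with
    | _ u v =>
    simp only [mem_edges, SimpleGraph.mem_edgeSet, SimpleGraph.inf_adj, crossGraph, hg]
    rintro ⟨⟨a, b, c⟩, d, e, f⟩
    simp [*]
  have h2 : ∀ i, cls g i = cls f i ∩ supp f' := by
    intro i
    ext v
    simp only [mem_cls, mem_inter, mem_supp, hg]
    by_cases h : f' v = none <;> simp [h]
  have h3 := card_le_card h1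
  rw [card_edges_crossGraph] at h3
  simp only [h2] at h3
  rw [card_inter_supp, Fin.sum_univ_three]
  zify at h3 ⊢
  nlinarith [sq_nonneg ((#(cls f 0 ∩ supp f') : ℤ) - #(cls f 1 ∩ supp f')),
    sq_nonneg ((#(cls f 0 ∩ supp f') : ℤ) - #(cls f 2 ∩ supp f')),
    sq_nonneg ((#(cls f 1 ∩ supp f') : ℤ) - #(cls f 2 ∩ supp f'))]

/-- If some class of `f` has no large intersection with a class of `f'`, then the cross graphs
have few common edges. -/
lemma card_edges_inf_le {k : ℕ} {f f' : V → Option (Fin 3)} (hf : f ∈ balanced V k)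
    (hf' : f' ∈ balanced V k) {i₀ : Fin 3} (h : ∀ j, 10 * #(cls f i₀ ∩ cls f' j) < 9 * k) :
    200 * #(edges (crossGraph f ⊓ crossGraph f')) ≤ 199 * (k * #(supp f ∩ supp f')) := by
  have h3 := three_mul_card_edges_inf_le f f'
  have ht : #(supp f ∩ supp f') ≤ 3 * k := by
    rw [← card_supp_of_balanced hf]
    exact card_le_card inter_subset_left
  set t := #(supp f ∩ supp f') with htdef
  set s := #(edges (crossGraph f ⊓ crossGraph f')) with hs
  rcases le_or_gt (20 * t) (59 * k) with hc | hc
  · nlinarith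
  set R := #(cls f i₀ ∩ supp f') with hR
  have hRt : t ≤ R + 2 * k := by
    rw [htdef, card_inter_supp, hR, ← add_sum_erase univ _ (mem_univ i₀)]
    gcongr
    refine (sum_le_card_nsmul _ _ k fun i _ => ?_).trans (by simp)
    rw [← (mem_balanced.1 hf) i]
    exact card_le_card inter_subset_left
  have hdeg0 : ∀ u ∉ supp f ∩ supp f', #{v | (crossGraph f ⊓ crossGraph f').Adj u v} = 0 := by
    intro u hu
    rw [card_eq_zero, eq_empty_iff_forall_notMem]
    intro v hv
    simp only [mem_filter, mem_univ, true_and, SimpleGraph.inf_adj, crossGraph] at hv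
    exact hu (by simpa using ⟨hv.1.1, hv.2.1⟩)
  have hsub : ∀ u ∈ supp f', ∃ j, f' u = some j ∧
      ({v | (crossGraph f ⊓ crossGraph f').Adj u v} : Finset V) ⊆ supp f' \ cls f' j ∧
      #(supp f' \ cls f' j) = 2 * k := by
    intro u hu
    obtain ⟨j, hj⟩ := Option.ne_none_iff_exists'.1 (mem_supp.1 hu)
    refine ⟨j, hj, ?_, ?_⟩
    · intro v hv
      simp only [mem_filter, mem_univ, true_and, SimpleGraph.inf_adj, crossGraph] at hv
      simp only [Finset.mem_sdiff, mem_supp, mem_cls]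
      exact ⟨hv.2.2.1, fun h' => hv.2.2.2 (hj.trans h'.symm)⟩
    · rw [card_sdiff_of_subset (cls_subset_supp f' j), card_supp_of_balanced hf',
        (mem_balanced.1 hf') j]
      omega
  have hdeg1 : ∀ u ∈ supp f ∩ supp f',
      #{v | (crossGraph f ⊓ crossGraph f').Adj u v} ≤ 2 * k := by
    intro u hu
    obtain ⟨j, -, h1, h2⟩ := hsub u (mem_inter.1 hu).2
    rw [← h2]
    exact card_le_card h1
  have hdeg2 : ∀ u ∈ cls f i₀ ∩ supp f',
      20 * #{v | (crossGraph f ⊓ crossGraph f').Adj u v} ≤ 39 * k := by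
    intro u hu
    obtain ⟨j, hj, h1, h2⟩ := hsub u (mem_inter.1 hu).2
    have h4 : Disjoint ({v | (crossGraph f ⊓ crossGraph f').Adj u v} : Finset V)
        ((cls f i₀ ∩ supp f') \ cls f' j) := by
      rw [disjoint_left]
      intro v hv hv'
      simp only [mem_filter, mem_univ, true_and, SimpleGraph.inf_adj, crossGraph] at hv
      simp only [Finset.mem_sdiff, mem_inter, mem_cls] at hv' hu
      exact hv.1.2.2 (hu.1.trans hv'.1.1.symm)
    have h5 := card_le_card (union_subset h1
      (sdiff_subset_sdiff (inter_subset_right (s₁ := cls f i₀)) (subset_refl (cls f' j))))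
    rw [card_union_of_disjoint h4, h2] at h5
    have h6 : R ≤ #((cls f i₀ ∩ supp f') \ cls f' j) + #(cls f i₀ ∩ cls f' j) := by
      rw [hR, ← card_sdiff_add_card_inter (cls f i₀ ∩ supp f') (cls f' j)]
      gcongr
      exact inter_subset_left
    have h7 := h j
    omega
  have hsum : 2 * s = ∑ u, #{v | (crossGraph f ⊓ crossGraph f').Adj u v} := by
    rw [hs, two_mul_card_edges]
    congr!
  have hsum' := sum_subset (subset_univ (supp f ∩ supp f')) (fun u _ hu => hdeg0 u hu)
  replace hsum := hsum.trans hsum'.symm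
  rw [← sum_sdiff (inter_subset_inter (cls_subset_supp f i₀) (subset_refl (supp f')))] at hsum
  have a1 : ∑ u ∈ (supp f ∩ supp f') \ (cls f i₀ ∩ supp f'),
      #{v | (crossGraph f ⊓ crossGraph f').Adj u v} ≤ (t - R) * (2 * k) := by
    refine (sum_le_card_nsmul _ _ (2 * k) fun u hu => hdeg1 u (mem_sdiff.1 hu).1).trans ?_
    rw [card_sdiff_of_subset (inter_subset_inter (cls_subset_supp f i₀) (subset_refl _)),
      smul_eq_mul]
  have a2 : 20 * ∑ u ∈ cls f i₀ ∩ supp f',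
      #{v | (crossGraph f ⊓ crossGraph f').Adj u v} ≤ R * (39 * k) := by
    rw [mul_sum]
    exact (sum_le_card_nsmul _ _ (39 * k) fun u hu => hdeg2 u hu).trans (by rw [smul_eq_mul])
  have hRle : R ≤ t := card_le_card (inter_subset_inter (cls_subset_supp f i₀) (subset_refl _))
  obtain ⟨d, hd⟩ := Nat.exists_eq_add_of_le hRle
  rw [hd, Nat.add_sub_cancel_left] at a1
  rw [hd] at hRt hc ht ⊢
  nlinarith

end SecondMoment

section Overlap

open Finset
open scoped Classical

variable {V : Type*} [Fintype V]

/-- The number of balanced labellings that label all elements of `S`. -/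
noncomputable def numCover (k : ℕ) (S : Finset V) : ℕ :=
  #{f ∈ balanced V k | S ⊆ supp f}

lemma card_cls_comp (f : V → Option (Fin 3)) (e : Equiv.Perm V) (i : Fin 3) :
    #(cls (f ∘ e) i) = #(cls f i) := by
  refine card_bij' (fun v _ => e v) (fun v _ => e.symm v) ?_ ?_ ?_ ?_ <;> simp

lemma numCover_insert_le (k : ℕ) {S : Finset V} {u v : V} (hu : u ∉ S) (hv : v ∉ S) :
    numCover k (insert u S) ≤ numCover k (insert v S) := by
  refine card_le_card_of_injOn (fun f => f ∘ Equiv.swap u v) ?_ ?_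
  · intro f hf
    simp only [coe_filter, Set.mem_ofPred_eq, mem_balanced] at hf ⊢
    refine ⟨fun i => by rw [card_cls_comp, hf.1], ?_⟩
    intro w hw
    rw [mem_supp, Function.comp_apply, ← mem_supp]
    apply hf.2
    rcases mem_insert.1 hw with rfl | hw'
    · simp
    · rw [Equiv.swap_apply_of_ne_of_ne]
      · exact mem_insert_of_mem hw'
      · rintro rfl; exact hu hw'
      · rintro rfl; exact hv hw'
  · exact fun f _ g _ h => (Equiv.swap u v).surjective.injective_comp_right h

lemma card_mul_numCover_insert (k : ℕ) {S : Finset V} {u : V} (hu : u ∉ S) :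
    (Fintype.card V - #S) * numCover k (insert u S) = (3 * k - #S) * numCover k S := by
  have h1 : ∑ v ∈ univ \ S, numCover k (insert v S) =
      (Fintype.card V - #S) * numCover k (insert u S) := by
    rw [sum_congr rfl (g := fun _ => numCover k (insert u S)), sum_const, card_univ_sdiff,
      smul_eq_mul]
    intro v hv
    have hv : v ∉ S := (mem_sdiff.1 hv).2
    exact le_antisymm (numCover_insert_le k hv hu) (numCover_insert_le k hu hv)
  rw [← h1]
  simp only [numCover, card_filter]
  rw [sum_comm, mul_sum]
  refine sum_congr rfl fun f hf => ?_
  by_cases hS : S ⊆ supp f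
  · rw [if_pos hS, mul_one, ← card_supp_of_balanced hf, ← card_sdiff_of_subset hS, ← card_filter]
    congr 1
    ext v
    simp [insert_subset_iff, hS, and_comm]
  · rw [if_neg hS, mul_zero]
    exact sum_eq_zero fun v _ => if_neg fun h => hS ((subset_insert v S).trans h)

lemma numCover_mul_pow_le {k : ℕ} (hk : 3 * k ≤ Fintype.card V) (S : Finset V) :
    numCover k S * Fintype.card V ^ #S ≤ #(balanced V k) * (3 * k) ^ #S := by
  induction S using Finset.induction_on with
  | empty => simp [numCover]
  | insert u S hu ih =>
    have h1 := card_mul_numCover_insert k hu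
    have h2 : #S < Fintype.card V := by
      rw [← card_univ]
      exact card_lt_card ((ssubset_univ_iff).2 fun h => hu (h ▸ mem_univ u))
    have h3 : numCover k (insert u S) * Fintype.card V ≤ 3 * k * numCover k S := by
      refine Nat.le_of_mul_le_mul_left ?_ (Nat.sub_pos_of_lt h2)
      calc (Fintype.card V - #S) * (numCover k (insert u S) * Fintype.card V)
          = ((3 * k - #S) * numCover k S) * Fintype.card V := by rw [← h1]; ring
        _ = ((3 * k - #S) * Fintype.card V) * numCover k S := by ring
        _ ≤ ((Fintype.card V - #S) * (3 * k)) * numCover k S := by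
          refine Nat.mul_le_mul_right _ ?_
          rw [Nat.sub_mul, Nat.sub_mul, mul_comm (Fintype.card V)]
          exact Nat.sub_le_sub_left (by nlinarith) _
        _ = _ := by ring
    rw [card_insert_of_notMem hu, pow_succ, pow_succ]
    calc numCover k (insert u S) * (Fintype.card V ^ #S * Fintype.card V)
        = (numCover k (insert u S) * Fintype.card V) * Fintype.card V ^ #S := by ring
      _ ≤ (3 * k * numCover k S) * Fintype.card V ^ #S := Nat.mul_le_mul_right _ h3
      _ = 3 * k * (numCover k S * Fintype.card V ^ #S) := by ring
      _ ≤ 3 * k * (#(balanced V k) * (3 * k) ^ #S) := Nat.mul_le_mul_left _ ih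
      _ = _ := by ring

/-- The generating function of the overlap of a random balanced labelling with a given set. -/
lemma sum_pow_inter_supp_le {k : ℕ} (hk : 3 * k ≤ Fintype.card V) (hV : 0 < Fintype.card V)
    (U : Finset V) {z : ℝ} (hz : 1 ≤ z) :
    ∑ f ∈ balanced V k, z ^ #(U ∩ supp f) ≤
      #(balanced V k) * (1 + 3 * k * z / Fintype.card V) ^ #U := by
  have hV' : (0 : ℝ) < Fintype.card V := by exact_mod_cast hV
  have hz0 : 0 ≤ z - 1 := by linarith
  calc ∑ f ∈ balanced V k, z ^ #(U ∩ supp f)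
      = ∑ f ∈ balanced V k, ∑ S ∈ U.powerset, if S ⊆ supp f then (z - 1) ^ #S else 0 := by
        refine sum_congr rfl fun f _ => ?_
        rw [← sum_filter]
        have : ({S ∈ U.powerset | S ⊆ supp f} : Finset (Finset V)) = (U ∩ supp f).powerset := by
          ext S
          rw [mem_filter, mem_powerset, mem_powerset, subset_inter_iff]
        rw [this]
        have h := sum_pow_mul_eq_add_pow (z - 1) 1 (U ∩ supp f)
        simp only [one_pow, mul_one, sub_add_cancel] at h
        exact h.symm
    _ = ∑ S ∈ U.powerset, (z - 1) ^ #S * numCover k S := by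
        rw [sum_comm]
        refine sum_congr rfl fun S _ => ?_
        rw [← sum_filter, sum_const, numCover, nsmul_eq_mul, mul_comm]
    _ ≤ ∑ S ∈ U.powerset, #(balanced V k) * (3 * k * z / Fintype.card V) ^ #S := by
        refine sum_le_sum fun S _ => ?_
        have h : (numCover k S : ℝ) * Fintype.card V ^ #S ≤ #(balanced V k) * (3 * k) ^ #S := by
          exact_mod_cast numCover_mul_pow_le hk S
        rw [div_pow, mul_pow, ← mul_div_assoc, le_div_iff₀ (by positivity)]
        have h2 : (z - 1) ^ #S ≤ z ^ #S := pow_le_pow_left₀ hz0 (by linarith) _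
        calc (z - 1) ^ #S * numCover k S * Fintype.card V ^ #S
            = (z - 1) ^ #S * (numCover k S * (Fintype.card V : ℝ) ^ #S) := by ring
          _ ≤ z ^ #S * (#(balanced V k) * (3 * k) ^ #S) := by gcongr
          _ = _ := by ring
    _ = _ := by
        rw [← mul_sum]
        have h := sum_pow_mul_eq_add_pow (3 * k * z / Fintype.card V) 1 U
        simp only [one_pow, mul_one] at h
        rw [h, add_comm]

end Overlap

/-- The integer `k` is large enough for the second moment computations. -/
structure GoodFor (l c : ℝ) (k : ℕ) : Prop where
  one_le : 1 ≤ k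
  mul_exp_le : 36 * k * exp (-(l * k)) ≤ 1
  le_mul_sq : 15 * (k + 1) ≤ l * k ^ 2 / 800
  mul_exp_div_le : 9 * k * exp (-(l * k / 400)) ≤ 1
  pow_mul_exp_le : 60 * k ^ 3 * (k + 1) * exp (-(7 / 20 * (l * k))) ≤ c

lemma eventually_goodFor {l c : ℝ} (hl : 0 < l) (hc : 0 < c) :
    ∀ᶠ k : ℕ in atTop, GoodFor l c k := by
  have key : ∀ (m : ℕ) {a : ℝ}, 0 < a →
      Tendsto (fun k : ℕ => (k : ℝ) ^ m * exp (-(a * k))) atTop (nhds 0) := by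
    intro m a ha
    have h1 := (tendsto_pow_mul_exp_neg_atTop_nhds_zero m).comp
      ((tendsto_natCast_atTop_atTop (R := ℝ)).const_mul_atTop ha)
    have h2 := h1.const_mul (a ^ m)⁻¹
    rw [mul_zero] at h2
    refine h2.congr fun k => ?_
    simp only [Function.comp_apply]
    field_simp
    ring
  have h1 := (key 1 hl).const_mul 36
  have h3 := (key 1 (a := l / 400) (by positivity)).const_mul 9
  have h4 := ((key 4 (a := 7 / 20 * l) (by positivity)).const_mul 60).add
    ((key 3 (a := 7 / 20 * l) (by positivity)).const_mul 60)
  rw [mul_zero] at h1 h3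
  rw [mul_zero, add_zero] at h4
  have h2 : Tendsto (fun k : ℕ => (k : ℝ)) atTop atTop := tendsto_natCast_atTop_atTop
  filter_upwards [h1.eventually_le_const one_pos, h3.eventually_le_const one_pos,
    h4.eventually_le_const hc, eventually_ge_atTop 1, h2.eventually_ge_atTop (24000 / l)]
    with k e1 e3 e4 e0 e2
  have hk : (1 : ℝ) ≤ k := by exact_mod_cast e0
  refine ⟨e0, by linarith, ?_, ?_, ?_⟩
  · rw [div_le_iff₀ hl] at e2
    nlinarith
  · rw [show l * k / 400 = l / 400 * k by ring]
    linarith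
  · rw [show 7 / 20 * (l * k) = 7 / 20 * l * (k : ℝ) by ring]
    linarith

section Good

variable {l c : ℝ} {k n : ℕ}

lemma mul_exp_neg_le (hn : n ≤ k * exp (l * k) + 1) :
    n * exp (-(l * k)) ≤ k + exp (-(l * k)) := by
  have h := mul_le_mul_of_nonneg_right hn (exp_pos (-(l * k))).le
  rwa [add_mul, mul_assoc, ← exp_add, add_neg_cancel, exp_zero, mul_one, one_mul] at h

lemma le_mul_exp_neg (hn : k * exp (l * k) ≤ n) : k ≤ n * exp (-(l * k)) := by
  have h := mul_le_mul_of_nonneg_right hn (exp_pos (-(l * k))).le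
  rwa [mul_assoc, ← exp_add, add_neg_cancel, exp_zero, mul_one] at h

lemma GoodFor.sq_le (h : GoodFor l c k) (hn : k * exp (l * k) ≤ n) : 36 * k ^ 2 ≤ n := by
  have h1 := h.mul_exp_le
  have h2 : (36 * k : ℝ) ≤ exp (l * k) := by
    rwa [exp_neg, mul_inv_le_iff₀ (exp_pos _), one_mul] at h1
  have h3 : (36 * k ^ 2 : ℝ) ≤ n := by nlinarith [Nat.cast_nonneg (α := ℝ) k]
  exact_mod_cast h3

lemma GoodFor.three_mul_le (h : GoodFor l c k) (hn : k * exp (l * k) ≤ n) : 3 * k ≤ n := by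
  nlinarith [h.sq_le hn, h.one_le]

lemma GoodFor.exp_le_pow (h : GoodFor l c k) (hn : n ≤ k * exp (l * k) + 1) :
    exp (-(k + 1)) ≤ (1 - exp (-(l * k))) ^ n := by
  have hk : (1 : ℝ) ≤ k := by exact_mod_cast h.one_le
  have h1 := h.mul_exp_le
  have h2 := mul_exp_neg_le hn
  set x := exp (-(l * k)) with hx
  have hx0 : 0 < x := exp_pos _
  have hx1 : x < 1 := by nlinarith
  have h3 : exp (-(x / (1 - x))) ≤ 1 - x := by
    rw [exp_neg, inv_le_comm₀ (exp_pos _) (by linarith)]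
    refine le_trans (le_of_eq ?_) (add_one_le_exp _)
    have : 1 - x ≠ 0 := by linarith
    field_simp
    ring
  refine le_trans ?_ (pow_le_pow_left₀ (exp_pos _).le h3 n)
  rw [← exp_nat_mul, exp_le_exp, mul_neg, neg_le_neg_iff, ← mul_div_assoc,
    div_le_iff₀ (by linarith)]
  nlinarith

lemma GoodFor.le_baseProb {p : ℝ} (h : GoodFor l c k) (hp : p ∈ Set.Ioo (0 : ℝ) 1)
    (hpl : 1 - p = exp (-l)) (hn : n ≤ k * exp (l * k) + 1) :
    k ^ 3 * (p ^ 3 * (1 - p) ^ (3 * k ^ 2 - 3) * exp (-(k + 1)) ^ 3) ≤ baseProb p n k := by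
  have hp0 := hp.1
  have hq0 : 0 < 1 - p := by linarith [hp.2]
  have hqk : (1 - p) ^ k = exp (-(l * k)) := by
    rw [hpl, ← exp_nat_mul]; congr 1; ring
  have hq1 : exp (-(l * k)) ≤ 1 := by
    rw [← hqk]; exact pow_le_one₀ hq0.le (by linarith)
  rw [baseProb, hqk]
  gcongr
  refine (pow_le_pow_left₀ (exp_pos _).le (h.exp_le_pow hn) 3).trans ?_
  rw [pow_right_comm]
  refine pow_le_pow_of_le_one (pow_nonneg (by linarith) _) ?_ (Nat.sub_le _ _)
  exact pow_le_one₀ (by linarith) (by linarith [exp_pos (-(l * k))])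

end Good

section SmallOverlap

open Finset
open scoped Classical

variable {V : Type*} [Fintype V] {p : ℝ}

lemma hitProb_sum_elim_le (hp : p ∈ Set.Ioo (0 : ℝ) 1) {k : ℕ} {f f' : V → Option (Fin 3)}
    (hf : f ∈ balanced V k) (hf' : f' ∈ balanced V k) :
    hitProb p (supp f ∪ supp f') (Sum.elim (cls f) (cls f')) ≤
      1 - 6 * (1 - p) ^ k + 15 * (1 - p) ^ (2 * k - min k #(supp f ∩ supp f')) := by
  have hp0 := hp.1
  have hq0 : 0 < 1 - p := by linarith [hp.2]
  set t := #(supp f ∩ supp f') with ht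
  have hc : ∀ i, #(cls f i) = k := mem_balanced.1 hf
  have hc' : ∀ i, #(cls f' i) = k := mem_balanced.1 hf'
  have hint : ∀ i j, #(cls f i ∩ cls f' j) ≤ min k t := by
    intro i j
    refine le_min ?_ ?_
    · rw [← hc i]; exact card_le_card inter_subset_left
    · exact card_le_card (inter_subset_inter (cls_subset_supp f i) (cls_subset_supp f' j))
  have hun : ∀ z : (Fin 3 ⊕ Fin 3) × (Fin 3 ⊕ Fin 3), z.1 ≠ z.2 →
      2 * k - min k t ≤ #(Sum.elim (cls f) (cls f') z.1 ∪ Sum.elim (cls f) (cls f') z.2) := by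
    rintro ⟨i | i, j | j⟩ hz
    · simp only [Sum.elim_inl]
      rw [card_union_of_disjoint (disjoint_cls f fun h => hz (by simp [h])), hc, hc]
      omega
    · simp only [Sum.elim_inl, Sum.elim_inr]
      have h1 := card_union_add_card_inter (cls f i) (cls f' j)
      have h2 := hint i j
      rw [hc, hc'] at h1
      omega
    · simp only [Sum.elim_inl, Sum.elim_inr]
      have h1 := card_union_add_card_inter (cls f j) (cls f' i)
      have h2 := hint j i
      rw [hc, hc'] at h1
      rw [union_comm]
      omega
    · simp only [Sum.elim_inr]
      rw [card_union_of_disjoint (disjoint_cls f' fun h => hz (by simp [h])), hc', hc']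
      omega
  refine (hitProb_le hp ?_).trans ?_
  · rintro (i | i)
    · exact (cls_subset_supp f i).trans subset_union_left
    · exact (cls_subset_supp f' i).trans subset_union_right
  have h1 : ∑ i, (1 - p) ^ #(Sum.elim (cls f) (cls f') i) = 6 * (1 - p) ^ k := by
    simp only [Fintype.sum_sum_type, Sum.elim_inl, Sum.elim_inr, hc, hc', sum_const, card_univ,
      Fintype.card_fin]
    ring
  have hcard : #{z : (Fin 3 ⊕ Fin 3) × (Fin 3 ⊕ Fin 3) | z.1 ≠ z.2} = 30 := by
    rw [← Fintype.card_subtype]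
    simp only [ne_eq]
    rw [Fintype.card_subtype]
    have : ({z : (Fin 3 ⊕ Fin 3) × (Fin 3 ⊕ Fin 3) | ¬ z.1 = z.2} : Finset _) =
        offDiag univ := by ext z; simp
    rw [this, offDiag_card]
    simp
  have h2 : ∑ z : (Fin 3 ⊕ Fin 3) × (Fin 3 ⊕ Fin 3) with z.1 ≠ z.2,
      (1 - p) ^ #(Sum.elim (cls f) (cls f') z.1 ∪ Sum.elim (cls f) (cls f') z.2) ≤
      30 * (1 - p) ^ (2 * k - min k t) := by
    refine (sum_le_card_nsmul _ _ ((1 - p) ^ (2 * k - min k t)) fun z hz => ?_).trans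
      (le_of_eq ?_)
    · exact pow_le_pow_of_le_one hq0.le (by linarith) (hun z (mem_filter.1 hz).2)
    · rw [hcard, nsmul_eq_mul]; norm_num
  refine le_trans (le_of_eq ?_) (add_le_add_right (mul_le_mul_of_nonneg_left h2
    (show (0 : ℝ) ≤ 2⁻¹ by norm_num)) (1 - 6 * (1 - p) ^ k)) |>.trans (le_of_eq (by ring))
  rw [h1]
  congr!

variable {l c : ℝ} {k : ℕ}

/-- The contribution of `15 * q ^ (2 * k - min k t)` to the exponent is negligible. -/
lemma GoodFor.cross_term_le {n : ℕ} (h : GoodFor l c k) (hl : 0 < l)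
    (hn : n ≤ k * exp (l * k) + 1) (t : ℕ) :
    15 * exp (-l) ^ (2 * k - min k t) * n ≤ 1 + l / 400 * k * t := by
  have hk : (1 : ℝ) ≤ k := by exact_mod_cast h.one_le
  have h1 := mul_exp_neg_le hn
  have hx1 : exp (-(l * k)) ≤ 1 := exp_le_one_iff.2 (by have := mul_pos hl (by linarith : (0:ℝ) < k); linarith)
  have hsplit : exp (-l) ^ (2 * k - min k t) = exp (-(l * k)) * exp (-l) ^ (k - min k t) := by
    rw [show 2 * k - min k t = k + (k - min k t) by omega, pow_add, ← exp_nat_mul (-l) k]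
    congr 2
    ring
  rw [hsplit]
  have h2 : 15 * (exp (-(l * k)) * exp (-l) ^ (k - min k t)) * n ≤
      15 * (k + 1) * exp (-l) ^ (k - min k t) := by
    have : 0 < exp (-l) ^ (k - min k t) := pow_pos (exp_pos _) _
    calc _ = 15 * (n * exp (-(l * k))) * exp (-l) ^ (k - min k t) := by ring
      _ ≤ _ := by gcongr; linarith
  refine h2.trans ?_
  have hlt : 0 ≤ l / 400 * k * t := by positivity
  rcases le_or_gt (2 * t) k with ht | ht
  · have h3 : exp (-l) ^ (k - min k t) ≤ exp (-(l * k / 400)) ^ 200 := by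
      rw [← exp_nat_mul, ← exp_nat_mul, exp_le_exp]
      have : (k : ℝ) ≤ 2 * (k - min k t : ℕ) := by
        have : k ≤ 2 * (k - min k t) := by omega
        exact_mod_cast this
      push_cast at this ⊢
      nlinarith
    have h4 := h.mul_exp_div_le
    set y := exp (-(l * k / 400)) with hy
    have hy0 : 0 < y := exp_pos _
    have h5 : y ≤ 1 / 9 := by nlinarith
    have h6 : y ^ 200 ≤ y * (1 / 9) ^ 3 := by
      calc y ^ 200 ≤ y ^ 4 := pow_le_pow_of_le_one hy0.le (by linarith) (by norm_num)
        _ = y * y ^ 3 := by ring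
        _ ≤ _ := by gcongr
    nlinarith
  · have h3 : exp (-l) ^ (k - min k t) ≤ 1 :=
      pow_le_one₀ (exp_pos _).le (exp_le_one_iff.2 (by linarith))
    have h4 := h.le_mul_sq
    have ht' : (k : ℝ) ≤ 2 * t := by exact_mod_cast ht.le
    have h5 : l / 800 * k * k ≤ l / 800 * k * (2 * t) := by gcongr
    nlinarith

/-- For pairs of labellings without matching classes the events are not much more correlated
than the size of the overlap allows. -/
lemma graphProb_pair_le_of_small_overlap (hp : p ∈ Set.Ioo (0 : ℝ) 1) (hl : 0 < l)
    (hpl : 1 - p = exp (-l)) (hG : GoodFor l c k)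
    (hn : k * exp (l * k) ≤ Fintype.card V) (hn' : Fintype.card V ≤ k * exp (l * k) + 1)
    {f f' : V → Option (Fin 3)} (hf : f ∈ balanced V k) (hf' : f' ∈ balanced V k) {i₀ : Fin 3}
    (h : ∀ j, 10 * #(cls f i₀ ∩ cls f' j) < 9 * k) :
    graphProb p (fun G => (∃ x, IsSpecial G f x) ∧ ∃ x, IsSpecial G f' x) ≤
      exp 8 / p ^ 6 * baseProb p (Fintype.card V) k ^ 2 *
        exp (399 / 400 * (l * k)) ^ #(supp f ∩ supp f') := by
  have hp0 := hp.1
  have hq0 : 0 < 1 - p := by linarith [hp.2]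
  have hk : (1 : ℝ) ≤ k := by exact_mod_cast hG.one_le
  have hqk : (1 - p) ^ k = exp (-(l * k)) := by
    rw [hpl, ← exp_nat_mul]; congr 1; ring
  refine (graphProb_pair_le hp hf hf' (Sum.elim (cls f) (cls f')) ?_).trans ?_
  · rintro (i | i)
    · exact ⟨i, Or.inl rfl⟩
    · exact ⟨i, Or.inr rfl⟩
  have hH := hitProb_sum_elim_le hp hf hf'
  have hH0 := hitProb_nonneg hp (supp f ∪ supp f') (Sum.elim (cls f) (cls f'))
  have hs := card_edges_inf_le hf hf' h
  have hsup := card_edges_sup hf hf'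
  have hun := card_supp_union hf hf'
  set n := Fintype.card V with hnV
  set t := #(supp f ∩ supp f') with ht
  set s := #(edges (crossGraph f ⊓ crossGraph f')) with hs'
  set e := #(edges (crossGraph f ⊔ crossGraph f')) with he
  set H := hitProb p (supp f ∪ supp f') (Sum.elim (cls f) (cls f')) with hHdef
  have ht3 : t ≤ 3 * k := by
    rw [← card_supp_of_balanced hf]; exact card_le_card inter_subset_left
  have h3k := hG.sq_le hn
  have hk1 := hG.one_le
  have hexp : n - #(supp f ∪ supp f') = n - (6 * k - t) := by omega
  rw [hexp]
  have hbase := hG.le_baseProb hp hpl hn'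
  have hbase2 : (k ^ 3 * (p ^ 3 * (1 - p) ^ (3 * k ^ 2 - 3) * exp (-(k + 1)) ^ 3)) ^ 2 ≤
      baseProb p n k ^ 2 := pow_le_pow_left₀ (by positivity) hbase 2
  -- the edges
  have hedge : (1 - p) ^ e = (1 - p) ^ (3 * k ^ 2 - 3) * (1 - p) ^ (3 * k ^ 2 - 3) * (1 - p) ^ 6 *
      exp (l * s) := by
    have h1 : 3 ≤ 3 * k ^ 2 := by nlinarith
    rw [← pow_add, ← pow_add, show 3 * k ^ 2 - 3 + (3 * k ^ 2 - 3) + 6 = e + s by omega, pow_add,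
      mul_assoc, hpl, ← exp_nat_mul _ s, ← exp_add]
    rw [show (s : ℝ) * -l + l * s = 0 by ring, exp_zero, mul_one]
  have hes : exp (l * s) ≤ exp (398 / 400 * (l * k * t)) := by
    rw [exp_le_exp]
    have : (200 * s : ℝ) ≤ 199 * (k * t) := by exact_mod_cast hs
    nlinarith
  -- the outside vertices
  have hHpow : H ^ (n - (6 * k - t)) ≤ exp (-(k + 1)) ^ 6 * exp (8 + l / 400 * k * t) := by
    have h1 : H ≤ exp (-6 * exp (-(l * k)) + 15 * exp (-l) ^ (2 * k - min k t)) := by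
      refine le_trans ?_ (add_one_le_exp _)
      rw [← hqk, ← hpl]
      linarith
    refine (pow_le_pow_left₀ hH0 h1 _).trans ?_
    rw [← exp_nat_mul _ (n - _), ← exp_nat_mul _ 6, ← exp_add, exp_le_exp]
    have h2 := hG.cross_term_le hl hn' t
    have h3 := le_mul_exp_neg hn
    have h4 := hG.mul_exp_le
    have h5 : ((n - (6 * k - t) : ℕ) : ℝ) ≤ n := by exact_mod_cast Nat.sub_le _ _
    have h6 : (n : ℝ) - 6 * k ≤ ((n - (6 * k - t) : ℕ) : ℝ) := by
      have : n ≤ (n - (6 * k - t)) + 6 * k := by omega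
      have : (n : ℝ) ≤ ((n - (6 * k - t) : ℕ) : ℝ) + 6 * k := by exact_mod_cast this
      linarith
    set N' : ℝ := ((n - (6 * k - t) : ℕ) : ℝ)
    have hx0 := exp_pos (-(l * k))
    set x := exp (-(l * k))
    have hy0 : 0 ≤ exp (-l) ^ (2 * k - min k t) := (pow_pos (exp_pos _) _).le
    set y := exp (-l) ^ (2 * k - min k t)
    have h7 : N' * (15 * y) ≤ n * (15 * y) := by gcongr
    have h8 : (n - 6 * k) * x ≤ N' * x := by gcongr
    push_cast
    nlinarith
  calc (k : ℝ) ^ 6 * ((1 - p) ^ e / (1 - p) ^ 6 * H ^ (n - (6 * k - t)))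
      ≤ (k : ℝ) ^ 6 * ((1 - p) ^ e / (1 - p) ^ 6 *
          (exp (-(k + 1)) ^ 6 * exp (8 + l / 400 * k * t))) := by gcongr
    _ = 1 / p ^ 6 * (k ^ 3 * (p ^ 3 * (1 - p) ^ (3 * k ^ 2 - 3) * exp (-(k + 1)) ^ 3)) ^ 2 *
          (exp (l * s) * exp (8 + l / 400 * k * t)) := by
        rw [hedge]
        field_simp
    _ ≤ 1 / p ^ 6 * baseProb p n k ^ 2 *
          (exp (398 / 400 * (l * k * t)) * exp (8 + l / 400 * k * t)) := by gcongr
    _ = _ := by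
        rw [← exp_nat_mul, ← exp_add,
          show 398 / 400 * (l * k * t) + (8 + l / 400 * k * t) = 8 + t * (399 / 400 * (l * k)) by
            ring, exp_add]
        ring

/-- The total contribution of the pairs without matching classes. -/
lemma sum_graphProb_pair_le_of_small_overlap (hp : p ∈ Set.Ioo (0 : ℝ) 1) (hl : 0 < l)
    (hpl : 1 - p = exp (-l)) (hG : GoodFor l c k)
    (hn : k * exp (l * k) ≤ Fintype.card V) (hn' : Fintype.card V ≤ k * exp (l * k) + 1)
    {f : V → Option (Fin 3)} (hf : f ∈ balanced V k) :
    ∑ f' ∈ balanced V k with ∃ i, ∀ j, 10 * #(cls f i ∩ cls f' j) < 9 * k,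
      graphProb p (fun G => (∃ x, IsSpecial G f x) ∧ ∃ x, IsSpecial G f' x) ≤
      exp 9 / p ^ 6 * (#(balanced V k) * baseProb p (Fintype.card V) k) *
        baseProb p (Fintype.card V) k := by
  have hp0 := hp.1
  have hk : (1 : ℝ) ≤ k := by exact_mod_cast hG.one_le
  have hV : (0 : ℝ) < Fintype.card V := lt_of_lt_of_le (by positivity) hn
  set n := Fintype.card V with hnV
  set z := exp (399 / 400 * (l * k)) with hz
  have hz1 : 1 ≤ z := one_le_exp (by positivity)
  calc _ ≤ ∑ f' ∈ balanced V k with ∃ i, ∀ j, 10 * #(cls f i ∩ cls f' j) < 9 * k,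
        exp 8 / p ^ 6 * baseProb p n k ^ 2 * z ^ #(supp f ∩ supp f') := by
        refine sum_le_sum fun f' hf' => ?_
        obtain ⟨hf', i, hi⟩ := mem_filter.1 hf'
        exact graphProb_pair_le_of_small_overlap hp hl hpl hG hn hn' hf hf' hi
    _ ≤ ∑ f' ∈ balanced V k, exp 8 / p ^ 6 * baseProb p n k ^ 2 * z ^ #(supp f ∩ supp f') :=
        sum_le_sum_of_subset_of_nonneg (filter_subset _ _) fun _ _ _ => by positivity
    _ ≤ exp 8 / p ^ 6 * baseProb p n k ^ 2 *
          (#(balanced V k) * (1 + 3 * k * z / n) ^ #(supp f)) := by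
        rw [← mul_sum]
        gcongr
        exact sum_pow_inter_supp_le (hG.three_mul_le hn) (by exact_mod_cast hV) _ hz1
    _ ≤ exp 8 / p ^ 6 * baseProb p n k ^ 2 * (#(balanced V k) * exp 1) := by
        gcongr
        rw [card_supp_of_balanced hf]
        have h1 : 1 + 3 * k * z / n ≤ exp (3 * k * z / n) := by
          rw [add_comm]; exact add_one_le_exp _
        refine (pow_le_pow_left₀ (by positivity) h1 _).trans ?_
        rw [← exp_nat_mul, exp_le_exp]
        push_cast
        rw [← mul_div_assoc, div_le_one hV]
        refine le_trans ?_ hn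
        have h2 := hG.mul_exp_div_le
        have h3 : z = exp (l * k) * exp (-(l * k / 400)) := by
          rw [hz, ← exp_add]; congr 1; ring
        rw [h3]
        calc 3 * (k : ℝ) * (3 * k * (exp (l * k) * exp (-(l * k / 400))))
            = k * exp (l * k) * (9 * k * exp (-(l * k / 400))) := by ring
          _ ≤ k * exp (l * k) * 1 := by gcongr
          _ = _ := mul_one _
    _ = _ := by
        rw [show (9 : ℝ) = 8 + 1 by norm_num, exp_add]
        ring

end SmallOverlap

section LargeOverlap

open Finset
open scoped Classical

variable {V : Type*} [Fintype V]

/-- Corresponding classes of the labellings have large intersections. -/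
def Matched (k : ℕ) (f f' : V → Option (Fin 3)) : Prop :=
  ∀ i, 9 * k ≤ 10 * #(cls f i ∩ cls f' i)

/-- The vertices that are labelled by `f'` but not by `f`. -/
noncomputable def added (f f' : V → Option (Fin 3)) : Finset V := {v | f v = none ∧ f' v ≠ none}

/-- The vertices that are labelled differently by `f` and `f'`. -/
noncomputable def moved (f f' : V → Option (Fin 3)) : Finset V :=
  {v | f v ≠ none ∧ f' v ≠ none ∧ f v ≠ f' v}

lemma card_added_add {k : ℕ} {f f' : V → Option (Fin 3)} (hf' : f' ∈ balanced V k) :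
    #(added f f') + #(supp f ∩ supp f') = 3 * k := by
  rw [← card_supp_of_balanced hf', ← card_union_of_disjoint]
  · congr 1
    ext v
    simp only [added, mem_union, mem_filter, mem_univ, true_and, mem_inter, mem_supp]
    tauto
  · rw [disjoint_left]
    intro v
    simp only [added, mem_filter, mem_univ, true_and, mem_inter, mem_supp]
    tauto

lemma ten_mul_card_added_le {k : ℕ} {f f' : V → Option (Fin 3)} (hf' : f' ∈ balanced V k)
    (h : Matched k f f') : 10 * #(added f f') ≤ 3 * k := by
  have h1 := card_added_add (f := f) hf'
  have h2 : 27 * k ≤ 10 * #(supp f ∩ supp f') := by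
    rw [card_inter_supp, mul_sum]
    refine le_trans (le_of_eq ?_) (sum_le_sum fun i _ => (h i).trans (Nat.mul_le_mul_left _
      (card_le_card (inter_subset_inter_left (cls_subset_supp f' i)))))
    simp only [sum_const, card_univ, Fintype.card_fin, smul_eq_mul]
    ring
  omega

lemma card_edges_sup_ge {k : ℕ} {f f' : V → Option (Fin 3)} (hf : f ∈ balanced V k)
    (h : Matched k f f') :
    9 * (k * (2 * #(added f f') + #(moved f f'))) + 30 * k ^ 2 ≤
      10 * #(edges (crossGraph f ⊔ crossGraph f')) := by
  set D : V → Finset V := fun u =>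
    {v | f v = f' v ∧ f' v ≠ none ∧ f' v ≠ f' u ∧ (f u = none ∨ f v = f u)} with hD
  have hdisj : Disjoint (added f f') (moved f f') := by
    rw [disjoint_left]
    intro v
    simp only [added, moved, mem_filter, mem_univ, true_and]
    tauto
  have hsub : ((added f f' ∪ moved f f').sigma D).image (fun z => s(z.1, z.2)) ⊆
      edges (crossGraph f ⊔ crossGraph f') \ edges (crossGraph f) := by
    intro e he
    obtain ⟨⟨u, v⟩, hz, rfl⟩ := mem_image.1 he
    simp only [mem_sigma, mem_union, added, moved, hD, mem_filter, mem_univ, true_and] at hz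
    simp only [Finset.mem_sdiff, mem_edges, SimpleGraph.mem_edgeSet, SimpleGraph.sup_adj,
      crossGraph]
    obtain ⟨hu, hv1, hv2, hv3, hv4⟩ := hz
    have hu' : f' u ≠ none := by tauto
    refine ⟨Or.inr ⟨hu', hv2, hv3.symm⟩, ?_⟩
    rintro ⟨a, b, c⟩
    rcases hv4 with h | h
    · exact a h
    · exact c h.symm
  have hinj : Set.InjOn (fun z : (_ : V) × V => s(z.1, z.2))
      ((added f f' ∪ moved f f').sigma D : Finset ((_ : V) × V)) := by
    rintro ⟨u, v⟩ hz ⟨u', v'⟩ hz' heq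
    simp only [mem_coe, mem_sigma, mem_union, added, moved, hD, mem_filter, mem_univ,
      true_and] at hz hz'
    simp only [Sym2.eq_iff] at heq
    rcases heq with ⟨rfl, rfl⟩ | ⟨rfl, rfl⟩
    · rfl
    · exfalso
      obtain ⟨hu, -⟩ := hz
      obtain ⟨-, hv, -⟩ := hz'
      rcases hu with ⟨h1, h2⟩ | ⟨-, -, h2⟩
      · exact h2 (hv ▸ h1)
      · exact h2 hv
  have h1 := card_le_card hsub
  rw [card_image_of_injOn hinj, card_sigma, sum_union hdisj,
    card_sdiff_of_subset (by intro e; simp only [mem_edges]; exact fun he =>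
      SimpleGraph.edgeSet_mono le_sup_left he), card_edges_of_balanced hf] at h1
  have hle : 3 * k ^ 2 ≤ #(edges (crossGraph f ⊔ crossGraph f')) := by
    rw [← card_edges_of_balanced hf]
    refine card_le_card ?_
    intro e; simp only [mem_edges]; exact fun he => SimpleGraph.edgeSet_mono le_sup_left he
  have h2 : 18 * k * #(added f f') ≤ 10 * ∑ u ∈ added f f', #(D u) := by
    rw [mul_sum, mul_comm, ← smul_eq_mul]
    refine card_nsmul_le_sum _ _ _ fun u hu => ?_
    simp only [added, mem_filter, mem_univ, true_and] at hu
    obtain ⟨j, hj⟩ := Option.ne_none_iff_exists'.1 hu.2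
    obtain ⟨a1, a2, a3⟩ : j + 1 ≠ j ∧ j + 2 ≠ j ∧ j + 1 ≠ j + 2 := by
      clear hj
      revert j
      decide
    have hM : (cls f (j + 1) ∩ cls f' (j + 1)) ∪ (cls f (j + 2) ∩ cls f' (j + 2)) ⊆ D u := by
      intro v hv
      simp only [mem_union, mem_inter, mem_cls] at hv
      simp only [hD, mem_filter, mem_univ, true_and, hu.1, hj]
      rcases hv with ⟨h1, h2⟩ | ⟨h1, h2⟩ <;> simp [h1, h2, a1, a2]
    have hcard := card_le_card hM
    rw [card_union_of_disjoint] at hcard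
    · have e1 := h (j + 1)
      have e2 := h (j + 2)
      omega
    · exact (disjoint_cls f a3).mono inter_subset_left inter_subset_left
  have h3 : 9 * k * #(moved f f') ≤ 10 * ∑ u ∈ moved f f', #(D u) := by
    rw [mul_sum, mul_comm, ← smul_eq_mul]
    refine card_nsmul_le_sum _ _ _ fun u hu => ?_
    simp only [moved, mem_filter, mem_univ, true_and] at hu
    obtain ⟨i, hi⟩ := Option.ne_none_iff_exists'.1 hu.1
    refine (h i).trans (Nat.mul_le_mul_left _ (card_le_card ?_))
    intro v hv
    simp only [mem_inter, mem_cls] at hv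
    have := hu.2.2
    rw [hi] at this
    simp [hD, hv.1, hv.2, hi, this]
  have h4 : 10 * (∑ u ∈ added f f', #(D u) + ∑ u ∈ moved f f', #(D u)) + 10 * (3 * k ^ 2) ≤
      10 * #(edges (crossGraph f ⊔ crossGraph f')) := by omega
  nlinarith

/-- The exponent of the weight of changing the label of a vertex from `o` to `o'`. -/
noncomputable def changeCost (o o' : Option (Fin 3)) : ℕ :=
  if o' = o then 0 else if o = none then 3 else 1

lemma sum_changeCost {k : ℕ} {f f' : V → Option (Fin 3)} (hf : f ∈ balanced V k)
    (hf' : f' ∈ balanced V k) :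
    ∑ v, changeCost (f v) (f' v) = 4 * #(added f f') + #(moved f f') := by
  have h1 : #(added f f') = #(added f' f) := by
    have a := card_added_add (f := f) hf'
    have b := card_added_add (f := f') hf
    rw [inter_comm] at b
    omega
  have h2 : ∑ v, changeCost (f v) (f' v) =
      3 * #(added f f') + #(added f' f) + #(moved f f') := by
    simp only [added, moved, card_filter]
    rw [mul_sum, ← sum_add_distrib, ← sum_add_distrib]
    refine sum_congr rfl fun v _ => ?_
    unfold changeCost
    by_cases a : f v = none <;> by_cases b : f' v = none <;> by_cases c : f' v = f v <;>
      simp_all [eq_comm]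
  omega

lemma sum_pow_changeCost (f : V → Option (Fin 3)) (y : ℝ) :
    ∑ f' : V → Option (Fin 3), y ^ ∑ v, changeCost (f v) (f' v) =
      (1 + 3 * y) ^ #(supp f) * (1 + 3 * y ^ 3) ^ (Fintype.card V - #(supp f)) := by
  simp only [← prod_pow_eq_pow_sum]
  rw [sum_prod_label (fun v o => y ^ changeCost (f v) o)]
  have h : ∀ o, ∑ o', y ^ changeCost o o' = if o = none then 1 + 3 * y ^ 3 else 1 + 3 * y := by
    intro o
    rcases o with _ | i
    · simp [Fintype.sum_option, changeCost]
    · rw [Fintype.sum_option, if_neg (by simp), Fin.sum_univ_three]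
      fin_cases i <;> simp [changeCost] <;> ring
  simp only [h]
  rw [prod_ite, prod_const, prod_const, mul_comm]
  have h1 : ({v | ¬ f v = none} : Finset V) = supp f := by ext; simp
  have h2 : ({v | f v = none} : Finset V) = univ \ supp f := by ext; simp
  rw [h1, h2, card_univ_sdiff]

end LargeOverlap

section MatchedPairs

open Finset
open scoped Classical

variable {V : Type*} [Fintype V] {p l : ℝ} {k : ℕ}

lemma baseProb_nonneg (hp : p ∈ Set.Ioo (0 : ℝ) 1) (n k : ℕ) : 0 ≤ baseProb p n k := by
  have hp0 := hp.1
  have hq0 : 0 < 1 - p := by linarith [hp.2]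
  have : 0 ≤ 1 - (1 - p) ^ k := sub_nonneg.2 (pow_le_one₀ hq0.le (by linarith))
  unfold baseProb
  positivity

lemma graphProb_pair_le_of_matched {c : ℝ} (hp : p ∈ Set.Ioo (0 : ℝ) 1) (hl : 0 < l)
    (hpl : 1 - p = exp (-l)) (hG : GoodFor l c k) (hn : k * exp (l * k) ≤ Fintype.card V)
    {f f' : V → Option (Fin 3)} (hf : f ∈ balanced V k) (hf' : f' ∈ balanced V k)
    (h : Matched k f f') :
    graphProb p (fun G => (∃ x, IsSpecial G f x) ∧ ∃ x, IsSpecial G f' x) ≤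
      2 * (k ^ 3 / (p ^ 3 * (1 - p) ^ 3)) * baseProb p (Fintype.card V) k *
        exp (-(9 / 20 * (l * k))) ^ ∑ v, changeCost (f v) (f' v) := by
  have hp0 := hp.1
  have hq0 : 0 < 1 - p := by linarith [hp.2]
  have hk : (1 : ℝ) ≤ k := by exact_mod_cast hG.one_le
  have hqk : (1 - p) ^ k = exp (-(l * k)) := by
    rw [hpl, ← exp_nat_mul]; congr 1; ring
  refine (graphProb_pair_le hp hf hf' (cls f) fun i => ⟨i, Or.inl rfl⟩).trans ?_
  rw [hitProb_of_disjoint (fun i => (cls_subset_supp f i).trans subset_union_left) (disjoint_cls f)]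
  rw [sum_changeCost hf hf']
  have hE := card_edges_sup_ge hf h
  have hr := ten_mul_card_added_le hf' h
  have hW : #(supp f ∪ supp f') = 3 * k + #(added f f') := by
    have h1 := card_added_add (f := f) hf'
    have h2 := card_supp_union hf hf'
    omega
  simp only [mem_balanced.1 hf, prod_const, card_univ, Fintype.card_fin, hW, hqk, baseProb]
  have h36 := hG.sq_le hn
  have hk1 := hG.one_le
  have hx0 := exp_pos (-(l * k))
  have hx := hG.mul_exp_le
  set n := Fintype.card V
  set r := #(added f f')
  set w := #(moved f f')
  set e := #(edges (crossGraph f ⊔ crossGraph f'))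
  set x := exp (-(l * k))
  have hx1 : 0 ≤ 1 - x := by nlinarith
  have h1 : (1 - p) ^ e ≤ (1 - p) ^ (3 * k ^ 2 - 3) * (1 - p) ^ 3 *
      exp (-(9 / 20 * (l * k))) ^ (4 * r + w) := by
    have h1 : 3 ≤ 3 * k ^ 2 := by nlinarith
    rw [← pow_add, Nat.sub_add_cancel h1, hpl, ← exp_nat_mul, ← exp_nat_mul, ← exp_nat_mul,
      ← exp_add, exp_le_exp]
    have h2 : (9 * (k * (2 * r + w)) + 30 * k ^ 2 : ℝ) ≤ 10 * e := by exact_mod_cast hE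
    push_cast
    have h3 : (0 : ℝ) ≤ k * w := by positivity
    nlinarith
  have h2 : ((1 - x) ^ 3) ^ (n - (3 * k + r)) ≤ 2 * ((1 - x) ^ 3) ^ (n - 3 * k) := by
    have h3 : n - 3 * k = (n - (3 * k + r)) + r := by
      have : 3 * k + r ≤ 36 * k ^ 2 := by nlinarith
      omega
    have h4 : 1 / 2 ≤ ((1 - x) ^ 3) ^ r := by
      rw [← pow_mul]
      refine le_trans ?_ (pow_le_pow_of_le_one hx1 (by linarith) (show 3 * r ≤ k by omega))
      have h5 := one_add_mul_le_pow (show (-2 : ℝ) ≤ -x by linarith) k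
      rw [← sub_eq_add_neg] at h5
      refine le_trans ?_ h5
      nlinarith
    rw [h3, pow_add]
    have h6 : 0 ≤ ((1 - x) ^ 3) ^ (n - (3 * k + r)) := by positivity
    nlinarith
  calc (k : ℝ) ^ 6 * ((1 - p) ^ e / (1 - p) ^ 6 * ((1 - x) ^ 3) ^ (n - (3 * k + r)))
      ≤ (k : ℝ) ^ 6 * ((1 - p) ^ (3 * k ^ 2 - 3) * (1 - p) ^ 3 *
        exp (-(9 / 20 * (l * k))) ^ (4 * r + w) / (1 - p) ^ 6 *
          (2 * ((1 - x) ^ 3) ^ (n - 3 * k))) := by gcongr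
    _ = _ := by field_simp

/-- The total contribution of the pairs with matching classes. -/
lemma sum_graphProb_pair_le_of_matched (hp : p ∈ Set.Ioo (0 : ℝ) 1) (hl : 0 < l)
    (hpl : 1 - p = exp (-l)) (hG : GoodFor l (p ^ 3 * (1 - p) ^ 3) k)
    (hn : k * exp (l * k) ≤ Fintype.card V) (hn' : Fintype.card V ≤ k * exp (l * k) + 1)
    {f : V → Option (Fin 3)} (hf : f ∈ balanced V k) :
    ∑ f' ∈ balanced V k with Matched k f f',
      graphProb p (fun G => (∃ x, IsSpecial G f x) ∧ ∃ x, IsSpecial G f' x) ≤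
      2 * baseProb p (Fintype.card V) k := by
  have hp0 := hp.1
  have hq0 : 0 < 1 - p := by linarith [hp.2]
  have hk : (1 : ℝ) ≤ k := by exact_mod_cast hG.one_le
  have hself : Matched k f f := by
    intro i
    rw [inter_self, mem_balanced.1 hf i]
    omega
  have hP0 := baseProb_nonneg hp (Fintype.card V) k
  have hx1 := mul_exp_neg_le hn'
  have hc := hG.pow_mul_exp_le
  set y := exp (-(9 / 20 * (l * k))) with hy
  have hy0 : 0 < y := exp_pos _
  have hsum : ∑ f' ∈ {f' ∈ balanced V k | Matched k f f'}.erase f,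
      y ^ ∑ v, changeCost (f v) (f' v) ≤ 30 * (k + 1) * exp (-(7 / 20 * (l * k))) := by
    have h1 : ∑ f' ∈ {f' ∈ balanced V k | Matched k f f'}.erase f,
        y ^ ∑ v, changeCost (f v) (f' v) + 1 ≤
        ∑ f' : V → Option (Fin 3), y ^ ∑ v, changeCost (f v) (f' v) := by
      rw [← sum_erase_add univ _ (mem_univ f)]
      refine add_le_add (sum_le_sum_of_subset_of_nonneg
        (erase_subset_erase f (subset_univ _)) fun _ _ _ => by positivity) (le_of_eq ?_)
      simp [changeCost]
    rw [sum_pow_changeCost, card_supp_of_balanced hf] at h1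
    set n := Fintype.card V
    have h2 : (1 + 3 * y) ^ (3 * k) * (1 + 3 * y ^ 3) ^ (n - 3 * k) ≤
        exp (9 * k * y + 3 * n * y ^ 3) := by
      have a1 : 1 + 3 * y ≤ exp (3 * y) := by rw [add_comm]; exact add_one_le_exp _
      have a2 : 1 + 3 * y ^ 3 ≤ exp (3 * y ^ 3) := by rw [add_comm]; exact add_one_le_exp _
      have a3 : (1 + 3 * y ^ 3) ^ (n - 3 * k) ≤ (1 + 3 * y ^ 3) ^ n :=
        pow_le_pow_right₀ (by have := pow_pos hy0 3; linarith) (Nat.sub_le _ _)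
      calc _ ≤ exp (3 * y) ^ (3 * k) * exp (3 * y ^ 3) ^ n := by
            gcongr
            exact a3.trans (by gcongr)
        _ = _ := by
            rw [← exp_nat_mul, ← exp_nat_mul, ← exp_add]
            push_cast
            ring_nf
    set u := exp (-(7 / 20 * (l * k))) with hu
    have hu0 : 0 < u := exp_pos _
    have hyu : y ≤ u := by
      rw [hy, hu, exp_le_exp]
      nlinarith [mul_pos hl (by linarith : (0 : ℝ) < k)]
    have hny : n * y ^ 3 ≤ (k + 1) * u := by
      have : y ^ 3 = exp (-(l * k)) * u := by
        rw [hy, hu, ← exp_nat_mul, ← exp_add]; congr 1; push_cast; ring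
      rw [this, ← mul_assoc]
      have hx : exp (-(l * k)) ≤ 1 := exp_le_one_iff.2 (by
        have := mul_pos hl (by linarith : (0 : ℝ) < k); linarith)
      gcongr
      linarith
    have h3 : exp (9 * k * y + 3 * n * y ^ 3) ≤ exp (15 * (k + 1) * u) := by
      rw [exp_le_exp]
      have : (k : ℝ) * y ≤ k * u := by gcongr
      nlinarith
    have hsmall : 15 * (k + 1) * u ≤ 1 := by
      have b1 : p ^ 3 * (1 - p) ^ 3 ≤ 1 := by
        have := pow_le_one₀ (n := 3) hp0.le hp.2.le
        have := pow_le_one₀ (n := 3) hq0.le (by linarith)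
        exact mul_le_one₀ ‹_› (by positivity) ‹_›
      have b2 : (1 : ℝ) ≤ k ^ 3 := one_le_pow₀ hk
      have b3 : 0 ≤ (k + 1) * u := by positivity
      nlinarith
    have h4 : exp (15 * (k + 1) * u) ≤ 1 + 2 * (15 * (k + 1) * u) := by
      have b := abs_exp_sub_one_le (x := 15 * (k + 1) * u) (by
        rw [abs_of_nonneg (by positivity)]; exact hsmall)
      rw [abs_of_nonneg (a := 15 * (k + 1) * u) (by positivity)] at b
      linarith [le_abs_self (exp (15 * (k + 1) * u) - 1)]
    linarith
  rw [← add_sum_erase _ _ (mem_filter.2 ⟨hf, hself⟩), two_mul]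
  refine add_le_add ?_ ?_
  · simp only [and_self]
    rw [graphProb_balanced hf]
  calc _ ≤ ∑ f' ∈ {f' ∈ balanced V k | Matched k f f'}.erase f,
        2 * (k ^ 3 / (p ^ 3 * (1 - p) ^ 3)) * baseProb p (Fintype.card V) k *
          y ^ ∑ v, changeCost (f v) (f' v) := by
        refine sum_le_sum fun f' hf' => ?_
        obtain ⟨hf', hm⟩ := mem_filter.1 (mem_of_mem_erase hf')
        exact graphProb_pair_le_of_matched hp hl hpl hG hn hf hf' hm
    _ ≤ 2 * (k ^ 3 / (p ^ 3 * (1 - p) ^ 3)) * baseProb p (Fintype.card V) k *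
          (30 * (k + 1) * exp (-(7 / 20 * (l * k)))) := by
        rw [← mul_sum]
        gcongr
    _ = 60 * k ^ 3 * (k + 1) * exp (-(7 / 20 * (l * k))) / (p ^ 3 * (1 - p) ^ 3) *
          baseProb p (Fintype.card V) k := by ring
    _ ≤ 1 * baseProb p (Fintype.card V) k := by
        gcongr
        rw [div_le_one (by positivity)]
        exact hc
    _ = _ := one_mul _

lemma map_mem_balanced {f : V → Option (Fin 3)} (hf : f ∈ balanced V k) (σ : Equiv.Perm (Fin 3)) :
    (fun v => (f v).map σ) ∈ balanced V k := by
  rw [mem_balanced] at hf ⊢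
  intro i
  rw [cls_map, hf]

lemma exists_isSpecial_map_iff {V : Type*} {G : SimpleGraph V} {f : V → Option (Fin 3)}
    (σ : Equiv.Perm (Fin 3)) :
    (∃ x, IsSpecial G (fun v => (f v).map σ) x) ↔ ∃ x, IsSpecial G f x := by
  refine ⟨fun ⟨x, hx⟩ => ⟨fun i => x (σ.symm.symm i), ?_⟩, fun ⟨x, hx⟩ => ⟨_, hx.perm σ⟩⟩
  have := hx.perm σ.symm
  simpa [Option.map_map, Function.comp_def] using this

/-- Two labellings all of whose classes have large intersections are matched after permuting the
labels. -/
lemma exists_perm_matched {f f' : V → Option (Fin 3)} (hf' : f' ∈ balanced V k) (hk : 1 ≤ k)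
    (h : ¬ ∃ i, ∀ j, 10 * #(cls f i ∩ cls f' j) < 9 * k) :
    ∃ σ : Equiv.Perm (Fin 3), Matched k f (fun v => (f' v).map σ) := by
  push Not at h
  choose τ hτ using h
  have hinj : Function.Injective τ := by
    intro i i' hii
    by_contra hne
    have h1 := hτ i
    have h2 := hτ i'
    rw [← hii] at h2
    have h3 : Disjoint (cls f i ∩ cls f' (τ i)) (cls f i' ∩ cls f' (τ i)) :=
      (disjoint_cls f hne).mono inter_subset_left inter_subset_left
    have h4 := card_le_card (union_subset (inter_subset_right (s₁ := cls f i) (s₂ := cls f' (τ i)))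
      (inter_subset_right (s₁ := cls f i')))
    rw [card_union_of_disjoint h3, mem_balanced.1 hf'] at h4
    omega
  refine ⟨(Equiv.ofBijective τ (Finite.injective_iff_bijective.1 hinj)).symm, fun i => ?_⟩
  rw [cls_map]
  exact hτ i

/-- The second moment of the number of special balanced labellings. -/
lemma sum_graphProb_pair_le (hp : p ∈ Set.Ioo (0 : ℝ) 1) (hl : 0 < l)
    (hpl : 1 - p = exp (-l)) (hG : GoodFor l (p ^ 3 * (1 - p) ^ 3) k)
    (hn : k * exp (l * k) ≤ Fintype.card V) (hn' : Fintype.card V ≤ k * exp (l * k) + 1)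
    {f : V → Option (Fin 3)} (hf : f ∈ balanced V k) :
    ∑ f' ∈ balanced V k,
      graphProb p (fun G => (∃ x, IsSpecial G f x) ∧ ∃ x, IsSpecial G f' x) ≤
      (exp 9 / p ^ 6 * (#(balanced V k) * baseProb p (Fintype.card V) k) + 12) *
        baseProb p (Fintype.card V) k := by
  rw [← sum_filter_add_sum_filter_not _
    (fun f' => ∃ i, ∀ j, 10 * #(cls f i ∩ cls f' j) < 9 * k), add_mul]
  refine add_le_add (sum_graphProb_pair_le_of_small_overlap hp hl hpl hG hn hn' hf) ?_
  set F : (V → Option (Fin 3)) → ℝ := fun f' =>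
    graphProb p (fun G => (∃ x, IsSpecial G f x) ∧ ∃ x, IsSpecial G f' x) with hF
  have hF0 : ∀ f', 0 ≤ F f' := fun f' => graphProb_nonneg hp _
  have hFσ : ∀ (σ : Equiv.Perm (Fin 3)) f', F (fun v => (f' v).map σ) = F f' := by
    intro σ f'
    simp only [hF, exists_isSpecial_map_iff]
  calc _ ≤ ∑ f' ∈ balanced V k, ∑ σ : Equiv.Perm (Fin 3),
        if Matched k f (fun v => (f' v).map σ) then F f' else 0 := by
        rw [sum_filter]
        refine sum_le_sum fun f' hf' => ?_
        split_ifs with h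
        · exact sum_nonneg fun σ _ => by split_ifs; exacts [hF0 _, le_rfl]
        · obtain ⟨σ, hσ⟩ := exists_perm_matched hf' hG.one_le h
          refine le_trans (le_of_eq ?_) (single_le_sum (fun σ _ => ?_) (mem_univ σ))
          · rw [if_pos hσ]
          · split_ifs; exacts [hF0 _, le_rfl]
    _ = ∑ _σ : Equiv.Perm (Fin 3), ∑ f' ∈ balanced V k with Matched k f f', F f' := by
        rw [sum_comm]
        refine sum_congr rfl fun σ _ => ?_
        rw [sum_filter]
        refine sum_nbij' (fun f' v => (f' v).map σ) (fun f' v => (f' v).map σ.symm) ?_ ?_ ?_ ?_ ?_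
        · exact fun f' hf' => map_mem_balanced hf' σ
        · exact fun f' hf' => map_mem_balanced hf' σ.symm
        · intro f' _
          ext1 v
          simp
        · intro f' _
          ext1 v
          simp
        · intro f' _
          rw [hFσ]
    _ ≤ ∑ _σ : Equiv.Perm (Fin 3), 2 * baseProb p (Fintype.card V) k :=
        sum_le_sum fun _ _ => sum_graphProb_pair_le_of_matched hp hl hpl hG hn hn' hf
    _ = _ := by
        rw [sum_const, card_univ, Fintype.card_perm, Fintype.card_fin]
        norm_num [Nat.factorial]
        ring

end MatchedPairs

lemma factorial_mul_exp_le {k : ℕ} (hk : 1 ≤ k) :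
    (k.factorial : ℝ) * exp k ≤ exp 1 * k * (k : ℝ) ^ k := by
  induction k, hk using Nat.le_induction with
  | base => simp
  | succ k hk ih =>
    have hk' : (1 : ℝ) ≤ k := by exact_mod_cast hk
    have h1 : (k / (k + 1) : ℝ) ≤ exp (-(1 / (k + 1))) := by
      refine le_trans (le_of_eq ?_) (one_sub_le_exp_neg _)
      field_simp
      ring
    have h2 : (k : ℝ) ^ (k + 1) * exp 1 ≤ (k + 1) ^ (k + 1) := by
      have h3 := pow_le_pow_left₀ (by positivity) h1 (k + 1)
      rw [← exp_nat_mul, div_pow, div_le_iff₀ (by positivity)] at h3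
      have h4 : ((k + 1 : ℕ) : ℝ) * -(1 / (k + 1)) = -1 := by push_cast; field_simp
      rw [h4] at h3
      calc (k : ℝ) ^ (k + 1) * exp 1 ≤ exp (-1) * (k + 1) ^ (k + 1) * exp 1 := by gcongr
        _ = (exp (-1) * exp 1) * (k + 1) ^ (k + 1) := by ring
        _ = _ := by rw [← exp_add]; simp
    rw [Nat.factorial_succ]
    push_cast
    rw [exp_add]
    calc ((k : ℝ) + 1) * k.factorial * (exp k * exp 1)
        = (k + 1) * exp 1 * (k.factorial * exp k) := by ring
      _ ≤ (k + 1) * exp 1 * (exp 1 * k * (k : ℝ) ^ k) := by gcongr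
      _ = exp 1 * (k + 1) * ((k : ℝ) ^ (k + 1) * exp 1) := by ring
      _ ≤ _ := by gcongr

section Count

open Finset
open scoped Classical

variable {V : Type*} [Fintype V] {p l c : ℝ} {k : ℕ}

lemma choose_mul_le_card_balanced :
    (Fintype.card V).choose k * ((Fintype.card V - k).choose k *
      (Fintype.card V - 2 * k).choose k) ≤ #(balanced V k) := by
  have hcls : ∀ A B C : Finset V, Disjoint A B → Disjoint (A ∪ B) C →
      cls (labelling A B C) 0 = A ∧ cls (labelling A B C) 1 = B ∧ cls (labelling A B C) 2 = C := by
    intro A B C hAB hC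
    refine ⟨?_, ?_, ?_⟩ <;> ext v <;> rw [mem_cls, labelling]
    · split_ifs <;> simp_all
    · have : v ∈ A → v ∉ B := fun h => disjoint_left.1 hAB h
      split_ifs <;> simp_all
    · have : v ∈ A ∪ B → v ∉ C := fun h => disjoint_left.1 hC h
      rw [mem_union] at this
      split_ifs <;> simp_all
  set s := (powersetCard k (univ : Finset V)).sigma fun A => (powersetCard k (univ \ A)).sigma
    fun B => powersetCard k (univ \ (A ∪ B)) with hs
  have hmem : ∀ z ∈ s, (#z.1 = k ∧ #z.2.1 = k ∧ #z.2.2 = k) ∧ Disjoint z.1 z.2.1 ∧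
      Disjoint (z.1 ∪ z.2.1) z.2.2 := by
    intro z hz
    simp only [hs, mem_sigma, mem_powersetCard, subset_univ, true_and] at hz
    obtain ⟨h1, ⟨h2, h3⟩, h4, h5⟩ := hz
    exact ⟨⟨h1, h3, h5⟩, (disjoint_sdiff.mono_right h2), (disjoint_sdiff.mono_right h4)⟩
  have hcard : #s = (Fintype.card V).choose k * ((Fintype.card V - k).choose k *
      (Fintype.card V - 2 * k).choose k) := by
    rw [hs, card_sigma, sum_congr rfl (g := fun _ => (Fintype.card V - k).choose k *
      (Fintype.card V - 2 * k).choose k), sum_const, card_powersetCard, card_univ, smul_eq_mul]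
    intro A hA
    rw [mem_powersetCard] at hA
    rw [card_sigma, sum_congr rfl (g := fun _ => (Fintype.card V - 2 * k).choose k), sum_const,
      card_powersetCard, card_univ_sdiff, hA.2, smul_eq_mul]
    intro B hB
    rw [mem_powersetCard] at hB
    rw [card_powersetCard, card_univ_sdiff,
      card_union_of_disjoint (disjoint_sdiff.mono_right hB.1), hA.2, hB.2, two_mul]
  rw [← hcard]
  refine card_le_card_of_injOn (fun z => labelling z.1 z.2.1 z.2.2) ?_ ?_
  · intro z hz
    obtain ⟨⟨h1, h2, h3⟩, h4, h5⟩ := hmem z hz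
    obtain ⟨c0, c1, c2⟩ := hcls _ _ _ h4 h5
    simp only [mem_coe, mem_balanced]
    intro i
    fin_cases i
    · exact (congrArg card c0).trans h1
    · exact (congrArg card c1).trans h2
    · exact (congrArg card c2).trans h3
  · rintro ⟨A, B, C⟩ hz ⟨A', B', C'⟩ hz' heq
    obtain ⟨-, h4, h5⟩ := hmem _ hz
    obtain ⟨c0, c1, c2⟩ := hcls _ _ _ h4 h5
    obtain ⟨-, h4', h5'⟩ := hmem _ hz'
    obtain ⟨c0', c1', c2'⟩ := hcls _ _ _ h4' h5'
    simp only at heq c0 c1 c2 c0' c1' c2'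
    rw [heq] at c0 c1 c2
    obtain rfl := c0.symm.trans c0'
    obtain rfl := c1.symm.trans c1'
    obtain rfl := c2.symm.trans c2'
    rfl

lemma pow_le_card_balanced (h3k : 3 * k ≤ Fintype.card V) :
    (Fintype.card V - 3 * k) ^ (3 * k) ≤ k.factorial ^ 3 * #(balanced V k) := by
  set n := Fintype.card V with hn
  have key : ∀ m, n - 2 * k ≤ m → (n - 3 * k) ^ k ≤ k.factorial * m.choose k := by
    intro m hm
    rw [← Nat.descFactorial_eq_factorial_mul_choose]
    exact (Nat.pow_le_pow_left (by omega) k).trans (Nat.pow_sub_le_descFactorial m k)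
  refine le_trans ?_ (Nat.mul_le_mul_left _ choose_mul_le_card_balanced)
  calc (n - 3 * k) ^ (3 * k) = (n - 3 * k) ^ k * ((n - 3 * k) ^ k * (n - 3 * k) ^ k) := by
        rw [← pow_add, ← pow_add]; congr 1; ring
    _ ≤ (k.factorial * n.choose k) * ((k.factorial * (n - k).choose k) *
          (k.factorial * (n - 2 * k).choose k)) :=
        Nat.mul_le_mul (key _ (by omega)) (Nat.mul_le_mul (key _ (by omega)) (key _ le_rfl))
    _ = _ := by ring

/-- The expected number of special balanced labellings is bounded below. -/
lemma le_card_mul_baseProb (hp : p ∈ Set.Ioo (0 : ℝ) 1) (hpl : 1 - p = exp (-l))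
    (hG : GoodFor l c k)
    (hn : k * exp (l * k) ≤ Fintype.card V) (hn' : Fintype.card V ≤ k * exp (l * k) + 1) :
    p ^ 3 * exp (-6) / 2 ≤ #(balanced V k) * baseProb p (Fintype.card V) k := by
  have hp0 := hp.1
  have hq0 : 0 < 1 - p := by linarith [hp.2]
  have hk : (1 : ℝ) ≤ k := by exact_mod_cast hG.one_le
  have h3k := hG.three_mul_le hn
  have hN : ((Fintype.card V : ℝ) - 3 * k) ^ (3 * k) ≤ k.factorial ^ 3 * #(balanced V k) := by
    have h := pow_le_card_balanced h3k
    have h2 : ((Fintype.card V - 3 * k : ℕ) : ℝ) = (Fintype.card V : ℝ) - 3 * k := by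
      push_cast [Nat.cast_sub h3k]; ring
    rw [← h2]
    exact_mod_cast h
  have hB := hG.le_baseProb hp hpl hn'
  have hF := factorial_mul_exp_le hG.one_le
  have hnx := le_mul_exp_neg hn
  have hx := hG.mul_exp_le
  have hx0 := exp_pos (-(l * k))
  have hqx : exp (-(l * k)) ^ (3 * k) ≤ (1 - p) ^ (3 * k ^ 2 - 3) := by
    have : exp (-(l * k)) = (1 - p) ^ k := by rw [hpl, ← exp_nat_mul]; congr 1; ring
    rw [this, ← pow_mul]
    refine pow_le_pow_of_le_one hq0.le (by linarith) ?_
    rw [show k * (3 * k) = 3 * k ^ 2 by ring]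
    exact Nat.sub_le _ _
  set n : ℕ := Fintype.card V
  set N : ℝ := (#(balanced V k) : ℝ)
  set P := baseProb p n k
  set x := exp (-(l * k))
  have h1 : (k : ℝ) ^ (3 * k) / 2 ≤ ((n - 3 * k) * x) ^ (3 * k) := by
    have a1 : k * (1 - 3 * x) ≤ (n - 3 * k) * x := by nlinarith
    have a2 : 0 ≤ 1 - 3 * x := by nlinarith
    refine le_trans ?_ (pow_le_pow_left₀ (by positivity) a1 _)
    have a3 := one_add_mul_le_pow (show (-2 : ℝ) ≤ -(3 * x) by nlinarith) (3 * k)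
    rw [← sub_eq_add_neg] at a3
    have a4 : 1 / 2 ≤ (1 - 3 * x) ^ (3 * k) := by
      refine le_trans ?_ a3
      push_cast
      nlinarith
    rw [mul_pow, div_eq_mul_one_div]
    gcongr
  have hn0 : 0 ≤ (n : ℝ) - 3 * k := by
    have : (3 * k : ℝ) ≤ n := by exact_mod_cast h3k
    linarith
  have hF3 : (k.factorial : ℝ) ^ 3 * exp k ^ 3 ≤ exp 3 * k ^ 3 * (k : ℝ) ^ (3 * k) := by
    have := pow_le_pow_left₀ (by positivity) hF 3
    rw [mul_pow] at this
    refine this.trans (le_of_eq ?_)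
    rw [mul_pow, mul_pow, ← pow_mul, mul_comm k 3, ← exp_nat_mul]
    norm_num
  have hfac : (0 : ℝ) < k.factorial ^ 3 := by positivity
  refine le_of_mul_le_mul_left ?_ hfac
  have e1 : exp (-(k + 1 : ℝ)) ^ 3 * exp k ^ 3 = exp (-3) := by
    rw [← exp_nat_mul, ← exp_nat_mul, ← exp_add]; congr 1; push_cast; ring
  have e2 : exp (-3 : ℝ) * exp 3 = 1 := by rw [← exp_add]; simp
  have e3 : exp (-6 : ℝ) = exp (-3) * exp (-3) := by rw [← exp_add]; norm_num
  have e4 : exp k ^ 3 * (exp (-(k + 1 : ℝ)) ^ 3 * exp 3) = 1 := by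
    rw [← mul_assoc, mul_comm (exp (k : ℝ) ^ 3), e1, e2]
  calc (k.factorial : ℝ) ^ 3 * (p ^ 3 * exp (-6) / 2)
      = (k.factorial : ℝ) ^ 3 * exp k ^ 3 * (exp (-(k + 1 : ℝ)) ^ 3 * exp 3) *
          (p ^ 3 * exp (-6) / 2) := by
        linear_combination (-(k.factorial : ℝ) ^ 3 * (p ^ 3 * exp (-6) / 2)) * e4
    _ ≤ exp 3 * k ^ 3 * (k : ℝ) ^ (3 * k) * (exp (-(k + 1 : ℝ)) ^ 3 * exp 3) *
          (p ^ 3 * exp (-6) / 2) := by gcongr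
    _ = (k : ℝ) ^ (3 * k) / 2 * (k ^ 3 * p ^ 3 * exp (-(k + 1 : ℝ)) ^ 3) := by
        rw [e3]
        linear_combination (k ^ 3 * (k : ℝ) ^ (3 * k) * exp (-(k + 1 : ℝ)) ^ 3 * p ^ 3 / 2) *
          (exp (-3) * exp 3 + 1) * e2
    _ ≤ ((n - 3 * k) * x) ^ (3 * k) * (k ^ 3 * p ^ 3 * exp (-(k + 1 : ℝ)) ^ 3) := by gcongr
    _ = (n - 3 * k : ℝ) ^ (3 * k) * (k ^ 3 * (p ^ 3 * x ^ (3 * k) * exp (-(k + 1 : ℝ)) ^ 3)) := by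
        rw [mul_pow]; ring
    _ ≤ (k.factorial ^ 3 * N) *
          (k ^ 3 * (p ^ 3 * (1 - p) ^ (3 * k ^ 2 - 3) * exp (-(k + 1 : ℝ)) ^ 3)) := by gcongr
    _ ≤ (k.factorial ^ 3 * N) * P := by gcongr
    _ = _ := by ring

/-- A lower bound for the probability of a special labelling when the expected number of special
labellings is not small. -/
lemma le_graphProb_exists_isSpecial (hp : p ∈ Set.Ioo (0 : ℝ) 1) (hl : 0 < l)
    (hpl : 1 - p = exp (-l)) (hG : GoodFor l (p ^ 3 * (1 - p) ^ 3) k)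
    (hn : k * exp (l * k) ≤ Fintype.card V) (hn' : Fintype.card V ≤ k * exp (l * k) + 1) :
    (exp 9 / p ^ 6 + 12 / (p ^ 3 * exp (-6) / 2))⁻¹ ≤
      graphProb p (fun G : SimpleGraph V => ∃ f x, IsSpecial G f x) := by
  have hp0 := hp.1
  set A := #(balanced V k) * baseProb p (Fintype.card V) k with hA
  have hm : p ^ 3 * exp (-6) / 2 ≤ A := le_card_mul_baseProb hp hpl hG hn hn'
  have hA0 : 0 < A := lt_of_lt_of_le (by positivity) hm
  have h1 := sq_sum_graphProb_le hp (balanced V k)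
    (fun f (G : SimpleGraph V) => ∃ x, IsSpecial G f x)
  have h2 : ∑ f ∈ balanced V k, graphProb p (fun G => ∃ x, IsSpecial G f x) = A := by
    rw [sum_congr rfl fun f hf => graphProb_balanced hf, sum_const, nsmul_eq_mul]
  have h3 : ∑ f ∈ balanced V k, ∑ f' ∈ balanced V k,
      graphProb p (fun G => (∃ x, IsSpecial G f x) ∧ ∃ x, IsSpecial G f' x) ≤
      (exp 9 / p ^ 6 * A + 12) * A := by
    refine (sum_le_sum fun f hf => sum_graphProb_pair_le hp hl hpl hG hn hn' hf).trans
      (le_of_eq ?_)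
    rw [sum_const, nsmul_eq_mul]
    ring
  rw [h2] at h1
  have h4 : graphProb p (fun G : SimpleGraph V => ∃ f ∈ balanced V k, ∃ x, IsSpecial G f x) ≤
      graphProb p (fun G : SimpleGraph V => ∃ f x, IsSpecial G f x) :=
    graphProb_mono hp fun G ⟨f, _, x, hx⟩ => ⟨f, x, hx⟩
  refine le_trans ?_ h4
  have h5 := graphProb_nonneg hp
    (fun G : SimpleGraph V => ∃ f ∈ balanced V k, ∃ x, IsSpecial G f x)
  set Q := graphProb p (fun G : SimpleGraph V => ∃ f ∈ balanced V k, ∃ x, IsSpecial G f x)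
  have h6 := h1.trans (mul_le_mul_of_nonneg_left h3 h5)
  have h7 : A ≤ Q * (exp 9 / p ^ 6 * A + 12) := by
    refine le_of_mul_le_mul_right ?_ hA0
    linarith
  have h8 : 12 ≤ 12 / (p ^ 3 * exp (-6) / 2) * A := by
    rw [div_mul_eq_mul_div, le_div_iff₀ (by positivity)]
    gcongr
  rw [inv_le_iff_one_le_mul₀ (by positivity)]
  refine le_of_mul_le_mul_right ?_ hA0
  calc 1 * A ≤ Q * (exp 9 / p ^ 6 * A + 12) := by rw [one_mul]; exact h7
    _ ≤ Q * (exp 9 / p ^ 6 * A + 12 / (p ^ 3 * exp (-6) / 2) * A) := by gcongr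
    _ = _ := by ring

end Count

/-- The probability that a special tuple exists has no limit: it is bounded below along
`n = ⌈k exp (l k)⌉`, and it vanishes along `n = ⌈(k + 1/2) exp (l (k + 1/2))⌉`. -/
theorem not_tendsto_graphProb_exists_isSpecial {p : ℝ} (hp : p ∈ Set.Ioo (0 : ℝ) 1) (c : ℝ) :
    ¬ Tendsto (fun n : ℕ => graphProb p (fun G : SimpleGraph (Fin n) => ∃ f x, IsSpecial G f x))
      atTop (nhds c) := by
  intro h
  obtain ⟨hp0, hp1⟩ := hp
  obtain ⟨l, hpl⟩ : ∃ l, 1 - p = exp (-l) :=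
    ⟨-log (1 - p), by rw [neg_neg, exp_log (by linarith)]⟩
  have hl : 0 < l := by
    by_contra! hl
    have := one_le_exp (neg_nonneg.2 hl)
    linarith
  have hseq : ∀ K : ℕ → ℝ, Tendsto K atTop atTop →
      Tendsto (fun j => ⌈K j * exp (l * K j)⌉₊) atTop atTop := fun K hK =>
    tendsto_nat_ceil_atTop.comp (hK.atTop_mul_atTop₀
      (tendsto_exp_atTop.comp (hK.const_mul_atTop hl)))
  have hK : Tendsto (fun j : ℕ => (j : ℝ) + 1 / 2) atTop atTop :=
    tendsto_atTop_add_const_right _ _ tendsto_natCast_atTop_atTop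
  have hq : 0 < 1 - p := by linarith
  have hpos : 0 < (exp 9 / p ^ 6 + 12 / (p ^ 3 * exp (-6) / 2))⁻¹ := by positivity
  have hlower : (exp 9 / p ^ 6 + 12 / (p ^ 3 * exp (-6) / 2))⁻¹ ≤ c := by
    refine ge_of_tendsto (h.comp (hseq _ tendsto_natCast_atTop_atTop)) ?_
    filter_upwards [eventually_goodFor (c := p ^ 3 * (1 - p) ^ 3) hl (by positivity)] with k hk
    refine le_graphProb_exists_isSpecial (k := k) ⟨hp0, hp1⟩ hl hpl hk ?_ ?_ <;>
      rw [Fintype.card_fin]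
    · exact Nat.le_ceil _
    · exact (Nat.ceil_lt_add_one (by positivity)).le
  have hupper : c ≤ 0 := by
    refine le_of_tendsto_of_tendsto (h.comp (hseq _ hK)) ((tendsto_upperBound hl).comp hK) ?_
    filter_upwards [hK.eventually (eventually_largeFor hl)] with j hj
    obtain rfl : p = 1 - exp (-l) := by linarith
    refine graphProb_le_upperBound hl hj (fun k => ?_) ?_ ?_
    · rcases le_or_gt k j with hkj | hkj
      · have : (k : ℝ) ≤ j := by exact_mod_cast hkj
        rw [le_abs]
        right
        linarith
      · have : (j : ℝ) + 1 ≤ k := by exact_mod_cast hkj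
        rw [le_abs]
        left
        linarith
    · rw [Fintype.card_fin]
      exact Nat.le_ceil _
    · rw [Fintype.card_fin]
      exact (Nat.ceil_lt_add_one (by positivity)).le
  linarith

end RandomGraph

theorem stmt0 {p : ℝ} (hp : p ∈ Set.Ioo (0 : ℝ) 1) :
    ¬ ∃ c : ℝ, Tendsto (fun n : ℕ =>
      ((gnp n p) {G : SimpleGraph (Fin n) |
        ∃ (X₁ X₂ X₃ : Finset (Fin n)) (x₁ x₂ x₃ : Fin n),
          SpecialTuple G X₁ X₂ X₃ x₁ x₂ x₃}).toReal) atTop (nhds c) := by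
  rintro ⟨c, hc⟩
  simp only [RandomGraph.gnp_specialTuple hp] at hc
  exact RandomGraph.not_tendsto_graphProb_exists_isSpecial hp c hc
end

section
/- For positive integers k, ℓ, m with k + ℓ + m ≤ n, the expectation of X(k,ℓ,m) under G(n,p) equals (n!/(k!·ℓ!·m!·(n−k−ℓ−m)!)) · (k·ℓ·m) · (1−p)^{kℓ+ℓm+km−3} · p³ · [(1−(1−p)^k)(1−(1−p)^ℓ)(1−(1−p)^m)]^{n−k−ℓ−m}. -/
open MeasureTheory Filter Real

open Finset in
/-- The expectation of `f S` for a random subset `S` of `A` that contains each element of `A`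
independently with probability `p`. -/
noncomputable def binomialExp {α : Type*} (p : ℝ) (A : Finset α) (f : Finset α → ℝ) : ℝ :=
  ∑ S ∈ A.powerset, p ^ #S * (1 - p) ^ (#A - #S) * f S

section BinomialExp

open Finset

variable {α ι : Type*} {p : ℝ}

lemma binomialExp_congr {A : Finset α} {f g : Finset α → ℝ} (h : ∀ S ⊆ A, f S = g S) :
    binomialExp p A f = binomialExp p A g :=
  sum_congr rfl fun S hS => by rw [h S (mem_powerset.1 hS)]

lemma binomialExp_one (A : Finset α) : binomialExp p A (fun _ => 1) = 1 := by
  simp only [binomialExp, mul_one]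
  rw [Finset.sum_pow_mul_eq_add_pow]
  simp

lemma binomialExp_eq_singleton [DecidableEq α] {A : Finset α} {a : α} (ha : a ∈ A) :
    binomialExp p A (fun S => if S = {a} then 1 else 0) = p * (1 - p) ^ (#A - 1) := by
  simp [binomialExp, ha]

lemma binomialExp_nonempty (A : Finset α) :
    binomialExp p A (fun S => if S.Nonempty then 1 else 0) = 1 - (1 - p) ^ #A := by
  classical
  have h : binomialExp p A (fun S => if S.Nonempty then 1 else 0) +
      binomialExp p A (fun S => if S = ∅ then 1 else 0) = binomialExp p A (fun _ => 1) := by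
    simp only [binomialExp, ← sum_add_distrib, ← mul_add]
    refine sum_congr rfl fun S _ => ?_
    rcases S.eq_empty_or_nonempty with rfl | hS
    · simp
    · simp [hS, hS.ne_empty]
  have h0 : binomialExp p A (fun S => if S = ∅ then 1 else 0) = (1 - p) ^ #A := by
    simp [binomialExp]
  rw [h0, binomialExp_one] at h
  linarith

variable [DecidableEq α]

lemma binomialExp_union {A B : Finset α} (hAB : Disjoint A B) (f g : Finset α → ℝ) :
    binomialExp p (A ∪ B) (fun S => f (S ∩ A) * g (S ∩ B)) =
      binomialExp p A f * binomialExp p B g := by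
  simp only [binomialExp]
  rw [sum_mul_sum, ← sum_product']
  refine sum_nbij' (fun S => (S ∩ A, S ∩ B)) (fun T => T.1 ∪ T.2) ?_ ?_ ?_ ?_ ?_
  · intro S _
    simp
  · rintro ⟨S, T⟩ h
    simp only [mem_product, mem_powerset] at h ⊢
    exact union_subset_union h.1 h.2
  · intro S hS
    rw [mem_powerset] at hS
    simp only [← inter_union_distrib_left]
    exact inter_eq_left.2 hS
  · rintro ⟨S, T⟩ h
    simp only [mem_product, mem_powerset] at h
    have h1 : T ∩ A = ∅ := disjoint_iff_inter_eq_empty.1 (hAB.symm.mono_left h.2)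
    have h2 : S ∩ B = ∅ := disjoint_iff_inter_eq_empty.1 (hAB.mono_left h.1)
    simp [union_inter_distrib_right, h1, h2, inter_eq_left.2 h.1, inter_eq_left.2 h.2]
  · intro S hS
    rw [mem_powerset] at hS
    have hS' : #S = #(S ∩ A) + #(S ∩ B) := by
      rw [← card_union_of_disjoint (hAB.mono inter_subset_right inter_subset_right),
        ← inter_union_distrib_left, inter_eq_left.2 hS]
    have hA : #(S ∩ A) ≤ #A := card_le_card inter_subset_right
    have hB : #(S ∩ B) ≤ #B := card_le_card inter_subset_right
    have hsub : #A + #B - (#(S ∩ A) + #(S ∩ B)) = (#A - #(S ∩ A)) + (#B - #(S ∩ B)) := by omega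
    rw [card_union_of_disjoint hAB, hS', hsub, pow_add, pow_add]
    ring

lemma binomialExp_biUnion (s : Finset ι) (A : ι → Finset α)
    (hA : (s : Set ι).PairwiseDisjoint A) (f : ι → Finset α → ℝ) :
    binomialExp p (s.biUnion A) (fun S => ∏ i ∈ s, f i (S ∩ A i)) =
      ∏ i ∈ s, binomialExp p (A i) (f i) := by
  classical
  induction s using Finset.induction_on with
  | empty => simp [binomialExp]
  | insert a s ha ih =>
    rw [prod_insert ha, ← ih (hA.subset (by simp)), biUnion_insert, ← binomialExp_union]
    · refine binomialExp_congr fun S _ => ?_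
      rw [prod_insert ha]
      congr 1
      refine prod_congr rfl fun i hi => ?_
      rw [inter_assoc, inter_eq_right.2 (subset_biUnion_of_mem A hi)]
    · rw [disjoint_biUnion_right]
      intro i hi
      exact hA (by simp) (by simp [hi]) (by rintro rfl; exact ha hi)

/-- Functions of the traces of a binomial random set on disjoint subsets are independent. -/
lemma binomialExp_prod {E : Finset α} (s : Finset ι) (A : ι → Finset α)
    (hA : (s : Set ι).PairwiseDisjoint A) (hE : ∀ i ∈ s, A i ⊆ E) (f : ι → Finset α → ℝ) :
    binomialExp p E (fun S => ∏ i ∈ s, f i (S ∩ A i)) =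
      ∏ i ∈ s, binomialExp p (A i) (f i) := by
  have hs : s.biUnion A ⊆ E := biUnion_subset.2 hE
  have h := binomialExp_union (p := p) (disjoint_sdiff (s := s.biUnion A) (t := E))
    (fun S => ∏ i ∈ s, f i (S ∩ A i)) (fun _ => 1)
  rw [binomialExp_one, mul_one, binomialExp_biUnion s A hA, union_sdiff_of_subset hs] at h
  rw [← h]
  refine binomialExp_congr fun S _ => ?_
  rw [mul_one]
  refine prod_congr rfl fun i hi => ?_
  rw [inter_assoc, inter_eq_right.2 (subset_biUnion_of_mem A hi)]

end BinomialExp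

section CrossEdges

open Finset

variable {α : Type*} [DecidableEq α] {p : ℝ}

/-- The unordered pairs with one element in `U` and the other in `V`. -/
def crossEdges (U V : Finset α) : Finset (Sym2 α) :=
  (U ×ˢ V).image fun e => s(e.1, e.2)

lemma mem_crossEdges {U V : Finset α} {e : Sym2 α} :
    e ∈ crossEdges U V ↔ ∃ u ∈ U, ∃ v ∈ V, s(u, v) = e := by
  simp [crossEdges, and_assoc]

lemma mk_mem_crossEdges {U V : Finset α} {u v : α} (hu : u ∈ U) (hv : v ∈ V) :
    s(u, v) ∈ crossEdges U V :=
  mem_crossEdges.2 ⟨u, hu, v, hv, rfl⟩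

lemma card_crossEdges {U V : Finset α} (h : Disjoint U V) : #(crossEdges U V) = #U * #V := by
  rw [crossEdges, card_image_of_injOn, card_product]
  rintro ⟨a, b⟩ hab ⟨c, d⟩ hcd he
  simp only [coe_product, Set.mem_prod, mem_coe] at hab hcd
  rcases Sym2.eq_iff.1 he with ⟨rfl, rfl⟩ | ⟨rfl, rfl⟩
  · rfl
  · exact absurd hcd.2 (disjoint_left.1 h hab.1)

lemma disjoint_crossEdges {U V U' V' : Finset α} (h : Disjoint U U' ∨ Disjoint V V')
    (h' : Disjoint U V' ∨ Disjoint V U') : Disjoint (crossEdges U V) (crossEdges U' V') := by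
  rw [disjoint_left]
  intro e he he'
  obtain ⟨u, hu, v, hv, rfl⟩ := mem_crossEdges.1 he
  obtain ⟨a, ha, b, hb, hab⟩ := mem_crossEdges.1 he'
  rcases Sym2.eq_iff.1 hab with ⟨rfl, rfl⟩ | ⟨rfl, rfl⟩
  · exact h.elim (fun h => disjoint_left.1 h hu ha) (fun h => disjoint_left.1 h hv hb)
  · exact h'.elim (fun h => disjoint_left.1 h hu hb) (fun h => disjoint_left.1 h hv ha)

lemma crossEdges_subset_edgeFinset_top [Fintype α] {U V : Finset α} (h : Disjoint U V) :
    crossEdges U V ⊆ (⊤ : SimpleGraph α).edgeFinset := by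
  intro e he
  obtain ⟨u, hu, v, hv, rfl⟩ := mem_crossEdges.1 he
  simp only [SimpleGraph.mem_edgeFinset, SimpleGraph.mem_edgeSet, SimpleGraph.top_adj]
  exact disjoint_iff_ne.1 h u hu v hv

/-- Every element of `O` is joined to some element of `X` by a pair in `S`. -/
def Dominates (O X : Finset α) (S : Finset (Sym2 α)) : Prop :=
  ∀ v ∈ O, ∃ u ∈ X, s(v, u) ∈ S

/-- The only pair in `S` between `U` and `V` is `s(x, y)`. -/
def UniqueCross (U V : Finset α) (x y : α) (S : Finset (Sym2 α)) : Prop :=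
  ∀ u ∈ U, ∀ v ∈ V, (s(u, v) ∈ S ↔ u = x ∧ v = y)

lemma dominates_inter {O X : Finset α} {S : Finset (Sym2 α)} :
    Dominates O X (S ∩ crossEdges O X) ↔ Dominates O X S := by
  refine forall₂_congr fun v hv => exists_congr fun u => and_congr_right fun hu => ?_
  simp [mk_mem_crossEdges hv hu]

lemma uniqueCross_inter {U V : Finset α} {x y : α} {S : Finset (Sym2 α)} :
    UniqueCross U V x y (S ∩ crossEdges U V) ↔ UniqueCross U V x y S := by
  refine forall₂_congr fun u hu => forall₂_congr fun v hv => ?_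
  simp [mk_mem_crossEdges hu hv]

open scoped Classical in
lemma binomialExp_dominates {O X : Finset α} (h : Disjoint O X) :
    binomialExp p (crossEdges O X) (fun S => if Dominates O X S then 1 else 0) =
      (1 - (1 - p) ^ #X) ^ #O := by
  have hO : crossEdges O X = O.biUnion fun v => crossEdges {v} X := by
    ext e
    simp [mem_crossEdges]
  have hd : (O : Set α).PairwiseDisjoint fun v => crossEdges {v} X := by
    intro v hv w hw hvw
    refine disjoint_crossEdges (Or.inl (by simpa using hvw)) (Or.inl ?_)
    exact h.mono_left (by simpa using hv)
  have hp := binomialExp_biUnion (p := p) O _ hd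
    (fun _ S => if S.Nonempty then (1 : ℝ) else 0)
  rw [← hO] at hp
  have hcard : ∀ v ∈ O, binomialExp p (crossEdges {v} X)
      (fun S => if S.Nonempty then (1 : ℝ) else 0) = 1 - (1 - p) ^ #X := by
    intro v hv
    rw [binomialExp_nonempty, card_crossEdges (h.mono_left (by simpa using hv))]
    simp
  rw [prod_congr rfl hcard, prod_const] at hp
  rw [← hp]
  refine binomialExp_congr fun S _ => ?_
  rw [prod_ite_zero, prod_const_one]
  refine if_congr (forall₂_congr fun v hv => ?_) rfl rfl
  constructor
  · rintro ⟨u, hu, hvu⟩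
    exact ⟨s(v, u), mem_inter.2 ⟨hvu, mk_mem_crossEdges (mem_singleton_self v) hu⟩⟩
  · rintro ⟨e, he⟩
    obtain ⟨heS, he⟩ := mem_inter.1 he
    obtain ⟨w, hw, u, hu, rfl⟩ := mem_crossEdges.1 he
    rw [mem_singleton] at hw
    subst hw
    exact ⟨u, hu, heS⟩

open scoped Classical in
lemma binomialExp_uniqueCross {U V : Finset α} (h : Disjoint U V) {x y : α} (hx : x ∈ U)
    (hy : y ∈ V) :
    binomialExp p (crossEdges U V) (fun S => if UniqueCross U V x y S then 1 else 0) =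
      p * (1 - p) ^ (#U * #V - 1) := by
  rw [← card_crossEdges h, ← binomialExp_eq_singleton (mk_mem_crossEdges hx hy)]
  refine binomialExp_congr fun S hS => if_congr ?_ rfl rfl
  constructor
  · intro hu
    refine Finset.Subset.antisymm (fun e he => ?_) ?_
    · obtain ⟨u, hu', v, hv', rfl⟩ := mem_crossEdges.1 (hS he)
      obtain ⟨rfl, rfl⟩ := (hu u hu' v hv').1 he
      simp
    · rw [singleton_subset_iff]
      exact (hu x hx y hy).2 ⟨rfl, rfl⟩
  · rintro rfl u hu v hv
    rw [mem_singleton, Sym2.eq_iff]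
    constructor
    · rintro (h' | ⟨rfl, rfl⟩)
      · exact h'
      · exact absurd hy (disjoint_left.1 h hu)
    · exact Or.inl

end CrossEdges

section RandomGraph

open Finset

open scoped Classical in
lemma integral_gnp {n : ℕ} {p : ℝ} (hp : p ∈ Set.Ioo (0 : ℝ) 1) (F : SimpleGraph (Fin n) → ℝ) :
    ∫ G, F G ∂ gnp n p =
      ∑ G, p ^ #G.edgeFinset * (1 - p) ^ (n * (n - 1) / 2 - #G.edgeFinset) * F G := by
  have hp0 := hp.1.le
  have hp1 : 0 ≤ 1 - p := by linarith [hp.2]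
  have hmeas : Measurable F := fun _ _ => trivial
  rw [gnp, Measure.sum_fintype, integral_finsetSum_measure]
  · refine sum_congr rfl fun G _ => ?_
    rw [integral_smul_measure, integral_dirac' _ _ hmeas.stronglyMeasurable,
      ENNReal.toReal_ofReal (by positivity), smul_eq_mul, Nat.card_eq_fintype_card,
      ← SimpleGraph.edgeFinset_card]
  · intro G _
    refine Integrable.smul_measure ?_ ENNReal.ofReal_ne_top
    exact integrable_dirac' hmeas.stronglyMeasurable (by simp)

open scoped Classical in
lemma sum_graph_eq_binomialExp {n : ℕ} (p : ℝ) (f : Finset (Sym2 (Fin n)) → ℝ) :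
    ∑ G : SimpleGraph (Fin n), p ^ #G.edgeFinset *
      (1 - p) ^ (n * (n - 1) / 2 - #G.edgeFinset) * f G.edgeFinset =
      binomialExp p (⊤ : SimpleGraph (Fin n)).edgeFinset f := by
  rw [binomialExp, SimpleGraph.card_edgeFinset_top_eq_card_choose_two, Fintype.card_fin,
    Nat.choose_two_right]
  refine sum_bij (fun G _ => G.edgeFinset) ?_ ?_ ?_ ?_
  · intro G _
    rw [mem_powerset]
    exact SimpleGraph.edgeFinset_mono le_top
  · intro G _ H _ h
    exact SimpleGraph.edgeFinset_inj.1 h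
  · intro S hS
    refine ⟨SimpleGraph.fromEdgeSet S, mem_univ _, ?_⟩
    ext e
    have : e ∈ S → _ := fun he => mem_powerset.1 hS he
    induction e with
    | _ a b =>
    simp only [SimpleGraph.mem_edgeFinset, SimpleGraph.mem_edgeSet, SimpleGraph.top_adj,
      SimpleGraph.fromEdgeSet_adj, mem_coe, ne_eq] at this ⊢
    exact ⟨fun h => h.1, fun h => ⟨h, this h⟩⟩
  · intro G _
    rfl

/-- The conditions on a special tuple that do not involve the graph. -/
def ValidTuple {n : ℕ} (k l m : ℕ)
    (t : Finset (Fin n) × Finset (Fin n) × Finset (Fin n) × Fin n × Fin n × Fin n) : Prop :=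
  (#t.1 = k ∧ (#t.2.1 = l ∧ Disjoint t.1 t.2.1) ∧
    (#t.2.2.1 = m ∧ Disjoint t.1 t.2.2.1 ∧ Disjoint t.2.1 t.2.2.1)) ∧
    t.2.2.2.1 ∈ t.1 ∧ t.2.2.2.2.1 ∈ t.2.1 ∧ t.2.2.2.2.2 ∈ t.2.2.1

open scoped Classical in
lemma card_validTuple (n k l m : ℕ) :
    #{t | ValidTuple (n := n) k l m t} =
      n.choose k * ((n - k).choose l * ((n - k - l).choose m * (k * l * m))) := by
  have hx : ∀ X₁ X₂ X₃ : Finset (Fin n), (∑ x₁, ∑ x₂, ∑ x₃,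
      if ValidTuple k l m (X₁, X₂, X₃, x₁, x₂, x₃) then 1 else 0) =
      if #X₁ = k then if #X₂ = l ∧ Disjoint X₁ X₂ then
        if #X₃ = m ∧ Disjoint X₁ X₃ ∧ Disjoint X₂ X₃ then k * l * m else 0 else 0 else 0 := by
    intro X₁ X₂ X₃
    simp only [ValidTuple]
    split_ifs with h₁ h₂ h₃
    · simp only [h₁, h₂, h₃, true_and, and_true, ite_and, sum_ite_mem, univ_inter, sum_const,
        smul_eq_mul, mul_one, sum_ite_irrel]
      simp [h₁, h₂.1, mul_assoc]
    all_goals simp [*]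
  rw [card_filter]
  simp only [Fintype.sum_prod_type, hx, sum_ite_irrel, sum_const_zero]
  have h₃ : ∀ X₁ X₂ : Finset (Fin n), #X₁ = k → #X₂ = l ∧ Disjoint X₁ X₂ →
      (∑ X₃ : Finset (Fin n), if #X₃ = m ∧ Disjoint X₁ X₃ ∧ Disjoint X₂ X₃ then k * l * m
        else 0) = (n - k - l).choose m * (k * l * m) := by
    rintro X₁ X₂ h₁ ⟨h₂, hd⟩
    have : ({X₃ | #X₃ = m ∧ Disjoint X₁ X₃ ∧ Disjoint X₂ X₃} : Finset (Finset (Fin n))) =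
        powersetCard m (X₁ ∪ X₂)ᶜ := by
      ext X
      simp only [mem_filter, mem_univ, true_and, mem_powersetCard, subset_compl_iff_disjoint_left,
        disjoint_union_left]
      tauto
    rw [← sum_filter, this, sum_const, card_powersetCard, card_compl, card_union_of_disjoint hd,
      Fintype.card_fin, h₁, h₂, Nat.sub_sub, smul_eq_mul]
  have h₂ : ∀ X₁ : Finset (Fin n), #X₁ = k →
      (∑ X₂ : Finset (Fin n), if #X₂ = l ∧ Disjoint X₁ X₂ then
        (∑ X₃ : Finset (Fin n), if #X₃ = m ∧ Disjoint X₁ X₃ ∧ Disjoint X₂ X₃ then k * l * m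
          else 0) else 0) = (n - k).choose l * ((n - k - l).choose m * (k * l * m)) := by
    intro X₁ h₁
    have : ({X₂ | #X₂ = l ∧ Disjoint X₁ X₂} : Finset (Finset (Fin n))) =
        powersetCard l X₁ᶜ := by
      ext X
      simp only [mem_filter, mem_univ, true_and, mem_powersetCard, subset_compl_iff_disjoint_left]
      tauto
    rw [← sum_filter, sum_congr rfl fun X hX => h₃ X₁ X h₁ (mem_filter.1 hX).2, this, sum_const,
      card_powersetCard, card_compl, Fintype.card_fin, h₁, smul_eq_mul]
  have h₁ : ({X₁ | #X₁ = k} : Finset (Finset (Fin n))) = powersetCard k univ := by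
    ext X
    simp
  rw [← sum_filter, sum_congr rfl fun X hX => h₂ X (mem_filter.1 hX).2, h₁, sum_const,
    card_powersetCard, card_univ, Fintype.card_fin, smul_eq_mul]

open scoped Classical in
/-- The probability that a valid tuple is special. -/
lemma sum_specialTuple {n k l m : ℕ} (p : ℝ) {X₁ X₂ X₃ : Finset (Fin n)} {x₁ x₂ x₃ : Fin n}
    (ht : ValidTuple k l m (X₁, X₂, X₃, x₁, x₂, x₃)) :
    (∑ G : SimpleGraph (Fin n), p ^ #G.edgeFinset *
      (1 - p) ^ (n * (n - 1) / 2 - #G.edgeFinset) *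
      if SpecialTuple G X₁ X₂ X₃ x₁ x₂ x₃ then 1 else 0) =
      (1 - p) ^ (k * l + l * m + k * m - 3) * p ^ 3 *
        ((1 - (1 - p) ^ k) * (1 - (1 - p) ^ l) * (1 - (1 - p) ^ m)) ^ (n - k - l - m) := by
  obtain ⟨⟨hk, ⟨hl, h₁₂⟩, hm, h₁₃, h₂₃⟩, hx₁, hx₂, hx₃⟩ := ht
  dsimp only at hk hl hm h₁₂ h₁₃ h₂₃ hx₁ hx₂ hx₃
  set O : Finset (Fin n) := (X₁ ∪ X₂ ∪ X₃)ᶜ with hO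
  have hO₁ : Disjoint O X₁ := disjoint_compl_left.mono_right (by grind)
  have hO₂ : Disjoint O X₂ := disjoint_compl_left.mono_right (by grind)
  have hO₃ : Disjoint O X₃ := disjoint_compl_left.mono_right (by grind)
  have hOcard : #O = n - k - l - m := by
    rw [hO, card_compl, Fintype.card_fin, card_union_of_disjoint (disjoint_union_left.2 ⟨h₁₃, h₂₃⟩),
      card_union_of_disjoint h₁₂, hk, hl, hm]
    omega
  let A : Fin 6 → Finset (Sym2 (Fin n)) := ![crossEdges O X₁, crossEdges O X₂, crossEdges O X₃,
    crossEdges X₁ X₂, crossEdges X₁ X₃, crossEdges X₂ X₃]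
  let f : Fin 6 → Finset (Sym2 (Fin n)) → ℝ :=
    ![fun S => if Dominates O X₁ S then 1 else 0, fun S => if Dominates O X₂ S then 1 else 0,
      fun S => if Dominates O X₃ S then 1 else 0,
      fun S => if UniqueCross X₁ X₂ x₁ x₂ S then 1 else 0,
      fun S => if UniqueCross X₁ X₃ x₁ x₃ S then 1 else 0,
      fun S => if UniqueCross X₂ X₃ x₂ x₃ S then 1 else 0]
  have hA : ((univ : Finset (Fin 6)) : Set (Fin 6)).PairwiseDisjoint A := by
    intro i _ j _ hij
    fin_cases i <;> fin_cases j <;> first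
      | exact absurd rfl hij
      | exact disjoint_crossEdges
          (by simp only [hO₁, hO₂, h₁₂, h₁₃, h₂₃, hO₁.symm, hO₂.symm, h₁₂.symm,
            h₁₃.symm, h₂₃.symm, true_or, or_true])
          (by simp only [hO₁, hO₂, hO₃, h₁₂, h₁₃, h₂₃, hO₁.symm, hO₂.symm, hO₃.symm, h₁₂.symm,
            h₁₃.symm, h₂₃.symm, true_or, or_true])
  have hAE : ∀ i ∈ univ, A i ⊆ (⊤ : SimpleGraph (Fin n)).edgeFinset := by
    intro i _
    fin_cases i <;> exact crossEdges_subset_edgeFinset_top (by assumption)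
  have key := binomialExp_prod (p := p) univ A hA hAE f
  rw [← sum_graph_eq_binomialExp] at key
  calc _ = _ := by
        refine sum_congr rfl fun G _ => ?_
        congr 1
        have hG : SpecialTuple G X₁ X₂ X₃ x₁ x₂ x₃ ↔
            Dominates O X₁ G.edgeFinset ∧ Dominates O X₂ G.edgeFinset ∧
            Dominates O X₃ G.edgeFinset ∧ UniqueCross X₁ X₂ x₁ x₂ G.edgeFinset ∧
            UniqueCross X₁ X₃ x₁ x₃ G.edgeFinset ∧ UniqueCross X₂ X₃ x₂ x₃ G.edgeFinset := by
          simp only [SpecialTuple, Dominates, UniqueCross, SimpleGraph.mem_edgeFinset,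
            SimpleGraph.mem_edgeSet, hO, mem_compl, mem_union, not_or, h₁₂, h₁₃, h₂₃, hx₁, hx₂,
            hx₃, true_and]
          constructor
          · rintro ⟨h, h'⟩
            exact ⟨fun v hv => (h v hv.1.1 hv.1.2 hv.2).1, fun v hv => (h v hv.1.1 hv.1.2 hv.2).2.1,
              fun v hv => (h v hv.1.1 hv.1.2 hv.2).2.2, h'⟩
          · rintro ⟨h₁, h₂, h₃, h'⟩
            exact ⟨fun v hv₁ hv₂ hv₃ => ⟨h₁ v ⟨⟨hv₁, hv₂⟩, hv₃⟩, h₂ v ⟨⟨hv₁, hv₂⟩, hv₃⟩,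
              h₃ v ⟨⟨hv₁, hv₂⟩, hv₃⟩⟩, h'⟩
        have hf : ∏ i, f i (G.edgeFinset ∩ A i) = ∏ i, f i G.edgeFinset := by
          refine prod_congr rfl fun i _ => ?_
          fin_cases i
          iterate 3 exact if_congr dominates_inter rfl rfl
          iterate 3 exact if_congr uniqueCross_inter rfl rfl
        rw [hf, Fin.prod_univ_six]
        simp only [f, Matrix.cons_val, mul_ite, mul_one, mul_zero, ← ite_and]
        exact if_congr (by rw [hG]; tauto) rfl rfl
    _ = _ := key
    _ = _ := by
        have e₁ : binomialExp p (A 0) (f 0) = _ := binomialExp_dominates hO₁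
        have e₂ : binomialExp p (A 1) (f 1) = _ := binomialExp_dominates hO₂
        have e₃ : binomialExp p (A 2) (f 2) = _ := binomialExp_dominates hO₃
        have e₄ : binomialExp p (A 3) (f 3) = _ := binomialExp_uniqueCross h₁₂ hx₁ hx₂
        have e₅ : binomialExp p (A 4) (f 4) = _ := binomialExp_uniqueCross h₁₃ hx₁ hx₃
        have e₆ : binomialExp p (A 5) (f 5) = _ := binomialExp_uniqueCross h₂₃ hx₂ hx₃
        rw [Fin.prod_univ_six, e₁, e₂, e₃, e₄, e₅, e₆, hOcard, hk, hl, hm]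
        have hk0 : 0 < k := hk ▸ card_pos.2 ⟨x₁, hx₁⟩
        have hl0 : 0 < l := hl ▸ card_pos.2 ⟨x₂, hx₂⟩
        have hm0 : 0 < m := hm ▸ card_pos.2 ⟨x₃, hx₃⟩
        have hkl := Nat.mul_pos hk0 hl0
        have hlm := Nat.mul_pos hl0 hm0
        have hkm := Nat.mul_pos hk0 hm0
        have hexp : k * l + l * m + k * m - 3 = (k * l - 1) + (k * m - 1) + (l * m - 1) := by omega
        rw [hexp, pow_add, pow_add, mul_pow, mul_pow]
        ring

open scoped Classical in
lemma countX_eq_sum {n : ℕ} (G : SimpleGraph (Fin n)) (k l m : ℕ) :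
    (countX G k l m : ℝ) = ∑ t with ValidTuple (n := n) k l m t,
      if SpecialTuple G t.1 t.2.1 t.2.2.1 t.2.2.2.1 t.2.2.2.2.1 t.2.2.2.2.2 then 1 else 0 := by
  rw [countX, Nat.card_eq_fintype_card, Fintype.card_subtype, sum_boole, filter_filter]
  congr 2
  refine filter_congr fun t _ => ?_
  simp only [ValidTuple, SpecialTuple]
  tauto

lemma choose_mul_choose_mul_choose {n k l m : ℕ} (h : k + l + m ≤ n) :
    (n.choose k * ((n - k).choose l * (n - k - l).choose m) : ℝ) = (n.factorial : ℝ) /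
      (k.factorial * l.factorial * m.factorial * (n - k - l - m).factorial) := by
  rw [Nat.cast_choose ℝ (by omega : k ≤ n), Nat.cast_choose ℝ (by omega : l ≤ n - k),
    Nat.cast_choose ℝ (by omega : m ≤ n - k - l)]
  have := fun a : ℕ => (Nat.cast_ne_zero (R := ℝ)).2 a.factorial_ne_zero
  field_simp

end RandomGraph

theorem stmt1 {p : ℝ} (hp : p ∈ Set.Ioo (0 : ℝ) 1) {n k l m : ℕ}
    (hk : 0 < k) (hl : 0 < l) (hm : 0 < m) (h : k + l + m ≤ n) :
    expX n p k l m =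
      (n.factorial : ℝ) /
        (k.factorial * l.factorial * m.factorial * (n - k - l - m).factorial) *
        ((k : ℝ) * l * m) * (1 - p) ^ (k * l + l * m + k * m - 3) * p ^ 3 *
        ((1 - (1 - p) ^ k) * (1 - (1 - p) ^ l) * (1 - (1 - p) ^ m)) ^ (n - k - l - m) := by
  classical
  rw [expX, integral_gnp hp]
  simp_rw [countX_eq_sum, Finset.mul_sum]
  rw [Finset.sum_comm, Finset.sum_congr rfl fun t ht =>
    sum_specialTuple p (Finset.mem_filter.1 ht).2, Finset.sum_const, card_validTuple,
    ← choose_mul_choose_mul_choose h, nsmul_eq_mul]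
  push_cast
  ring
end
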